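/- arXiv:0905.1978 — 3 statements merged into one kernel-verified Lean document; each statement's English description precedes it below -/
import Mathlib

section
/- Let n ≥ 3 be an integer and let K be a continuum. Suppose 𝒱 is a finite open cover of K whose nerve is a simple-n-od with distinguished element V_0, and 𝒲 is a finite open cover of K refining 𝒱 whose nerve is a simple-(n−1)-od with distinguished element W_0. Then there exist an integer ñ with 1 ≤ ñ ≤ n−1 and an amalgamation 𝒰 of 𝒲 which refines 𝒱 such that the nerve of 𝒰 is a simple-ñ-od with distinguished element U_0 and U_0 ⊆ V_0. -/
/-! ## Simple-m-od covers (nerve combinatorics) -/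

/-- A finite indexed open cover of `K` whose nerve is a simple-`m`-od with
distinguished element `U₀`: the cover consists of `U₀` together with `m`
pairwise disjoint linear chains `U i 1, …, U i (μ i)`, with the prescribed
intersection pattern (writing `U i 0 = U₀` for every `i`). -/
structure SimpleOdCover (K : Type*) [MetricSpace K] (m : ℕ) where
  U₀ : Set K
  μ : Fin m → ℕ
  U : Fin m → ℕ → Set K
  base : ∀ i, U i 0 = U₀
  one_le : ∀ i, 1 ≤ μ i
  isOpen₀ : IsOpen U₀
  nonempty₀ : U₀.Nonempty
  isOpen' : ∀ i j, 1 ≤ j → j ≤ μ i → IsOpen (U i j)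
  nonempty' : ∀ i j, 1 ≤ j → j ≤ μ i → (U i j).Nonempty
  covers : (U₀ ∪ ⋃ i, ⋃ j ∈ Set.Icc 1 (μ i), U i j) = Set.univ
  distinct : ∀ i j i' j', j ≤ μ i → j' ≤ μ i' → U i j = U i' j' →
    (j = 0 ∧ j' = 0) ∨ (i = i' ∧ j = j')
  inter_iff : ∀ i j i' j', j ≤ μ i → j' ≤ μ i' →
    ((U i j ∩ U i' j').Nonempty ↔
      (i = i' ∧ j ≤ j' + 1 ∧ j' ≤ j + 1) ∨ (min j j' = 0 ∧ max j j' ≤ 1))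

namespace SimpleOdCover

variable {K : Type*} [MetricSpace K] {m m' : ℕ}

/-- The elements of the cover. -/
def mem (C : SimpleOdCover K m) (s : Set K) : Prop :=
  s = C.U₀ ∨ ∃ i j, 1 ≤ j ∧ j ≤ C.μ i ∧ s = C.U i j

/-- The mesh of the cover is `< ε`. -/
def MeshLT (C : SimpleOdCover K m) (ε : ℝ) : Prop :=
  Metric.diam C.U₀ < ε ∧ ∀ i j, 1 ≤ j → j ≤ C.μ i → Metric.diam (C.U i j) < ε

/-- `W` refines `V`: every element of `W` is contained in some element of `V`. -/
def Refines (W : SimpleOdCover K m) (V : SimpleOdCover K m') : Prop :=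
  ∀ s, W.mem s → ∃ t, V.mem t ∧ s ⊆ t

/-- `A` is an amalgamation of `W`: every element of `A` is a union of elements of `W`. -/
def IsAmalgamationOf (A : SimpleOdCover K m) (W : SimpleOdCover K m') : Prop :=
  ∀ s, A.mem s → ∃ 𝒮 : Set (Set K), (∀ u ∈ 𝒮, W.mem u) ∧ s = ⋃₀ 𝒮

end SimpleOdCover

/-- `K` is simple-`m`-od-like in the covering sense. -/
def SimpleOdLikeCov (K : Type*) [MetricSpace K] (m : ℕ) : Prop :=
  ∀ ε : ℝ, 0 < ε → ∃ C : SimpleOdCover K m, C.MeshLT ε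

/-- `v` is a branch point of `K` of order `m`. -/
def IsBranchPointOfOrder {K : Type*} [MetricSpace K] (v : K) (m : ℕ) : Prop :=
  ∀ ε : ℝ, 0 < ε → ∃ C : SimpleOdCover K m, C.MeshLT ε ∧ v ∈ C.U₀

namespace SimpleOdCover

theorem mem_U {K : Type*} [MetricSpace K] {m : ℕ} (C : SimpleOdCover K m) {i : Fin m} {j : ℕ}
    (hj : j ≤ C.μ i) : C.mem (C.U i j) := by
  rcases Nat.eq_zero_or_pos j with rfl | h
  · exact Or.inl (C.base i)
  · exact Or.inr ⟨i, j, h, hj, rfl⟩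

theorem isOpen_U {K : Type*} [MetricSpace K] {m : ℕ} (C : SimpleOdCover K m) {i : Fin m} {j : ℕ}
    (hj : j ≤ C.μ i) : IsOpen (C.U i j) := by
  rcases Nat.eq_zero_or_pos j with rfl | h
  · exact C.base i ▸ C.isOpen₀
  · exact C.isOpen' i j h hj

theorem nonempty_U {K : Type*} [MetricSpace K] {m : ℕ} (C : SimpleOdCover K m) {i : Fin m} {j : ℕ}
    (hj : j ≤ C.μ i) : (C.U i j).Nonempty := by
  rcases Nat.eq_zero_or_pos j with rfl | h
  · exact C.base i ▸ C.nonempty₀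
  · exact C.nonempty' i j h hj

theorem exists_mem_U {K : Type*} [MetricSpace K] {m : ℕ} (C : SimpleOdCover K m) (i₀ : Fin m)
    (x : K) : ∃ i j, j ≤ C.μ i ∧ x ∈ C.U i j := by
  have hx : x ∈ C.U₀ ∪ ⋃ i, ⋃ j ∈ Set.Icc 1 (C.μ i), C.U i j := C.covers ▸ Set.mem_univ x
  rcases hx with hx | hx
  · exact ⟨i₀, 0, Nat.zero_le _, by rwa [C.base]⟩
  · simp only [Set.mem_iUnion, Set.mem_Icc] at hx
    obtain ⟨i, j, hj, hx⟩ := hx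
    exact ⟨i, j, hj.2, hx⟩

/-- In a connected space, an open star-shaped family in which only the centre and the ends of the
legs are known to be nonempty, and only the absence of unwanted intersections is known, has
consecutive elements intersecting. -/
theorem inter_succ_nonempty {K ι : Type*} [TopologicalSpace K] [PreconnectedSpace K]
    {μ : ι → ℕ} {U : ι → ℕ → Set K} (hopen : ∀ i j, j ≤ μ i → IsOpen (U i j))
    (hzero : ∀ i, (U i 0).Nonempty) (hlast : ∀ i, (U i (μ i)).Nonempty)
    (hbase : ∀ i i', U i 0 = U i' 0)
    (hcov : ∀ x, ∃ i j, j ≤ μ i ∧ x ∈ U i j)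
    (hsep : ∀ i j i' j', j ≤ μ i → j' ≤ μ i' → (U i j ∩ U i' j').Nonempty →
      (i = i' ∧ j ≤ j' + 1 ∧ j' ≤ j + 1) ∨ (min j j' = 0 ∧ max j j' ≤ 1))
    (i : ι) (j : ℕ) (hj : j + 1 ≤ μ i) : (U i j ∩ U i (j + 1)).Nonempty := by
  have key := isPreconnected_univ (α := K)
    (⋃ (j' : ℕ) (_ : j < j' ∧ j' ≤ μ i), U i j')
    (⋃ (i' : ι) (j' : ℕ) (_ : j' ≤ μ i' ∧ (i' = i → j' ≤ j)), U i' j')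
    (isOpen_iUnion fun j' => isOpen_iUnion fun h => hopen _ _ h.2)
    (isOpen_iUnion fun i' => isOpen_iUnion fun j' => isOpen_iUnion fun h => hopen _ _ h.1)
    (by
      intro x _
      obtain ⟨i', j', h, hx⟩ := hcov x
      by_cases hc : i' = i ∧ j < j'
      · obtain ⟨rfl, hc⟩ := hc
        left
        simp only [Set.mem_iUnion]
        exact ⟨j', ⟨hc, h⟩, hx⟩
      · right
        simp only [Set.mem_iUnion]
        exact ⟨i', j', ⟨h, fun e => by grind⟩, hx⟩)
    (by
      obtain ⟨x, hx⟩ := hlast i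
      refine ⟨x, trivial, ?_⟩
      simp only [Set.mem_iUnion]
      exact ⟨μ i, ⟨hj, le_rfl⟩, hx⟩)
    (by
      obtain ⟨x, hx⟩ := hzero i
      refine ⟨x, trivial, ?_⟩
      simp only [Set.mem_iUnion]
      exact ⟨i, 0, ⟨Nat.zero_le _, fun _ => Nat.zero_le _⟩, hx⟩)
  obtain ⟨x, -, hx, hx'⟩ := key
  simp only [Set.mem_iUnion] at hx hx'
  obtain ⟨p, ⟨hjp, hp⟩, hxp⟩ := hx
  obtain ⟨i', q, ⟨hq, hqj⟩, hxq⟩ := hx'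
  rcases hsep i p i' q hp hq ⟨x, hxp, hxq⟩ with ⟨rfl, h1, h2⟩ | ⟨h1, h2⟩
  · have hqj' := hqj rfl
    obtain rfl : q = j := by omega
    obtain rfl : p = q + 1 := by omega
    exact ⟨x, hxq, hxp⟩
  · obtain rfl : q = 0 := by omega
    obtain rfl : p = 1 := by omega
    obtain rfl : j = 0 := by omega
    exact ⟨x, hbase i' i ▸ hxq, hxp⟩

/-- A star-shaped open cover of a connected space with no unwanted intersections, nonempty centre
and nonempty ends of legs, and with centre not everything, has a simple-od as its nerve. -/
theorem exists_of_separated {K ι : Type*} [MetricSpace K] [PreconnectedSpace K]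
    [Fintype ι] [Nonempty ι] {U₀ : Set K} {μ : ι → ℕ} {U : ι → ℕ → Set K}
    (hbase : ∀ i, U i 0 = U₀) (hμ : ∀ i, 1 ≤ μ i)
    (hopen : ∀ i j, j ≤ μ i → IsOpen (U i j))
    (hzero : U₀.Nonempty) (hlast : ∀ i, (U i (μ i)).Nonempty)
    (hcov : ∀ x, ∃ i j, j ≤ μ i ∧ x ∈ U i j) (huniv : U₀ ≠ Set.univ)
    (hsep : ∀ i j i' j', j ≤ μ i → j' ≤ μ i' → (U i j ∩ U i' j').Nonempty →
      (i = i' ∧ j ≤ j' + 1 ∧ j' ≤ j + 1) ∨ (min j j' = 0 ∧ max j j' ≤ 1)) :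
    ∃ C : SimpleOdCover K (Fintype.card ι),
      C.U₀ = U₀ ∧ ∀ s, C.mem s → ∃ i j, j ≤ μ i ∧ s = U i j := by
  have hsucc := inter_succ_nonempty hopen (fun i => by rwa [hbase]) hlast
    (fun i i' => by rw [hbase, hbase]) hcov hsep
  have hne : ∀ i j, j ≤ μ i → (U i j).Nonempty := by
    rintro i (_ | j) hj
    · rwa [hbase]
    · exact (hsucc i j hj).mono Set.inter_subset_right
  have hinter : ∀ i j i' j', j ≤ μ i → j' ≤ μ i' → ((U i j ∩ U i' j').Nonempty ↔
      (i = i' ∧ j ≤ j' + 1 ∧ j' ≤ j + 1) ∨ (min j j' = 0 ∧ max j j' ≤ 1)) := by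
    intro i j i' j' hj hj'
    refine ⟨hsep i j i' j' hj hj', ?_⟩
    have hleg : ∀ i j j', j ≤ μ i → j' ≤ μ i → j ≤ j' + 1 → j' ≤ j + 1 →
        (U i j ∩ U i j').Nonempty := by
      intro i j j' hj hj' h1 h2
      obtain rfl | rfl | rfl : j = j' ∨ j' = j + 1 ∨ j = j' + 1 := by omega
      · rw [Set.inter_self]
        exact hne i j hj
      · exact hsucc i j hj'
      · rw [Set.inter_comm]
        exact hsucc i j' hj
    rintro (⟨rfl, h1, h2⟩ | ⟨h1, h2⟩)
    · exact hleg i j j' hj hj' h1 h2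
    · rcases Nat.eq_zero_or_pos j with rfl | hpos
      · rw [hbase i, ← hbase i']
        exact hleg i' 0 j' (Nat.zero_le _) hj' (Nat.zero_le _) (by omega)
      · obtain rfl : j' = 0 := by omega
        rw [hbase i', ← hbase i]
        exact hleg i j 0 hj (Nat.zero_le _) (by omega) (Nat.zero_le _)
  have hstep : ∀ i j, j + 1 ≤ μ i → U i j ≠ U i (j + 1) := by
    intro i j hj he
    rcases Nat.eq_zero_or_pos j with rfl | hpos
    · apply huniv
      refine Set.eq_univ_of_forall fun x => ?_
      by_contra hx
      obtain ⟨i', j', hj', hxj⟩ := hcov x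
      have hj0 : j' ≠ 0 := by
        rintro rfl
        exact hx (hbase i' ▸ hxj)
      by_cases hi : i' = i
      · subst hi
        by_cases hj1 : j' = 1
        · subst hj1
          exact hx (hbase i' ▸ he ▸ hxj)
        · have h1 := (hinter i' 1 i' 2 (by omega) (by omega)).2 (Or.inl ⟨rfl, by omega, by omega⟩)
          rw [zero_add] at he
          rw [← he] at h1
          have := hsep _ _ _ _ (by omega) (by omega) h1
          omega
      · have h1 := (hinter i 0 i' 1 (by omega) (by omega)).2 (Or.inr ⟨by omega, by omega⟩)
        rw [he] at h1
        have := hsep _ _ _ _ (by omega) (by omega) h1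
        rcases this with ⟨h, -⟩ | h
        · exact hi h.symm
        · omega
    · have h1 := (hinter i (j - 1) i j (by omega) (by omega)).2 (Or.inl ⟨rfl, by omega, by omega⟩)
      rw [he] at h1
      have := hsep _ _ _ _ (by omega) (by omega) h1
      omega
  have hdist : ∀ i j i' j', j ≤ μ i → j' ≤ μ i' → U i j = U i' j' →
      (j = 0 ∧ j' = 0) ∨ (i = i' ∧ j = j') := by
    intro i j i' j' hj hj' he
    have h1 : (U i j ∩ U i' j').Nonempty := by
      rw [← he, Set.inter_self]
      exact hne i j hj
    by_contra hcon
    rcases hsep i j i' j' hj hj' h1 with ⟨rfl, h2, h3⟩ | ⟨h2, h3⟩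
    · obtain rfl | rfl | rfl : j = j' ∨ j' = j + 1 ∨ j = j' + 1 := by omega
      · exact hcon (Or.inr ⟨rfl, rfl⟩)
      · exact hstep i j hj' he
      · exact hstep i j' hj he.symm
    · obtain ⟨rfl, rfl⟩ | ⟨rfl, rfl⟩ : (j = 0 ∧ j' = 1) ∨ (j = 1 ∧ j' = 0) := by omega
      · exact hstep i' 0 hj' (by rw [hbase i', ← hbase i, he])
      · exact hstep i 0 hj (by rw [hbase i, ← hbase i', he])
  let e := (Fintype.equivFin ι).symm
  refine ⟨⟨U₀, fun i => μ (e i), fun i => U (e i), fun i => hbase _, fun i => hμ _,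
    ?_, hzero, fun i j _ h => hopen _ _ h, fun i j _ h => hne _ _ h, ?_, ?_, ?_⟩, rfl, ?_⟩
  · obtain ⟨i⟩ := ‹Nonempty ι›
    exact hbase i ▸ hopen i 0 (Nat.zero_le _)
  · refine Set.eq_univ_of_forall fun x => ?_
    obtain ⟨i, j, hj, hx⟩ := hcov x
    rcases Nat.eq_zero_or_pos j with rfl | hpos
    · exact Or.inl (hbase i ▸ hx)
    · right
      simp only [Set.mem_iUnion, Set.mem_Icc]
      exact ⟨e.symm i, j, ⟨hpos, by simpa using hj⟩, by simpa using hx⟩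
  · intro i j i' j' hj hj' he
    simpa using hdist _ _ _ _ hj hj' he
  · intro i j i' j' hj hj'
    simpa using hinter _ _ _ _ hj hj'
  · obtain ⟨i₁⟩ := ‹Nonempty ι›
    rintro s (rfl | ⟨i, j, -, hj, rfl⟩)
    · exact ⟨i₁, 0, Nat.zero_le _, (hbase i₁).symm⟩
    · exact ⟨e i, j, hj, rfl⟩

/-- The vertex `(i, j)` of a star with legs of length `μ` is sent to the vertex `(c, l)` by the
collapse: `a` records where the initial parts of the legs end, `L` is the level on the initial
parts, and on the leg `i₀` the initial part is cut at `t`, above which it is continued past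
level `M`. -/
def Collapses {ι : Type*} (a : ι → ℕ) (L : ι → ℕ → ℕ) (i₀ : ι) (t M : ℕ)
    (c : ι) (l : ℕ) (i : ι) (j : ℕ) : Prop :=
  (l = 0 ∧ i ≠ i₀ ∧ j = a i) ∨
    (c = i₀ ∧ 1 ≤ l ∧ l ≤ M ∧ j < a i ∧ (i = i₀ → j ≤ t) ∧ L i j = l) ∨
    (c = i₀ ∧ M < l ∧ i = i₀ ∧ j + M = t + l) ∨
    (c ≠ i₀ ∧ 1 ≤ l ∧ i = c ∧ j = a i + l)

theorem collapse_adjacent {ι : Type*} {μ a : ι → ℕ} {L : ι → ℕ → ℕ} {i₀ : ι} {t M l₀ : ℕ}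
    (hL₀ : ∀ i, L i 0 = l₀) {c c' i i' : ι} {l l' j j' : ℕ}
    (hai : 1 ≤ a i) (hai' : 1 ≤ a i') (htM : t < μ i₀ → L i₀ t = M)
    (hj : j ≤ μ i) (hj' : j' ≤ μ i')
    (h00 : j = a i → j' < a i' → L i' j' ≤ 1) (h01 : j' = a i' → j < a i → L i j ≤ 1)
    (h11 : j < a i → j' < a i' → L i j ≤ L i' j' + 1 ∧ L i' j' ≤ L i j + 1)
    (hadj : (i = i' ∧ j ≤ j' + 1 ∧ j' ≤ j + 1) ∨ (min j j' = 0 ∧ max j j' ≤ 1))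
    (hp : Collapses a L i₀ t M c l i j) (hp' : Collapses a L i₀ t M c' l' i' j') :
    (c = c' ∧ l ≤ l' + 1 ∧ l' ≤ l + 1) ∨ (min l l' = 0 ∧ max l l' ≤ 1) := by
  have hcr : ∀ i j i' j' l l', 1 ≤ l → l ≤ M → j < a i → (i = i₀ → j ≤ t) → L i j = l →
      M < l' → i' = i₀ → j' + M = t + l' → j' ≤ μ i' →
      (i = i' ∧ j ≤ j' + 1 ∧ j' ≤ j + 1 ∨ min j j' = 0 ∧ max j j' ≤ 1) →
      l ≤ l' + 1 ∧ l' ≤ l + 1 := by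
    rintro i j i' j' l l' h2 h3 h4 h5 h6 g2 rfl g4 hj' hadj
    have hLM := htM (by omega)
    rcases hadj with ⟨rfl, hadj⟩ | hadj
    · have h7 := h5 rfl
      obtain rfl : j = t := by omega
      omega
    · obtain rfl : j = 0 := by omega
      obtain rfl : t = 0 := by omega
      rw [hL₀] at h6 hLM
      omega
  have hfar : i ≠ i' → min j j' = 0 ∧ max j j' ≤ 1 := fun h => hadj.resolve_left fun h' => h h'.1
  have hnear : j ≤ j' + 1 ∧ j' ≤ j + 1 := by
    rcases hadj with h | h <;> omega
  rcases hp with ⟨h1, h2, h3⟩ | ⟨h1, h2, h3, h4, h5, h6⟩ | ⟨h1, h2, h3, h4⟩ | ⟨h1, h2, h3, h4⟩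
  · rcases hp' with ⟨g1, g2, g3⟩ | ⟨g1, g2, g3, g4, g5, g6⟩ | ⟨g1, g2, g3, g4⟩ |
      ⟨g1, g2, g3, g4⟩
    · exact Or.inr (by omega)
    · have := h00 h3 g4
      exact Or.inr (by omega)
    · have := hfar fun h => h2 (h.trans g3)
      omega
    · by_cases h : i = i'
      · subst h
        exact Or.inr (by omega)
      · have := hfar h
        omega
  · rcases hp' with ⟨g1, g2, g3⟩ | ⟨g1, g2, g3, g4, g5, g6⟩ | ⟨g1, g2, g3, g4⟩ |
      ⟨g1, g2, g3, g4⟩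
    · have := h01 g3 h4
      exact Or.inr (by omega)
    · have := h11 h4 g4
      exact Or.inl ⟨h1.trans g1.symm, by omega, by omega⟩
    · exact Or.inl ⟨h1.trans g1.symm, hcr i j i' j' l l' h2 h3 h4 h5 h6 g2 g3 g4 hj' hadj⟩
    · by_cases h : i = i'
      · subst h
        omega
      · have := hfar h
        omega
  · rcases hp' with ⟨g1, g2, g3⟩ | ⟨g1, g2, g3, g4, g5, g6⟩ | ⟨g1, g2, g3, g4⟩ |
      ⟨g1, g2, g3, g4⟩
    · have := hfar fun h => g2 (h.symm.trans h3)
      omega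
    · have hadj' : (i' = i ∧ j' ≤ j + 1 ∧ j ≤ j' + 1) ∨ (min j' j = 0 ∧ max j' j ≤ 1) :=
        hadj.imp (fun h => ⟨h.1.symm, h.2.2, h.2.1⟩) fun h => by omega
      exact Or.inl ⟨h1.trans g1.symm,
        (hcr i' j' i j l' l g2 g3 g4 g5 g6 h2 h3 h4 hj hadj').symm⟩
    · exact Or.inl ⟨h1.trans g1.symm, by omega, by omega⟩
    · have := hfar fun h => g1 (g3.symm.trans (h.symm.trans h3))
      omega
  · rcases hp' with ⟨g1, g2, g3⟩ | ⟨g1, g2, g3, g4, g5, g6⟩ | ⟨g1, g2, g3, g4⟩ |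
      ⟨g1, g2, g3, g4⟩
    · by_cases h : i = i'
      · subst h
        exact Or.inr (by omega)
      · have := hfar h
        omega
    · by_cases h : i = i'
      · subst h
        omega
      · have := hfar h
        omega
    · have := hfar fun h => h1 (h3.symm.trans (h.trans g3))
      omega
    · by_cases h : i = i'
      · subst h
        exact Or.inl ⟨h3.symm.trans g3, by omega, by omega⟩
      · have := hfar h
        omega

set_option maxHeartbeats 400000 in
/-- Suppose `W` refines `V`, the set `W₀` lies in the leg `k` of `V`, and `a i` is the first time
the leg `i` of `W` leaves that leg (past the end of the leg `i` if it never does), with `L i j`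
the level before that time. The initial part of the leg `i₀` up to `t` together with all other
initial parts is collapsed level by level. If the leg `i₀` goes on after `t`, it does so from the
top level. -/
theorem exists_amalgamation_of_levels {K : Type*} [MetricSpace K] [ConnectedSpace K] {n m : ℕ}
    (V : SimpleOdCover K n) (W : SimpleOdCover K m) (hWV : W.Refines V)
    (hW₀ : ¬ W.U₀ ⊆ V.U₀) (k : Fin n) (a : Fin m → ℕ) (L : Fin m → ℕ → ℕ) (l₀ : ℕ)
    (hL₀ : ∀ i, L i 0 = l₀) (ha : ∀ i, 1 ≤ a i) (haμ : ∀ i, a i ≤ W.μ i + 1)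
    (hL : ∀ i j, j < a i → 1 ≤ L i j ∧ L i j ≤ V.μ k ∧ W.U i j ⊆ V.U k (L i j))
    (hexit : ∀ i, a i ≤ W.μ i → W.U i (a i) ⊆ V.U₀)
    (i₀ : Fin m) (t M : ℕ) (ht : t < a i₀)
    (hMmax : ∀ i j, j < a i → (i = i₀ → j ≤ t) → L i j ≤ M)
    (hMatt : ∃ i j, j < a i ∧ (i = i₀ → j ≤ t) ∧ L i j = M)
    (htM : t < W.μ i₀ → L i₀ t = M)
    (e : Fin m) (hei : e ≠ i₀) (hea : a e ≤ W.μ e) :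
    ∃ n' : ℕ, 1 ≤ n' ∧ n' ≤ m ∧
      ∃ U : SimpleOdCover K n', U.IsAmalgamationOf W ∧ U.Refines V ∧ U.U₀ ⊆ V.U₀ := by
  classical
  let part : Fin m → ℕ → Fin m → ℕ → Prop := fun c l i j => j ≤ W.μ i ∧
    Collapses a L i₀ t M c l i j
  let ι := {i : Fin m // i = i₀ ∨ a i < W.μ i}
  let len : ι → ℕ := fun c => if c.1 = i₀ then M + (W.μ i₀ - t) else W.μ c.1 - a c.1
  let U : ι → ℕ → Set K := fun c l => ⋃ (i : Fin m) (j : ℕ) (_ : part c.1 l i j), W.U i j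
  have hmemU : ∀ c l x, x ∈ U c l ↔ ∃ i j, part c.1 l i j ∧ x ∈ W.U i j := by
    intro c l x
    simp only [U, Set.mem_iUnion, exists_prop]
  have hM : 1 ≤ M := by
    obtain ⟨i, j, hj, -, rfl⟩ := hMatt
    exact (hL i j hj).1
  have htμ : t ≤ W.μ i₀ := by
    have := haμ i₀
    omega
  let c₀ : ι := ⟨i₀, Or.inl rfl⟩
  have : Nonempty ι := ⟨c₀⟩
  have hbase : ∀ c, U c 0 = U c₀ 0 := by
    intro c
    ext x
    simp only [hmemU, part, Collapses]
    simp
  have hU₀V : U c₀ 0 ⊆ V.U₀ := by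
    intro x hx
    obtain ⟨i, j, ⟨hj, hp⟩, hx⟩ := (hmemU _ _ _).1 hx
    obtain rfl : j = a i := by grind [Collapses]
    exact hexit i hj hx
  have hlen₀ : len c₀ = M + (W.μ i₀ - t) := if_pos rfl
  have hsepV : ∀ l l', l ≤ V.μ k → l' ≤ V.μ k → (V.U k l ∩ V.U k l').Nonempty →
      l ≤ l' + 1 ∧ l' ≤ l + 1 := by
    intro l l' hl hl' h
    have := (V.inter_iff k l k l' hl hl').1 h
    omega
  obtain ⟨C, hC₀, hC⟩ := exists_of_separated (K := K) (U₀ := U c₀ 0) (μ := len) (U := U) hbase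
    (by
      rintro ⟨c, hc⟩
      by_cases h : c = i₀
      · simp only [len, if_pos h]
        omega
      · simp only [len, if_neg h]
        have := hc.resolve_left h
        omega)
    (fun c l _ => isOpen_iUnion fun i => isOpen_iUnion fun j => isOpen_iUnion fun h =>
      W.isOpen_U h.1)
    (by
      obtain ⟨x, hx⟩ := W.nonempty_U hea
      exact ⟨x, (hmemU _ _ _).2 ⟨e, a e, ⟨hea, Or.inl ⟨rfl, hei, rfl⟩⟩, hx⟩⟩)
    (by
      rintro ⟨c, hc⟩
      by_cases h : c = i₀
      · subst h
        rw [hlen₀]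
        by_cases h' : t = W.μ c
        · obtain ⟨i, j, hj, hjt, hjM⟩ := hMatt
          have hjμ : j ≤ W.μ i := by
            have := haμ i
            omega
          obtain ⟨x, hx⟩ := W.nonempty_U hjμ
          exact ⟨x, (hmemU _ _ _).2 ⟨i, j, ⟨hjμ, Or.inr (Or.inl
            ⟨rfl, by omega, by omega, hj, hjt, by omega⟩)⟩, hx⟩⟩
        · obtain ⟨x, hx⟩ := W.nonempty_U (le_refl (W.μ c))
          exact ⟨x, (hmemU _ _ _).2 ⟨c, W.μ c, ⟨le_rfl, Or.inr (Or.inr (Or.inl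
            ⟨rfl, by omega, rfl, by omega⟩))⟩, hx⟩⟩
      · obtain ⟨x, hx⟩ := W.nonempty_U (le_refl (W.μ c))
        have := hc.resolve_left h
        refine ⟨x, (hmemU _ _ _).2 ⟨c, W.μ c, ⟨le_rfl, Or.inr (Or.inr (Or.inr
            ⟨h, ?_, rfl, ?_⟩))⟩, hx⟩⟩
        · simp only [len, if_neg h]
          omega
        · simp only [len, if_neg h]
          omega)
    (by
      intro x
      obtain ⟨i, j, hj, hx⟩ := W.exists_mem_U i₀ x
      by_cases h1 : j < a i ∧ (i = i₀ → j ≤ t)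
      · have h2 := hMmax i j h1.1 h1.2
        exact ⟨c₀, L i j, by omega, (hmemU _ _ _).2 ⟨i, j, ⟨hj, Or.inr (Or.inl
          ⟨rfl, (hL i j h1.1).1, h2, h1.1, h1.2, rfl⟩)⟩, hx⟩⟩
      · by_cases h : i = i₀
        · subst h
          have h2 : t < j := by grind
          exact ⟨c₀, M + (j - t), by omega, (hmemU _ _ _).2 ⟨i, j, ⟨hj, Or.inr (Or.inr (Or.inl
            ⟨rfl, by omega, rfl, by omega⟩))⟩, hx⟩⟩
        · have h2 : a i ≤ j := by grind
          rcases h2.eq_or_lt with h2 | h2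
          · exact ⟨c₀, 0, Nat.zero_le _, (hmemU _ _ _).2 ⟨i, j,
              ⟨hj, Or.inl ⟨rfl, h, h2.symm⟩⟩, hx⟩⟩
          · refine ⟨⟨i, Or.inr (by omega)⟩, j - a i, ?_, (hmemU _ _ _).2 ⟨i, j, ⟨hj, Or.inr
              (Or.inr (Or.inr ⟨h, by omega, rfl, by omega⟩))⟩, hx⟩⟩
            simp only [len, if_neg h]
            omega)
    (by
      intro h
      obtain ⟨x, hx, hxV⟩ := Set.not_subset.1 hW₀
      exact hxV (hU₀V (h ▸ Set.mem_univ x)))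
    (by
      rintro c l c' l' - - ⟨x, hx, hx'⟩
      obtain ⟨i, j, ⟨hj, hp⟩, hx⟩ := (hmemU _ _ _).1 hx
      obtain ⟨i', j', ⟨hj', hp'⟩, hx'⟩ := (hmemU _ _ _).1 hx'
      have hadj := (W.inter_iff i j i' j' hj hj').1 ⟨x, hx, hx'⟩
      have hcc : c = c' ↔ c.1 = c'.1 := Subtype.ext_iff
      rw [hcc]
      have h00 : j = a i → j' < a i' → L i' j' ≤ 1 := by
        rintro rfl h'
        have h2 := hL i' j' h'
        have := hsepV 0 (L i' j') (Nat.zero_le _) h2.2.1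
          ⟨x, V.base k ▸ hexit i hj hx, h2.2.2 hx'⟩
        omega
      have h01 : j' = a i' → j < a i → L i j ≤ 1 := by
        rintro rfl h'
        have h2 := hL i j h'
        have := hsepV 0 (L i j) (Nat.zero_le _) h2.2.1
          ⟨x, V.base k ▸ hexit i' hj' hx', h2.2.2 hx⟩
        omega
      have h11 : j < a i → j' < a i' → L i j ≤ L i' j' + 1 ∧ L i' j' ≤ L i j + 1 := by
        intro h h'
        have h1 := hL i j h
        have h2 := hL i' j' h'
        exact hsepV _ _ h1.2.1 h2.2.1 ⟨x, h1.2.2 hx, h2.2.2 hx'⟩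
      exact collapse_adjacent hL₀ (ha i) (ha i') htM hj hj' h00 h01 h11 hadj hp hp')
  refine ⟨Fintype.card ι, Fintype.card_pos,
    (Fintype.card_subtype_le _).trans (Fintype.card_fin m).le, C, ?_, ?_, hC₀ ▸ hU₀V⟩
  · intro s hs
    obtain ⟨c, l, -, rfl⟩ := hC s hs
    refine ⟨{u | ∃ i j, part c.1 l i j ∧ u = W.U i j}, ?_, ?_⟩
    · rintro u ⟨i, j, h, rfl⟩
      exact W.mem_U h.1
    · ext x
      rw [hmemU]
      constructor
      · rintro ⟨i, j, h, hx⟩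
        exact ⟨_, ⟨i, j, h, rfl⟩, hx⟩
      · rintro ⟨_, ⟨i, j, h, rfl⟩, hx⟩
        exact ⟨i, j, h, hx⟩
  · intro s hs
    obtain ⟨c, l, -, rfl⟩ := hC s hs
    have hsingle : ∀ i j, j ≤ W.μ i → (∀ i' j', part c.1 l i' j' → i' = i ∧ j' = j) →
        ∃ t, V.mem t ∧ U c l ⊆ t := by
      intro i j hj h
      obtain ⟨s, hs, hsub⟩ := hWV _ (W.mem_U hj)
      refine ⟨s, hs, fun x hx => ?_⟩
      obtain ⟨i', j', hp, hx⟩ := (hmemU _ _ _).1 hx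
      obtain ⟨rfl, rfl⟩ := h i' j' hp
      exact hsub hx
    rcases Nat.eq_zero_or_pos l with rfl | hl
    · exact ⟨V.U₀, Or.inl rfl, hbase c ▸ hU₀V⟩
    by_cases hemp : ∃ i j, part c.1 l i j
    · obtain ⟨i, j, hj, hp⟩ := hemp
      rcases hp with ⟨h1, h2, h3⟩ | ⟨h1, h2, h3, h4, h5, h6⟩ | ⟨h1, h2, h3, h4⟩ | ⟨h1, h2, h3, h4⟩
      · omega
      · refine ⟨V.U k l, V.mem_U (h6 ▸ (hL i j h4).2.1), fun x hx => ?_⟩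
        obtain ⟨i', j', ⟨hj', hp⟩, hx⟩ := (hmemU _ _ _).1 hx
        have : j' < a i' ∧ L i' j' = l := by grind [Collapses]
        exact this.2 ▸ (hL i' j' this.1).2.2 hx
      · exact hsingle i j hj fun i' j' ⟨_, hp⟩ => by grind [Collapses]
      · exact hsingle i j hj fun i' j' ⟨_, hp⟩ => by grind [Collapses]
    · refine ⟨V.U₀, Or.inl rfl, fun x hx => ?_⟩
      obtain ⟨i, j, hp, -⟩ := (hmemU _ _ _).1 hx
      exact absurd ⟨i, j, hp⟩ hemp

end SimpleOdCover

/-- Let `n ≥ 3` and let `K` be a continuum.  If `𝒱` is a finite open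
cover of `K` whose nerve is a simple-`n`-od with distinguished element `V₀`, and
`𝒲` is a finite open cover refining `𝒱` whose nerve is a simple-`(n-1)`-od, then
there are `1 ≤ n' ≤ n - 1` and an amalgamation `𝒰` of `𝒲` refining `𝒱` whose nerve
is a simple-`n'`-od with distinguished element `U₀ ⊆ V₀`. -/
theorem statement0 {K : Type*} [MetricSpace K] [CompactSpace K] [ConnectedSpace K]
    [Nonempty K] (n : ℕ) (hn : 3 ≤ n)
    (V : SimpleOdCover K n) (W : SimpleOdCover K (n - 1))
    (hWV : W.Refines V) :
    ∃ n' : ℕ, 1 ≤ n' ∧ n' ≤ n - 1 ∧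
      ∃ U : SimpleOdCover K n', U.IsAmalgamationOf W ∧ U.Refines V ∧ U.U₀ ⊆ V.U₀ := by
  classical
  by_cases hW₀ : W.U₀ ⊆ V.U₀
  · refine ⟨n - 1, by omega, le_rfl, W, fun s hs => ⟨{s}, ?_, by simp⟩, hWV, hW₀⟩
    rintro u rfl
    exact hs
  obtain ⟨s, hs, hsub⟩ := hWV W.U₀ (Or.inl rfl)
  rcases hs with rfl | ⟨k, l₀, hl₀, hl₀μ, rfl⟩
  · exact absurd hsub hW₀
  have hf : ∀ i j, ∃ p : Fin n × ℕ, (j = 0 → p = (k, l₀)) ∧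
      (j ≤ W.μ i → p.2 ≤ V.μ p.1 ∧ W.U i j ⊆ V.U p.1 p.2) := by
    intro i j
    rcases Nat.eq_zero_or_pos j with rfl | hpos
    · exact ⟨(k, l₀), fun _ => rfl, fun _ => ⟨hl₀μ, by rwa [W.base]⟩⟩
    by_cases hj : j ≤ W.μ i
    · obtain ⟨s, rfl | ⟨c, l, -, hl, rfl⟩, hsub⟩ := hWV _ (W.mem_U hj)
      · exact ⟨(k, 0), fun h => by omega, fun _ => ⟨Nat.zero_le _, by rwa [V.base]⟩⟩
      · exact ⟨(c, l), fun h => by omega, fun _ => ⟨hl, hsub⟩⟩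
    · exact ⟨(k, l₀), fun _ => rfl, fun h => absurd h hj⟩
  choose f hf₀ hf using hf
  have hex : ∀ i, ∃ j, W.μ i < j ∨ ¬ ((f i j).1 = k ∧ 1 ≤ (f i j).2) :=
    fun i => ⟨W.μ i + 1, Or.inl (Nat.lt_succ_self _)⟩
  choose a ha hamin using fun i => (⟨Nat.find (hex i), Nat.find_spec (hex i),
    fun j hj => Nat.find_min (hex i) hj⟩ : ∃ j, (W.μ i < j ∨ ¬ ((f i j).1 = k ∧ 1 ≤ (f i j).2)) ∧
      ∀ j' < j, ¬ (W.μ i < j' ∨ ¬ ((f i j').1 = k ∧ 1 ≤ (f i j').2)))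
  have hlt : ∀ i j, j < a i → j ≤ W.μ i ∧ (f i j).1 = k ∧ 1 ≤ (f i j).2 := by
    intro i j hj
    have := hamin i j hj
    push Not at this
    exact this
  have ha1 : ∀ i, 1 ≤ a i := by
    intro i
    by_contra h
    have h0 : a i = 0 := by omega
    have := ha i
    rw [h0, hf₀ i 0 rfl] at this
    simp only [true_and] at this
    omega
  have haμ : ∀ i, a i ≤ W.μ i + 1 := by
    intro i
    have := (hlt i (a i - 1) (by have := ha1 i; omega)).1
    omega
  have hL : ∀ i j, j < a i → 1 ≤ (f i j).2 ∧ (f i j).2 ≤ V.μ k ∧ W.U i j ⊆ V.U k (f i j).2 := by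
    intro i j hj
    obtain ⟨h1, h2, h3⟩ := hlt i j hj
    have := hf i j h1
    rw [h2] at this
    exact ⟨h3, this⟩
  have hexit : ∀ i, a i ≤ W.μ i → W.U i (a i) ⊆ V.U₀ := by
    intro i hi
    have h1 := ha1 i
    obtain ⟨p1, p2, p3⟩ := hL i (a i - 1) (by omega)
    obtain ⟨q1, q2⟩ := hf i (a i) hi
    obtain ⟨x, hx, hx'⟩ := (W.inter_iff i (a i - 1) i (a i) (by omega) hi).2
      (Or.inl ⟨rfl, by omega, by omega⟩)
    have h3 := (V.inter_iff _ _ _ _ p2 q1).1 ⟨x, p3 hx, q2 hx'⟩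
    have h4 := (ha i).resolve_left (by omega)
    have h5 : (f i (a i)).2 = 0 := by grind
    rwa [h5, V.base] at q2
  have hsome : ∃ i, a i ≤ W.μ i := by
    by_contra hno
    push Not at hno
    have : Nontrivial (Fin n) := Fin.nontrivial_iff_two_le.2 (by omega)
    obtain ⟨c, hc⟩ := exists_ne k
    obtain ⟨x, hx⟩ := V.nonempty' c 1 le_rfl (V.one_le c)
    obtain ⟨i, j, hj, hxW⟩ := W.exists_mem_U ⟨0, by omega⟩ x
    obtain ⟨h1, h2, h3⟩ := hL i j (by have := hno i; omega)
    rcases (V.inter_iff _ _ _ _ (V.one_le c) h2).1 ⟨x, hx, h3 hxW⟩ with h | h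
    · exact hc h.1
    · omega
  have hmax : ∀ Q : Fin (n - 1) → ℕ → Prop, (∃ i j, j < a i ∧ Q i j) →
      ∃ i j, (j < a i ∧ Q i j) ∧ ∀ i' j', j' < a i' → Q i' j' → (f i' j').2 ≤ (f i j).2 := by
    rintro Q ⟨i₁, j₁, h₁⟩
    let S : Set ℕ := {l | ∃ i j, (j < a i ∧ Q i j) ∧ (f i j).2 = l}
    have hbdd : BddAbove S := ⟨V.μ k, by
      rintro _ ⟨i, j, h, rfl⟩
      exact (hL i j h.1).2.1⟩
    obtain ⟨i, j, h, hS⟩ : sSup S ∈ S := Nat.sSup_mem ⟨_, i₁, j₁, h₁, rfl⟩ hbdd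
    exact ⟨i, j, h, fun i' j' h' hQ => hS ▸ le_csSup hbdd ⟨i', j', ⟨h', hQ⟩, rfl⟩⟩
  have main := SimpleOdCover.exists_amalgamation_of_levels V W hWV hW₀ k a (fun i j => (f i j).2) l₀
    (fun i => by simp [hf₀ i 0 rfl]) ha1 haμ hL hexit
  by_cases hall : ∀ i, a i ≤ W.μ i
  · obtain ⟨i₀, t, ⟨ht, -⟩, hm⟩ := hmax (fun _ _ => True) ⟨⟨0, by omega⟩, 0, ha1 _, trivial⟩
    have : Nontrivial (Fin (n - 1)) := Fin.nontrivial_iff_two_le.2 (by omega)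
    obtain ⟨e, he⟩ := exists_ne i₀
    exact main i₀ t (f i₀ t).2 ht (fun i j h _ => hm i j h trivial)
      ⟨i₀, t, ht, fun _ => le_rfl, rfl⟩ (fun _ => rfl) e he (hall e)
  · push Not at hall
    obtain ⟨i₀, hi₀⟩ := hall
    obtain ⟨e, he⟩ := hsome
    obtain ⟨i, j, ⟨hj, hQ⟩, hm⟩ := hmax (fun i j => i = i₀ → j ≤ W.μ i₀)
      ⟨i₀, 0, ha1 _, fun _ => Nat.zero_le _⟩
    exact main i₀ (W.μ i₀) (f i j).2 hi₀ hm ⟨i, j, hj, hQ, rfl⟩ (fun h => absurd h (lt_irrefl _))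
      e (by rintro rfl; omega) he
end

section
/- Let n ≥ 3 be an integer, K a continuum, and v ∈ K a branch point of K of order n. Suppose K is simple-(n−1)-od-like in the covering sense. Then for every ε > 0 there exist an integer ñ with 1 ≤ ñ ≤ n−1 and a finite open cover 𝒰 of K with mesh less than ε whose nerve is a simple-ñ-od with distinguished element U_0 such that the distance from v to U_0 is less than ε. -/
namespace SimpleOdCover

/-- Adjacency in the nerve of a simple od, whose vertices are pairs (arm, position) and where all
positions `0` denote the centre. -/
def OdAdj {ι : Type*} (p q : ι × ℕ) : Prop :=
  (p.1 = q.1 ∧ p.2 ≤ q.2 + 1 ∧ q.2 ≤ p.2 + 1) ∨ (min p.2 q.2 = 0 ∧ max p.2 q.2 ≤ 1)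

/-- Two pairs (arm, position) denote the same vertex of a simple od. -/
def OdEq {ι : Type*} (p q : ι × ℕ) : Prop :=
  p.2 = q.2 ∧ (p.2 = 0 ∨ p.1 = q.1)

theorem OdAdj.congr {ι : Type*} {p q p' q' : ι × ℕ} (h : OdAdj p q) (hp : OdEq p p')
    (hq : OdEq q q') : OdAdj p' q' := by
  obtain ⟨i, l⟩ := p
  obtain ⟨i', l'⟩ := q
  obtain ⟨a, b⟩ := p'
  obtain ⟨a', b'⟩ := q'
  simp only [OdAdj, OdEq] at *
  grind

theorem OdAdj.symm {ι : Type*} {p q : ι × ℕ} (h : OdAdj p q) : OdAdj q p := by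
  obtain ⟨i, l⟩ := p
  obtain ⟨i', l'⟩ := q
  simp only [OdAdj] at *
  grind

/-- Adjacent vertices are equal or consecutive on an arm. -/
theorem OdAdj.cases {ι : Type*} {p q : ι × ℕ} (h : OdAdj p q) :
    OdEq p q ∨ (∃ i l, OdEq (i, l) p ∧ (i, l + 1) = q) ∨
      (∃ i l, OdEq (i, l) q ∧ (i, l + 1) = p) := by
  obtain ⟨i, l⟩ := p
  obtain ⟨i', l'⟩ := q
  simp only [OdAdj, OdEq, Prod.mk.injEq] at *
  rcases lt_trichotomy l l' with hl | hl | hl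
  · right; left
    exact ⟨i', l, by grind, by grind⟩
  · left; grind
  · right; right
    exact ⟨i, l', by grind, by grind⟩

section

variable {K : Type*} [MetricSpace K] {m : ℕ}

theorem isOpen_U_s1 (W : SimpleOdCover K m) {j : Fin m} {k : ℕ} (hk : k ≤ W.μ j) :
    IsOpen (W.U j k) := by
  rcases Nat.eq_zero_or_pos k with rfl | h
  · rw [W.base]; exact W.isOpen₀
  · exact W.isOpen' j k h hk

theorem nonempty_U_s1 (W : SimpleOdCover K m) {j : Fin m} {k : ℕ} (hk : k ≤ W.μ j) :
    (W.U j k).Nonempty := by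
  rcases Nat.eq_zero_or_pos k with rfl | h
  · rw [W.base]; exact W.nonempty₀
  · exact W.nonempty' j k h hk

theorem MeshLT.diam_lt {W : SimpleOdCover K m} {ε : ℝ} (h : W.MeshLT ε) {j : Fin m} {k : ℕ}
    (hk : k ≤ W.μ j) : Metric.diam (W.U j k) < ε := by
  rcases Nat.eq_zero_or_pos k with rfl | h0
  · rw [W.base]; exact h.1
  · exact h.2 j k h0 hk

theorem exists_mem_U_s1 (W : SimpleOdCover K m) (hm : 0 < m) (x : K) :
    ∃ j k, k ≤ W.μ j ∧ x ∈ W.U j k := by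
  have hx : x ∈ (W.U₀ ∪ ⋃ i, ⋃ j ∈ Set.Icc 1 (W.μ i), W.U i j) := W.covers ▸ Set.mem_univ x
  rcases hx with hx | hx
  · exact ⟨⟨0, hm⟩, 0, Nat.zero_le _, by rwa [W.base]⟩
  · simp only [Set.mem_iUnion, Set.mem_Icc] at hx
    obtain ⟨i, j, ⟨-, hj⟩, hx⟩ := hx
    exact ⟨i, j, hj, hx⟩

/-- If none of its elements is the whole space, an indexed open cover with the intersection
pattern of a simple od consists of pairwise distinct sets. -/
theorem exists_of_inter_iff {ι : Type*} [Fintype ι] [Nonempty ι] (μ : ι → ℕ) (G : ι → ℕ → Set K)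
    (G₀ : Set K) (hbase : ∀ i, G i 0 = G₀) (hμ : ∀ i, 1 ≤ μ i)
    (hopen : ∀ i l, l ≤ μ i → IsOpen (G i l))
    (hcov : ∀ x, ∃ i l, l ≤ μ i ∧ x ∈ G i l)
    (huniv : ∀ i l, l ≤ μ i → G i l ≠ Set.univ)
    (hinter : ∀ i l i' l', l ≤ μ i → l' ≤ μ i' →
      ((G i l ∩ G i' l').Nonempty ↔ OdAdj (i, l) (i', l'))) :
    ∃ (C : SimpleOdCover K (Fintype.card ι)) (e : Fin (Fintype.card ι) → ι),
      C.U₀ = G₀ ∧ (∀ i, C.μ i = μ (e i)) ∧ ∀ i l, C.U i l = G (e i) l := by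
  have hne : ∀ i l, l ≤ μ i → (G i l).Nonempty := fun i l hl => by
    have h := (hinter i l i l hl hl).2 (Or.inl ⟨rfl, by simp, by simp⟩)
    simpa using h
  have hsucc : ∀ i l, l + 1 ≤ μ i → G i l ≠ G i (l + 1) := by
    intro i l hl heq
    rcases Nat.eq_zero_or_pos l with rfl | hl0
    · by_cases h2 : 2 ≤ μ i
      · have h := (hinter i 1 i 2 hl h2).2 (Or.inl ⟨rfl, by simp, by simp⟩)
        rw [← heq, hinter i 0 i 2 (Nat.zero_le _) h2] at h
        simp [OdAdj] at h
      · by_cases hi : ∃ i', i' ≠ i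
        · obtain ⟨i', hi'⟩ := hi
          have h := (hinter i 0 i' 1 (Nat.zero_le _) (hμ i')).2 (Or.inr ⟨by simp, by simp⟩)
          rw [heq, hinter i 1 i' 1 hl (hμ i')] at h
          simp [OdAdj, hi'.symm] at h
        · push Not at hi
          refine huniv i 0 (Nat.zero_le _) (Set.eq_univ_of_forall fun x => ?_)
          obtain ⟨i', l, hl', hx⟩ := hcov x
          obtain rfl := hi i'
          obtain rfl | rfl : l = 0 ∨ l = 1 := by omega
          · exact hx
          · rwa [heq]
    · have h := (hinter i (l - 1) i l (by omega) (by omega)).2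
        (Or.inl ⟨rfl, by dsimp only; omega, by dsimp only; omega⟩)
      rw [heq, hinter i (l - 1) i (l + 1) (by omega) hl] at h
      simp only [OdAdj] at h
      omega
  let e := (Fintype.equivFin ι).symm
  refine ⟨{ U₀ := G₀
            μ := fun i => μ (e i)
            U := fun i l => G (e i) l
            base := fun i => hbase _
            one_le := fun i => hμ _
            isOpen₀ := hbase (Classical.arbitrary ι) ▸ hopen _ 0 (Nat.zero_le _)
            nonempty₀ := hbase (Classical.arbitrary ι) ▸ hne _ 0 (Nat.zero_le _)
            isOpen' := fun i j _ hj => hopen _ _ hj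
            nonempty' := fun i j _ hj => hne _ _ hj
            covers := ?_
            distinct := ?_
            inter_iff := ?_ }, e, rfl, fun _ => rfl, fun _ _ => rfl⟩
  · refine Set.eq_univ_of_forall fun x => ?_
    obtain ⟨i, l, hl, hx⟩ := hcov x
    rcases Nat.eq_zero_or_pos l with rfl | hl0
    · left; rwa [← hbase i]
    · right
      simp only [Set.mem_iUnion, Set.mem_Icc]
      exact ⟨e.symm i, l, ⟨hl0, by simpa using hl⟩, by simpa using hx⟩
  · intro i j i' j' hj hj' heq
    have hadj : OdAdj (e i, j) (e i', j') := by
      rw [← hinter _ _ _ _ hj hj', ← heq, Set.inter_self]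
      exact hne _ _ hj
    rcases hadj.cases with h | ⟨b, l, h1, h2⟩ | ⟨b, l, h1, h2⟩
    · simp only [OdEq, EmbeddingLike.apply_eq_iff_eq] at h
      grind
    · simp only [Prod.mk.injEq, OdEq] at h1 h2
      obtain ⟨rfl, rfl⟩ := h2
      obtain ⟨rfl, h1⟩ := h1
      refine absurd ?_ (hsucc _ _ hj')
      rw [← heq]
      rcases h1 with rfl | h1
      · rw [hbase, hbase]
      · rw [h1]
    · simp only [Prod.mk.injEq, OdEq] at h1 h2
      obtain ⟨rfl, rfl⟩ := h2
      obtain ⟨rfl, h1⟩ := h1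
      refine absurd ?_ (hsucc _ _ hj)
      rw [heq]
      rcases h1 with rfl | h1
      · rw [hbase, hbase]
      · rw [h1]
  · intro i j i' j' hj hj'
    rw [hinter _ _ _ _ hj hj']
    simp [OdAdj]

/-- A map from the nerve of a simple od cover to a simple od that preserves adjacency, hits
every edge and has small fibres induces an amalgamated simple od cover. -/
theorem exists_amalgamation [CompactSpace K] {ι : Type*} [Fintype ι] [Nonempty ι]
    (W : SimpleOdCover K m) (hm : 0 < m) (μ : ι → ℕ) (hμ : ∀ i, 1 ≤ μ i)
    (h : Fin m → ℕ → ι × ℕ) (D : ι → ℕ → Set K) (D₀ : Set K) {ε : ℝ}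
    (hε : ε ≤ Metric.diam (Set.univ : Set K))
    (hle : ∀ j k, k ≤ W.μ j → (h j k).2 ≤ μ (h j k).1)
    (hcentre : ∀ j j', h j 0 = h j' 0)
    (hadj : ∀ j k, k + 1 ≤ W.μ j → OdAdj (h j k) (h j (k + 1)))
    (hsurj : ∀ i l, l + 1 ≤ μ i → ∃ j k k', k ≤ W.μ j ∧ k' ≤ W.μ j ∧
      (W.U j k ∩ W.U j k').Nonempty ∧ OdEq (h j k) (i, l) ∧ OdEq (h j k') (i, l + 1))
    (hD : ∀ i l, l ≤ μ i → Metric.diam (D i l) < ε)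
    (hWD : ∀ i l j k, l ≤ μ i → k ≤ W.μ j → OdEq (h j k) (i, l) → W.U j k ⊆ D i l)
    (hD₀ : ∀ i, D i 0 = D₀) :
    ∃ C : SimpleOdCover K (Fintype.card ι), C.MeshLT ε ∧ C.U₀ ⊆ D₀ := by
  have hadj' : ∀ j k j' k', k ≤ W.μ j → k' ≤ W.μ j' → (W.U j k ∩ W.U j' k').Nonempty →
      OdAdj (h j k) (h j' k') := by
    have hrefl : ∀ p : ι × ℕ, OdAdj p p := fun p => Or.inl ⟨rfl, by simp, by simp⟩
    have key : ∀ j k j' k', k ≤ W.μ j → k' ≤ W.μ j' → k ≤ k' →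
        (W.U j k ∩ W.U j' k').Nonempty → OdAdj (h j k) (h j' k') := by
      intro j k j' k' hk hk' hkk hne
      rcases (W.inter_iff j k j' k' hk hk').1 hne with ⟨rfl, h1, h2⟩ | ⟨h1, h2⟩
      · obtain rfl | rfl : k' = k ∨ k' = k + 1 := by omega
        · exact hrefl _
        · exact hadj _ _ hk'
      · obtain rfl : k = 0 := by omega
        rw [hcentre j j']
        obtain rfl | rfl : k' = 0 ∨ k' = 0 + 1 := by omega
        · exact hrefl _
        · exact hadj _ _ hk'
    intro j k j' k' hk hk' hne
    rcases le_total k k' with hkk | hkk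
    · exact key _ _ _ _ hk hk' hkk hne
    · rw [Set.inter_comm] at hne
      exact (key _ _ _ _ hk' hk hkk hne).symm
  let G : ι → ℕ → Set K := fun i l =>
    {x | ∃ j k, k ≤ W.μ j ∧ OdEq (h j k) (i, l) ∧ x ∈ W.U j k}
  have hGeq : ∀ i l i' l', OdEq (i, l) (i', l') → G i l = G i' l' := by
    intro i l i' l' he
    ext x
    simp only [G, Set.mem_ofPred_eq, OdEq] at he ⊢
    grind
  have hGD : ∀ i l, l ≤ μ i → G i l ⊆ D i l := by
    rintro i l hl x ⟨j, k, hk, he, hx⟩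
    exact hWD i l j k hl hk he hx
  have hGdiam : ∀ i l, l ≤ μ i → Metric.diam (G i l) < ε := fun i l hl =>
    (Metric.diam_mono (hGD i l hl) (Metric.isBounded_of_compactSpace)).trans_lt (hD i l hl)
  have hedge : ∀ i l, l + 1 ≤ μ i → (G i l ∩ G i (l + 1)).Nonempty := by
    intro i l hl
    obtain ⟨j, k, k', hk, hk', ⟨x, hx, hx'⟩, he, he'⟩ := hsurj i l hl
    exact ⟨x, ⟨j, k, hk, he, hx⟩, ⟨j, k', hk', he', hx'⟩⟩
  have hne : ∀ i l, l ≤ μ i → (G i l).Nonempty := by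
    intro i l hl
    cases l with
    | zero => exact (hedge i 0 (hμ i)).mono Set.inter_subset_left
    | succ l => exact (hedge i l hl).mono Set.inter_subset_right
  let i₀ := Classical.arbitrary ι
  suffices hex : ∃ (C : SimpleOdCover K (Fintype.card ι)) (e : Fin (Fintype.card ι) → ι),
      C.U₀ = G i₀ 0 ∧ (∀ i, C.μ i = μ (e i)) ∧ ∀ i l, C.U i l = G (e i) l by
    obtain ⟨C, e, hC₀, hCμ, hCU⟩ := hex
    refine ⟨C, ⟨?_, fun i j _ hj => ?_⟩, ?_⟩
    · rw [hC₀]; exact hGdiam _ _ (Nat.zero_le _)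
    · rw [hCU]; exact hGdiam _ _ (hCμ i ▸ hj)
    · rw [hC₀, ← hD₀ i₀]; exact hGD _ _ (Nat.zero_le _)
  refine exists_of_inter_iff μ G (G i₀ 0)
    (fun i => hGeq _ _ _ _ ⟨rfl, Or.inl rfl⟩) hμ ?_ ?_ ?_ ?_
  · intro i l _
    have : G i l = ⋃ j, ⋃ k, ⋃ (_ : k ≤ W.μ j ∧ OdEq (h j k) (i, l)), W.U j k := by
      ext x; simp [G, and_assoc]
    rw [this]
    exact isOpen_iUnion fun j => isOpen_iUnion fun k => isOpen_iUnion fun hk => W.isOpen_U_s1 hk.1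
  · intro x
    obtain ⟨j, k, hk, hx⟩ := W.exists_mem_U_s1 hm x
    exact ⟨(h j k).1, (h j k).2, hle j k hk, j, k, hk, ⟨rfl, Or.inr rfl⟩, hx⟩
  · intro i l hl heq
    have := hGdiam i l hl
    rw [heq] at this
    exact absurd hε (not_le.2 this)
  · intro i l i' l' hl hl'
    constructor
    · rintro ⟨x, ⟨j, k, hk, he, hx⟩, ⟨j', k', hk', he', hx'⟩⟩
      exact (hadj' j k j' k' hk hk' ⟨x, hx, hx'⟩).congr he he'
    · intro ha
      rcases ha.cases with h1 | ⟨b, n, h1, h2⟩ | ⟨b, n, h1, h2⟩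
      · rw [hGeq _ _ _ _ h1, Set.inter_self]
        exact hne _ _ hl'
      · obtain ⟨rfl, rfl⟩ := Prod.mk.inj h2
        rw [← hGeq _ _ _ _ h1]
        exact hedge _ _ hl'
      · obtain ⟨rfl, rfl⟩ := Prod.mk.inj h2
        rw [← hGeq _ _ _ _ h1, Set.inter_comm]
        exact hedge _ _ hl

/-- A function on `ℕ` that changes by at most one at each step crosses every intermediate edge. -/
theorem exists_consecutive (f : ℕ → ℕ) (l t : ℕ)
    (hf : ∀ k < t, f k ≤ f (k + 1) + 1 ∧ f (k + 1) ≤ f k + 1)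
    (h : (f 0 ≤ l ∧ l + 1 ≤ f t) ∨ (l + 1 ≤ f 0 ∧ f t ≤ l)) :
    ∃ k k', k ≤ t ∧ k' ≤ t ∧ k ≤ k' + 1 ∧ k' ≤ k + 1 ∧ f k = l ∧ f k' = l + 1 := by
  induction t with
  | zero => omega
  | succ t ih =>
    have h1 := hf t (Nat.lt_succ_self t)
    by_cases h2 : (f 0 ≤ l ∧ l + 1 ≤ f t) ∨ (l + 1 ≤ f 0 ∧ f t ≤ l)
    · obtain ⟨k, k', hk, hk', h3⟩ := ih (fun k hk => hf k (by omega)) h2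
      exact ⟨k, k', by omega, by omega, h3⟩
    · by_cases h3 : f t ≤ l
      · exact ⟨t, t + 1, by omega, le_rfl, by omega, by omega, by omega, by omega⟩
      · exact ⟨t + 1, t, le_rfl, by omega, by omega, by omega, by omega, by omega⟩

/-- Folding: the initial segments `[0, t j]` of the arms are folded, by the level function `L`,
onto a chain with levels `0, …, M`. The rest of the arm `a` is attached at level `M`, the rests
of the other arms at level `0`, which becomes the new centre. -/
theorem exists_fold [CompactSpace K] (W : SimpleOdCover K m) (a : Fin m) (t : Fin m → ℕ)
    (L : Fin m → ℕ → ℕ) (M : ℕ) (D : ℕ → Set K) {ε : ℝ}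
    (hε : ε ≤ Metric.diam (Set.univ : Set K)) (hW : W.MeshLT ε) (hM : 1 ≤ M)
    (ht : ∀ j, t j ≤ W.μ j) (hL₀ : ∀ j j', L j 0 = L j' 0)
    (hL : ∀ j, ∀ k < t j, L j k ≤ L j (k + 1) + 1 ∧ L j (k + 1) ≤ L j k + 1)
    (hLM : ∀ j k, k ≤ t j → L j k ≤ M)
    (hzero : ∃ j k, k ≤ t j ∧ L j k = 0) (htop : ∃ j k, k ≤ t j ∧ L j k = M)
    (hta : t a < W.μ a → L a (t a) = M)
    (htj : ∀ j, j ≠ a → t j < W.μ j → L j (t j) = 0)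
    (hD : ∀ l ≤ M, Metric.diam (D l) < ε)
    (hWD : ∀ j k, k ≤ t j → W.U j k ⊆ D (L j k)) :
    ∃ n', 1 ≤ n' ∧ n' ≤ m ∧ ∃ C : SimpleOdCover K n', C.MeshLT ε ∧ C.U₀ ⊆ D 0 := by
  classical
  let ι := {j : Fin m // j = a ∨ t j < W.μ j}
  let a' : ι := ⟨a, Or.inl rfl⟩
  have : Nonempty ι := ⟨a'⟩
  let h : Fin m → ℕ → ι × ℕ := fun j k =>
    if k ≤ t j then (a', L j k) else if j = a then (a', M + (k - t a))
    else if hj : t j < W.μ j then (⟨j, Or.inr hj⟩, k - t j) else (a', 0)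
  have hF : ∀ j k, k ≤ t j → h j k = (a', L j k) := fun j k hk => by simp [h, hk]
  have hA : ∀ k, t a < k → h a k = (a', M + (k - t a)) := fun k hk => by
    simp [h, hk]
  have hT : ∀ j k (_ : j ≠ a) (_ : t j < k) (hk : k ≤ W.μ j),
      h j k = (⟨j, Or.inr (by omega)⟩, k - t j) := fun j k hj htk hk => by
    have h1 : t j < W.μ j := by omega
    simp [h, hj, htk, h1]
  let μ : ι → ℕ := fun i => if i.1 = a then M + (W.μ a - t a) else W.μ i.1 - t i.1
  have hμa : μ a' = M + (W.μ a - t a) := by simp [μ, a']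
  have hμj : ∀ i : ι, i.1 ≠ a → μ i = W.μ i.1 - t i.1 := fun i hi => by simp [μ, hi]
  let D' : ι → ℕ → Set K := fun i l =>
    if l = 0 then D 0 else if i.1 = a then (if l ≤ M then D l else W.U a (t a + (l - M)))
    else W.U i.1 (t i.1 + l)
  have hia : ∀ i : ι, i.1 = a → i = a' := fun i hi => Subtype.ext hi
  refine ⟨Fintype.card ι, Fintype.card_pos, ?_, ?_⟩
  · simpa using Fintype.card_subtype_le (fun j : Fin m => j = a ∨ t j < W.μ j)
  have hcons : ∀ j k k', k ≤ W.μ j → k' ≤ W.μ j → k ≤ k' + 1 → k' ≤ k + 1 →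
      (W.U j k ∩ W.U j k').Nonempty := fun j k k' hk hk' h1 h2 =>
    (W.inter_iff j k j k' hk hk').2 (Or.inl ⟨rfl, h1, h2⟩)
  refine exists_amalgamation W a.pos μ ?_ h D' (D 0) hε ?_ ?_ ?_ ?_ ?_ ?_ ?_
  · intro i
    by_cases hi : i.1 = a
    · rw [hia i hi, hμa]; omega
    · rw [hμj i hi]
      have := i.2.resolve_left hi
      omega
  · intro j k hk
    by_cases hkt : k ≤ t j
    · rw [hF j k hkt, hμa]
      have := hLM j k hkt
      dsimp only; omega
    · by_cases hj : j = a
      · subst hj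
        rw [hA k (by omega), hμa]
        dsimp only; omega
      · rw [hT j k hj (by omega) hk, hμj _ hj]
        dsimp only; omega
  · intro j j'
    rw [hF j 0 (Nat.zero_le _), hF j' 0 (Nat.zero_le _), hL₀ j j']
  · intro j k hk
    by_cases hkt : k + 1 ≤ t j
    · rw [hF j k (by omega), hF j (k + 1) hkt]
      exact Or.inl ⟨rfl, hL j k hkt⟩
    · by_cases hj : j = a
      · subst hj
        rw [hA (k + 1) (by omega)]
        by_cases hk' : k ≤ t j
        · obtain rfl : k = t j := by omega
          rw [hF j _ le_rfl, hta (by omega)]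
          exact Or.inl ⟨rfl, by dsimp only; omega, by dsimp only; omega⟩
        · rw [hA k (by omega)]
          exact Or.inl ⟨rfl, by dsimp only; omega, by dsimp only; omega⟩
      · rw [hT j (k + 1) hj (by omega) hk]
        by_cases hk' : k ≤ t j
        · obtain rfl : k = t j := by omega
          rw [hF j _ le_rfl, htj j hj (by omega)]
          exact Or.inr ⟨by simp, by simp⟩
        · rw [hT j k hj (by omega) (by omega)]
          exact Or.inl ⟨rfl, by dsimp only; omega, by dsimp only; omega⟩
  · intro i l hl
    by_cases hi : i.1 = a
    · rw [hia i hi] at hl ⊢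
      rw [hμa] at hl
      by_cases hlM : l + 1 ≤ M
      · have hcross : ∃ j k, k ≤ t j ∧
            ((L j 0 ≤ l ∧ l + 1 ≤ L j k) ∨ (l + 1 ≤ L j 0 ∧ L j k ≤ l)) := by
          obtain ⟨q, k₀, hk₀, hq⟩ := hzero
          obtain ⟨p, k₁, hk₁, hp⟩ := htop
          have := hL₀ p q
          by_cases hl0 : L q 0 ≤ l
          · exact ⟨p, k₁, hk₁, by omega⟩
          · exact ⟨q, k₀, hk₀, by omega⟩
        obtain ⟨j, s, hs, hcr⟩ := hcross
        obtain ⟨k, k', hk, hk', h1, h2, h3, h4⟩ := exists_consecutive (L j) l s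
          (fun k hk => hL j k (by omega)) hcr
        have := ht j
        refine ⟨j, k, k', by omega, by omega, hcons _ _ _ (by omega) (by omega) h1 h2, ?_, ?_⟩
        · rw [hF j k (by omega), h3]; exact ⟨rfl, Or.inr rfl⟩
        · rw [hF j k' (by omega), h4]; exact ⟨rfl, Or.inr rfl⟩
      · have := ht a
        refine ⟨a, t a + (l - M), t a + (l - M) + 1, by omega, by omega,
          hcons _ _ _ (by omega) (by omega) (by omega) (by omega), ?_, ?_⟩
        · by_cases hl' : l = M
          · subst hl'
            rw [Nat.sub_self, Nat.add_zero, hF a _ le_rfl, hta (by omega)]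
            exact ⟨rfl, Or.inr rfl⟩
          · rw [hA _ (by omega)]
            exact ⟨by dsimp only; omega, Or.inr rfl⟩
        · rw [hA _ (by omega)]
          exact ⟨by dsimp only; omega, Or.inr rfl⟩
    · rw [hμj i hi] at hl
      refine ⟨i.1, t i.1 + l, t i.1 + (l + 1), by omega, by omega,
        hcons _ _ _ (by omega) (by omega) (by omega) (by omega), ?_, ?_⟩
      · rcases Nat.eq_zero_or_pos l with rfl | hl0
        · rw [Nat.add_zero, hF _ _ le_rfl, htj _ hi (by omega)]
          exact ⟨rfl, Or.inl rfl⟩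
        · rw [hT _ _ hi (by omega) (by omega)]
          exact ⟨by dsimp only; omega, Or.inr rfl⟩
      · rw [hT _ _ hi (by omega) (by omega)]
        exact ⟨by dsimp only; omega, Or.inr rfl⟩
  · intro i l hl
    simp only [D']
    split_ifs with h1 h2 h3
    · exact hD 0 (Nat.zero_le _)
    · exact hD l h3
    · rw [hia i h2, hμa] at hl
      have := ht a
      exact hW.diam_lt (by omega)
    · rw [hμj i h2] at hl
      exact hW.diam_lt (by omega)
  · intro i l j k hl hk he
    by_cases hkt : k ≤ t j
    · rw [hF j k hkt] at he
      obtain ⟨he1, he2⟩ := he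
      dsimp only at he1 he2
      have h1 := hWD j k hkt
      have h2 := hLM j k hkt
      rw [he1] at h1 h2 he2
      simp only [D']
      split_ifs with h3 h4
      · rwa [h3] at h1
      · exact h1
      · exact absurd (congrArg Subtype.val (he2.resolve_left h3)).symm h4
    · by_cases hj : j = a
      · subst hj
        rw [hA k (by omega)] at he
        obtain ⟨he1, he2⟩ := he
        dsimp only at he1 he2
        subst he1
        have h2 := he2.resolve_left (by omega)
        have h3 : i.1 = j := (congrArg Subtype.val h2).symm
        have h4 : ¬ M + (k - t j) ≤ M := by omega
        have h5 : M + (k - t j) ≠ 0 := by omega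
        have h6 : t j + (M + (k - t j) - M) = k := by omega
        simp only [D', if_neg h5, if_pos h3, if_neg h4, h6, subset_rfl]
      · rw [hT j k hj (by omega) hk] at he
        obtain ⟨he1, he2⟩ := he
        dsimp only at he1 he2
        subst he1
        have h2 := he2.resolve_left (by omega)
        have h3 : i.1 = j := (congrArg Subtype.val h2).symm
        have h5 : k - t j ≠ 0 := by omega
        have h6 : t j + (k - t j) = k := by omega
        simp only [D', if_neg h5, h3, if_neg hj, h6, subset_rfl]
  · intro i
    simp [D']

/-- A sufficiently fine cover refines a given simple od cover. -/
theorem exists_refinement_scale [CompactSpace K] (V : SimpleOdCover K m) (hm : 0 < m) :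
    ∃ δ > 0, ∀ s : Set K, s.Nonempty → Metric.diam s < δ →
      ∃ i l, l ≤ V.μ i ∧ s ⊆ V.U i l := by
  let c : {p : Fin m × ℕ // p.2 ≤ V.μ p.1} → Set K := fun p => V.U p.1.1 p.1.2
  obtain ⟨δ, hδ, h⟩ := lebesgue_number_lemma_of_metric (c := c) isCompact_univ
    (fun p => V.isOpen_U_s1 p.2) (fun x _ => by
      obtain ⟨j, k, hk, hx⟩ := V.exists_mem_U_s1 hm x
      exact Set.mem_iUnion.2 ⟨⟨(j, k), hk⟩, hx⟩)
  refine ⟨δ, hδ, fun s ⟨x, hx⟩ hs => ?_⟩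
  obtain ⟨p, hp⟩ := h x (Set.mem_univ x)
  exact ⟨p.1.1, p.1.2, p.2, fun y hy => hp (Metric.mem_ball.2
    ((Metric.dist_le_diam_of_mem Metric.isBounded_of_compactSpace hy hx).trans_lt hs))⟩

/-- Given a simple od cover `V` with at least two arms, and a simple od cover `W` with at least
two arms refining it, there is a simple od cover with no more arms than `W` and with centre
inside that of `V`. -/
theorem exists_centre_subset [CompactSpace K] {n : ℕ} (V : SimpleOdCover K n) (hn : 2 ≤ n)
    (W : SimpleOdCover K m) (hm : 2 ≤ m) {ε : ℝ} (hε : ε ≤ Metric.diam (Set.univ : Set K))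
    (hV : V.MeshLT ε) (hW : W.MeshLT ε)
    (href : ∀ j k, k ≤ W.μ j → ∃ i l, l ≤ V.μ i ∧ W.U j k ⊆ V.U i l) :
    ∃ n', 1 ≤ n' ∧ n' ≤ m ∧ ∃ C : SimpleOdCover K n', C.MeshLT ε ∧ C.U₀ ⊆ V.U₀ := by
  classical
  have href' : ∀ s : Set K, ∃ p : Fin n × ℕ, (∃ j k, k ≤ W.μ j ∧ s = W.U j k) →
      p.2 ≤ V.μ p.1 ∧ s ⊆ V.U p.1 p.2 := by
    intro s
    by_cases hs : ∃ j k, k ≤ W.μ j ∧ s = W.U j k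
    · obtain ⟨j, k, hk, rfl⟩ := hs
      obtain ⟨i, l, hl, h⟩ := href j k hk
      exact ⟨(i, l), fun _ => ⟨hl, h⟩⟩
    · exact ⟨(⟨0, by omega⟩, 0), fun h => absurd h hs⟩
  choose f hf using href'
  let A : Fin m → ℕ → Fin n := fun j k => (f (W.U j k)).1
  let L : Fin m → ℕ → ℕ := fun j k => (f (W.U j k)).2
  have hle : ∀ j k, k ≤ W.μ j → L j k ≤ V.μ (A j k) := fun j k hk =>
    (hf _ ⟨j, k, hk, rfl⟩).1
  have hsub : ∀ j k, k ≤ W.μ j → W.U j k ⊆ V.U (A j k) (L j k) := fun j k hk =>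
    (hf _ ⟨j, k, hk, rfl⟩).2
  have hadj : ∀ j k, k + 1 ≤ W.μ j → OdAdj (A j k, L j k) (A j (k + 1), L j (k + 1)) := by
    intro j k hk
    refine (V.inter_iff _ _ _ _ (hle j k (by omega)) (hle j (k + 1) hk)).1 ?_
    have h := (W.inter_iff j k j (k + 1) (by omega) hk).2 (Or.inl ⟨rfl, by omega, by omega⟩)
    exact h.mono (Set.inter_subset_inter (hsub _ _ (by omega)) (hsub _ _ hk))
  have hstep : ∀ j k, k + 1 ≤ W.μ j → L j k ≤ L j (k + 1) + 1 ∧ L j (k + 1) ≤ L j k + 1 := by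
    intro j k hk
    have h := hadj j k hk
    simp only [OdAdj] at h
    omega
  let j₀ : Fin m := ⟨0, by omega⟩
  have hL₀ : ∀ j j', L j 0 = L j' 0 := fun j j' => by simp only [L, W.base]
  have hA₀ : ∀ j j', A j 0 = A j' 0 := fun j j' => by simp only [A, W.base]
  by_cases hc : L j₀ 0 = 0
  · refine ⟨m, by omega, le_rfl, W, hW, ?_⟩
    have h := hsub j₀ 0 (Nat.zero_le _)
    rwa [hc, W.base, V.base] at h
  let i₀ := A j₀ 0
  -- `x j` is the first position on the arm `j` that is sent to the centre, or the last position.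
  have hx : ∀ j, ∃ x, x ≤ W.μ j ∧ (x < W.μ j → L j x = 0) ∧ (∀ k < x, L j k ≠ 0) := by
    intro j
    by_cases hex : ∃ k, k ≤ W.μ j ∧ L j k = 0
    · refine ⟨Nat.find hex, (Nat.find_spec hex).1, fun _ => (Nat.find_spec hex).2, fun k hk h => ?_⟩
      exact Nat.find_min hex hk ⟨(hk.le.trans (Nat.find_spec hex).1), h⟩
    · push Not at hex
      exact ⟨W.μ j, le_rfl, fun h => absurd h (lt_irrefl _), fun k hk => hex k hk.le⟩
  choose x hxμ hx0 hxmin using hx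
  have harm : ∀ j k, k ≤ x j → L j k = 0 ∨ A j k = i₀ := by
    intro j k
    induction k with
    | zero => exact fun _ => Or.inr (hA₀ j j₀)
    | succ k ih =>
      intro hk
      have h1 := (ih (by omega)).resolve_left (hxmin j k hk)
      have h2 := hxmin j k hk
      have h3 := hadj j k (hk.trans (hxμ j))
      simp only [OdAdj] at h3
      rcases h3 with ⟨h3, -⟩ | ⟨h3, -⟩
      · exact Or.inr (h3 ▸ h1)
      · left; omega
  have hWD : ∀ j k, k ≤ x j → W.U j k ⊆ V.U i₀ (L j k) := by
    intro j k hk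
    have h := hsub j k (hk.trans (hxμ j))
    rcases harm j k hk with h0 | h0
    · rw [h0, V.base] at h
      rwa [h0, V.base]
    · rwa [h0] at h
  have hLμ : ∀ j k, k ≤ x j → L j k ≤ V.μ i₀ := by
    intro j k hk
    rcases harm j k hk with h0 | h0
    · omega
    · exact h0 ▸ hle j k (hk.trans (hxμ j))
  have hexit : ∃ q, L q (x q) = 0 := by
    by_contra! hno
    have hxe : ∀ j, x j = W.μ j := fun j =>
      le_antisymm (hxμ j) (not_lt.1 fun h => hno j (hx0 j h))
    obtain ⟨i, hi⟩ : ∃ i, i ≠ i₀ := by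
      have : Nontrivial (Fin n) := Fin.nontrivial_iff_two_le.2 hn
      exact exists_ne i₀
    obtain ⟨y, hy⟩ := V.nonempty' i 1 le_rfl (V.one_le i)
    obtain ⟨j, k, hk, hyW⟩ := W.exists_mem_U_s1 (by omega) y
    have hkx : k ≤ x j := hxe j ▸ hk
    have h0 : L j k ≠ 0 := by
      rcases hkx.lt_or_eq with h | h
      · exact hxmin j k h
      · exact h ▸ hno j
    have h := (V.inter_iff i 1 i₀ (L j k) (V.one_le i) (hLμ j k hkx)).1
      ⟨y, hy, hWD j k hkx hyW⟩
    rcases h with ⟨h, -⟩ | ⟨h, -⟩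
    · exact hi h
    · omega
  obtain ⟨p, k₁, hk₁, hmax⟩ : ∃ p k₁, k₁ ≤ x p ∧ ∀ j k, k ≤ x j → L j k ≤ L p k₁ := by
    have hfin : BddAbove {l | ∃ j k, k ≤ x j ∧ L j k = l} :=
      ⟨V.μ i₀, by rintro _ ⟨j, k, hk, rfl⟩; exact hLμ j k hk⟩
    obtain ⟨p, k₁, hk₁, h⟩ := Nat.sSup_mem
      (⟨L j₀ 0, j₀, 0, Nat.zero_le _, rfl⟩ : {l | ∃ j k, k ≤ x j ∧ L j k = l}.Nonempty) hfin
    exact ⟨p, k₁, hk₁, fun j k hk => h ▸ le_csSup hfin ⟨j, k, hk, rfl⟩⟩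
  have hM1 : 1 ≤ L p k₁ := by
    have := hmax j₀ 0 (Nat.zero_le _)
    omega
  have hDiam : ∀ l ≤ L p k₁, Metric.diam (V.U i₀ l) < ε := fun l hl =>
    hV.diam_lt (hl.trans (hLμ p k₁ hk₁))
  rw [← V.base i₀]
  by_cases hq : ∃ q, q ≠ p ∧ L q (x q) = 0
  · obtain ⟨q, hqp, hq0⟩ := hq
    have htx : ∀ j, Function.update x p k₁ j ≤ x j := by
      intro j
      by_cases hj : j = p
      · subst hj; simpa using hk₁
      · simp [hj]
    refine W.exists_fold p (Function.update x p k₁) L (L p k₁) (V.U i₀) hε hW hM1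
      (fun j => (htx j).trans (hxμ j)) hL₀
      (fun j k hk => hstep j k (by have := htx j; have := hxμ j; omega))
      (fun j k hk => hmax j k (hk.trans (htx j)))
      ⟨q, x q, by simp [hqp], hq0⟩ ⟨p, k₁, by simp, rfl⟩ (fun _ => by simp) ?_ hDiam
      (fun j k hk => hWD j k (hk.trans (htx j)))
    intro j hj hlt
    rw [Function.update_of_ne hj] at hlt ⊢
    exact hx0 j hlt
  · push Not at hq
    obtain ⟨a, ha⟩ : ∃ a, a ≠ p := by
      have : Nontrivial (Fin m) := Fin.nontrivial_iff_two_le.2 hm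
      exact exists_ne p
    obtain ⟨q, hq0⟩ := hexit
    exact W.exists_fold a x L (L p k₁) (V.U i₀) hε hW hM1 hxμ hL₀
      (fun j k hk => hstep j k (by have := hxμ j; omega)) hmax ⟨q, x q, le_rfl, hq0⟩
      ⟨p, k₁, hk₁, rfl⟩ (fun hlt => absurd (hx0 a hlt) (hq a ha)) (fun j _ => hx0 j) hDiam hWD

end

end SimpleOdCover

/-- Let `n ≥ 3`, `K` a continuum and `v ∈ K` a branch point of `K` of
order `n`.  If `K` is simple-`(n-1)`-od-like in the covering sense, then for every
`ε > 0` there are `1 ≤ n' ≤ n - 1` and a finite open cover `𝒰` of `K` of mesh `< ε`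
whose nerve is a simple-`n'`-od with distinguished element `U₀` such that the
distance from `v` to `U₀` is `< ε`. -/
theorem statement1 {K : Type*} [MetricSpace K] [CompactSpace K] [ConnectedSpace K]
    [Nonempty K] (n : ℕ) (hn : 3 ≤ n) (v : K)
    (hv : IsBranchPointOfOrder v n)
    (hK : SimpleOdLikeCov K (n - 1)) :
    ∀ ε : ℝ, 0 < ε → ∃ n' : ℕ, 1 ≤ n' ∧ n' ≤ n - 1 ∧
      ∃ C : SimpleOdCover K n', C.MeshLT ε ∧ Metric.infDist v C.U₀ < ε := by
  intro ε hε
  have hdist : ∀ (n' : ℕ) (C : SimpleOdCover K n') (s : Set K), v ∈ s → C.U₀ ⊆ s →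
      Metric.diam s < ε → Metric.infDist v C.U₀ < ε := by
    intro n' C s hvs hs hsε
    obtain ⟨y, hy⟩ := C.nonempty₀
    exact ((Metric.infDist_le_dist_of_mem hy).trans (Metric.dist_le_diam_of_mem
      Metric.isBounded_of_compactSpace hvs (hs hy))).trans_lt hsε
  by_cases hsmall : Metric.diam (Set.univ : Set K) < ε
  · obtain ⟨C, hC⟩ := hK ε hε
    exact ⟨n - 1, by omega, le_rfl, C, hC,
      hdist _ C Set.univ (Set.mem_univ v) (Set.subset_univ _) hsmall⟩
  · obtain ⟨V, hV, hvV⟩ := hv ε hε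
    obtain ⟨δ, hδ, hδV⟩ := V.exists_refinement_scale (by omega)
    obtain ⟨W, hW⟩ := hK (min ε δ) (lt_min hε hδ)
    have hWε : W.MeshLT ε := ⟨hW.1.trans_le (min_le_left _ _),
      fun i j h1 h2 => (hW.2 i j h1 h2).trans_le (min_le_left _ _)⟩
    obtain ⟨n', h1, h2, C, hC, hCV⟩ := V.exists_centre_subset (by omega) W (by omega)
      (not_lt.1 hsmall) hV hWε
      (fun j k hk => hδV _ (W.nonempty_U_s1 hk) ((hW.diam_lt hk).trans_le (min_le_right _ _)))
    exact ⟨n', h1, h2, C, hC, hdist _ C V.U₀ hvV hCV hV.1⟩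
end

section
/- Let n ≥ 3 be an integer and let K be a continuum homeomorphic to the inverse limit lim←(X_i, Φ_i), where each X_i is a simple-n-od graph and each Φ_i : X_{i+1} → X_i is a surjective simplicial map. If K is simple-(n−1)-od-like in the covering sense, then for every index i there exist an index j > i, an integer ñ with 1 ≤ ñ ≤ n−1, a simple-ñ-od graph T with branch point t_0, and simplicial maps α : X_j → T and β : T → X_i such that β ∘ α = Φ_i^j and β(t_0) = x_0, where x_0 is the branch point of X_i. -/
/-! ## Graphs (geometric realizations of finite connected 1-complexes) -/

/-- The data of a graph structure on a space `G`: a finite vertex set and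
finitely many parametrized edges. -/
structure GraphData (G : Type*) where
  verts : Finset G
  nE : ℕ
  edge : Fin nE → ℝ → G

namespace GraphData

variable {G : Type*}

/-- Two vertices are adjacent if they are joined by an edge. -/
def Adj (Γ : GraphData G) (v w : G) : Prop :=
  ∃ e, ({Γ.edge e 0, Γ.edge e 1} : Set G) = {v, w}

/-- The axioms making `Γ` an actual graph (a finite connected one-dimensional
simplicial complex realized in `G`): each edge is an arc (parametrized by `[0,1]`)
joining two distinct vertices, open edges avoid the vertices, the edges cover `G`,
two distinct edges meet only in vertices, and an edge is determined by its
endpoints. -/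
def IsGraph [TopologicalSpace G] (Γ : GraphData G) : Prop :=
  (∀ e, ContinuousOn (Γ.edge e) (Set.Icc 0 1)) ∧
  (∀ e, Set.InjOn (Γ.edge e) (Set.Icc 0 1)) ∧
  (∀ e, Γ.edge e 0 ∈ Γ.verts) ∧
  (∀ e, Γ.edge e 1 ∈ Γ.verts) ∧
  (∀ e, Γ.edge e 0 ≠ Γ.edge e 1) ∧
  (∀ e, ∀ t ∈ Set.Ioo (0:ℝ) 1, Γ.edge e t ∉ (Γ.verts : Set G)) ∧
  (⋃ e, Γ.edge e '' Set.Icc 0 1) = Set.univ ∧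
  (∀ e e', e ≠ e' →
    (Γ.edge e '' Set.Icc 0 1) ∩ (Γ.edge e' '' Set.Icc 0 1) ⊆ (Γ.verts : Set G)) ∧
  (∀ e e', ({Γ.edge e 0, Γ.edge e 1} : Set G) = {Γ.edge e' 0, Γ.edge e' 1} → e = e')

end GraphData

/-- A simplicial map between graphs: continuous, vertices to vertices, and each
edge is mapped either onto a vertex or, affinely with respect to the fixed
parametrizations, onto an edge. -/
def IsSimplicialMap {G H : Type*} [TopologicalSpace G] [TopologicalSpace H]
    (Γ : GraphData G) (Δ : GraphData H) (φ : G → H) : Prop :=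
  Continuous φ ∧ (∀ v ∈ Γ.verts, φ v ∈ Δ.verts) ∧
  ∀ e, (∃ w ∈ Δ.verts, ∀ t ∈ Set.Icc (0:ℝ) 1, φ (Γ.edge e t) = w) ∨
    ∃ e', (∀ t ∈ Set.Icc (0:ℝ) 1, φ (Γ.edge e t) = Δ.edge e' t) ∨
          (∀ t ∈ Set.Icc (0:ℝ) 1, φ (Γ.edge e t) = Δ.edge e' (1 - t))

/-- `Γ` is a simple-`m`-od graph with branch point `t₀` and arms given by the
vertex paths `⟨t₀, t i 1, …, t i (k i)⟩` (`i < m`): the arms are nondegenerate,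
pairwise meet exactly in `t₀`, exhaust the vertices, and two vertices are
adjacent exactly when they are consecutive on an arm. -/
def IsSimpleOdWith {G : Type*} [TopologicalSpace G] (Γ : GraphData G) (m : ℕ) (t₀ : G)
    (k : Fin m → ℕ) (t : Fin m → ℕ → G) : Prop :=
  Γ.IsGraph ∧ (∀ i, 1 ≤ k i) ∧ (∀ i, t i 0 = t₀) ∧
  ((Γ.verts : Set G) = {t₀} ∪ {x | ∃ i j, 1 ≤ j ∧ j ≤ k i ∧ x = t i j}) ∧
  (∀ i j i' j', 1 ≤ j → j ≤ k i → 1 ≤ j' → j' ≤ k i' → t i j = t i' j' →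
    i = i' ∧ j = j') ∧
  (∀ i j, 1 ≤ j → j ≤ k i → t i j ≠ t₀) ∧
  (∀ v w, Γ.Adj v w ↔ ∃ i j, j + 1 ≤ k i ∧ ({v, w} : Set G) = {t i j, t i (j + 1)})

/-- `Γ` is a simple-`m`-od graph with branch point `t₀`. -/
def IsSimpleOdGraphData {G : Type*} [TopologicalSpace G] (Γ : GraphData G) (m : ℕ)
    (t₀ : G) : Prop :=
  ∃ k t, IsSimpleOdWith Γ m t₀ k t

/-- Composite bonding maps `Φ_i^{i+k} : X (i+k) → X i` of an inverse sequence. -/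
def bondIter {X : ℕ → Type*} (Φ : ∀ i, X (i + 1) → X i) (i : ℕ) :
    ∀ k : ℕ, X (i + k) → X i
  | 0 => id
  | k + 1 => fun x => bondIter Φ i k (Φ (i + k) x)

/-- The inverse limit of an inverse sequence of spaces. -/
def InvLimit {X : ℕ → Type*} (Φ : ∀ i, X (i + 1) → X i) : Type _ :=
  {x : ∀ i, X i // ∀ i, Φ i (x (i + 1)) = x i}

instance {X : ℕ → Type*} [∀ i, TopologicalSpace (X i)] (Φ : ∀ i, X (i + 1) → X i) :
    TopologicalSpace (InvLimit Φ) :=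
  instTopologicalSpaceSubtype

/-! ## Combinatorial simple-`m`-ods -/

/-- Two points of the combinatorial simple-`m`-od with infinite arms `{a} × ℕ`, whose points
`(a, 0)` all represent the centre, are equal or consecutive. -/
def OdNear {m : ℕ} (u v : Fin m × ℕ) : Prop :=
  (u.1 = v.1 ∧ u.2 ≤ v.2 + 1 ∧ v.2 ≤ u.2 + 1) ∨ (min u.2 v.2 = 0 ∧ max u.2 v.2 ≤ 1)

/-- Two pairs represent the same point of the combinatorial simple-`m`-od. -/
def OdEq {m : ℕ} (u v : Fin m × ℕ) : Prop :=
  u = v ∨ (u.2 = 0 ∧ v.2 = 0)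

namespace OdNear

variable {m : ℕ} {u v w : Fin m × ℕ}

theorem refl (u : Fin m × ℕ) : OdNear u u := by
  unfold OdNear; left; omega

theorem symm (h : OdNear u v) : OdNear v u := by
  rcases h with ⟨h1, h2, h3⟩ | ⟨h1, h2⟩
  · exact Or.inl ⟨h1.symm, h3, h2⟩
  · exact Or.inr ⟨by rwa [min_comm], by rwa [max_comm]⟩

theorem le_succ (h : OdNear u v) : v.2 ≤ u.2 + 1 := by
  rcases h with h | h <;> omega

theorem fst_eq (h : OdNear u v) (hu : u.2 ≠ 0) (hv : v.2 ≠ 0) : u.1 = v.1 := by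
  rcases h with h | h
  · exact h.1
  · omega

theorem congr_left (h : OdNear v w) (e : OdEq u v) : OdNear u w := by
  rcases e with rfl | e
  · exact h
  · have := h.le_succ
    right; omega

theorem map_of_step {n : ℕ} {f : Fin m × ℕ → Fin n × ℕ}
    (hstep : ∀ a b, OdNear (f (a, b)) (f (a, b + 1)))
    (hzero : ∀ a a', OdEq (f (a, 0)) (f (a', 0))) (h : OdNear u v) : OdNear (f u) (f v) := by
  obtain ⟨a, b⟩ := u
  obtain ⟨a', b'⟩ := v
  have key : ∀ c c', OdNear (f (c, 0)) (f (c', 1)) := fun c c' =>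
    (hstep c' 0).congr_left (hzero c c')
  rcases h with ⟨h1, h2, h3⟩ | ⟨h1, h2⟩
  · simp only at h1 h2 h3
    subst h1
    obtain h | h | h : b = b' ∨ b' = b + 1 ∨ b = b' + 1 := by omega
    · subst h; exact refl _
    · subst h; exact hstep _ _
    · subst h; exact (hstep _ _).symm
  · simp only at h1 h2
    obtain ⟨h, h'⟩ | ⟨h, h'⟩ | ⟨h, h'⟩ : (b = 0 ∧ b' = 0) ∨ (b = 0 ∧ b' = 1) ∨ (b = 1 ∧ b' = 0) := by
      omega
    · subst h h'; exact (refl _).congr_left (hzero _ _)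
    · subst h h'; exact key _ _
    · subst h h'; exact (key _ _).symm

end OdNear

section Folding

variable {m n : ℕ} {h : Fin m × ℕ → Fin n × ℕ}

theorem fst_eq_of_forall_ne_zero (hnear : ∀ u v, OdNear u v → OdNear (h u) (h v)) {a : Fin m}
    {b : ℕ} (hb : ∀ b' ≤ b, (h (a, b')).2 ≠ 0) : (h (a, b)).1 = (h (a, 0)).1 := by
  induction b with
  | zero => rfl
  | succ b ih =>
    rw [← ih fun b' hb' => hb b' (by omega)]
    refine ((hnear _ _ ?_).fst_eq (hb b (by omega)) (hb (b + 1) le_rfl)).symm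
    exact Or.inl ⟨rfl, by omega, by omega⟩

/-- The folding lemma when one of the arms never reaches the centre of the target. -/
theorem exists_folding_of_arm_avoiding (k : Fin n → ℕ)
    (hnear : ∀ u v, OdNear u v → OdNear (h u) (h v)) (hzero : ∀ a a', h (a, 0) = h (a', 0))
    (hk : ∀ u, (h u).2 ≤ k (h u).1) (R : Fin m) (hR : ∀ b, (h (R, b)).2 ≠ 0) :
    ∃ (g : Fin m × ℕ → Fin m × ℕ) (h' : Fin m × ℕ → Fin n × ℕ),
      (∀ u v, OdNear u v → OdNear (g u) (g v)) ∧ (∀ u v, OdNear u v → OdNear (h' u) (h' v)) ∧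
      (∀ a, (h' (a, 0)).2 = 0) ∧ (∀ u, (h' u).2 ≤ k (h' u).1) ∧ ∀ u, h' (g u) = h u := by
  classical
  set A := (h (R, 0)).1 with hA
  have hstep : ∀ a b, OdNear (h (a, b)) (h (a, b + 1)) := fun a b =>
    hnear _ _ (Or.inl ⟨rfl, by omega, by omega⟩)
  have hPA : ∀ a b, (∀ b' ≤ b, (h (a, b')).2 ≠ 0) → h (a, b) = (A, (h (a, b)).2) := by
    intro a b hb
    rw [hA, hzero R a, ← fst_eq_of_forall_ne_zero hnear hb]
  have hfind : ∀ a b, (¬ ∀ b' ≤ b, (h (a, b')).2 ≠ 0) → ∃ b, (h (a, b)).2 = 0 := by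
    intro a b hb
    push Not at hb
    exact ⟨_, hb.choose_spec.2⟩
  let c : Fin m → ℕ := fun a => sInf {b | (h (a, b)).2 = 0}
  have hc : ∀ a, (∃ b, (h (a, b)).2 = 0) → (h (a, c a)).2 = 0 := fun a ha =>
    Nat.sInf_mem (s := {b | (h (a, b)).2 = 0}) ha
  have hcle : ∀ a b, (¬ ∀ b' ≤ b, (h (a, b')).2 ≠ 0) → c a ≤ b := by
    intro a b hb
    push Not at hb
    obtain ⟨b', h1, h2⟩ := hb
    exact (Nat.sInf_le (s := {b | (h (a, b)).2 = 0}) h2).trans h1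
  have hlec : ∀ a b, (∀ b' ≤ b, (h (a, b')).2 ≠ 0) → (∃ b, (h (a, b)).2 = 0) → b < c a := by
    intro a b hb ha
    by_contra! hlt
    exact hb _ hlt (hc a ha)
  let g : Fin m × ℕ → Fin m × ℕ := fun u =>
    if ∀ b' ≤ u.2, (h (u.1, b')).2 ≠ 0 then (R, (h u).2) else (u.1, u.2 - c u.1)
  let h' : Fin m × ℕ → Fin n × ℕ := fun u =>
    if u.1 = R then (A, min u.2 (k A)) else
      if ∃ b, (h (u.1, b)).2 = 0 then h (u.1, u.2 + c u.1) else (A, 0)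
  have h'zero : ∀ a, (h' (a, 0)).2 = 0 := by
    intro a
    by_cases h1 : a = R
    · simp [h', h1]
    · by_cases h2 : ∃ b, (h (a, b)).2 = 0
      · simp only [h', h1, h2, if_false, if_true, zero_add]
        exact hc a h2
      · simp only [h', h1, h2, if_false]
  refine ⟨g, h', fun u v => OdNear.map_of_step ?_ ?_, fun u v => OdNear.map_of_step ?_ ?_,
    h'zero, ?_, ?_⟩
  · intro a b
    by_cases h2 : ∀ b' ≤ b + 1, (h (a, b')).2 ≠ 0
    · have h1 : ∀ b' ≤ b, (h (a, b')).2 ≠ 0 := fun b' hb' => h2 b' (by omega)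
      simp only [g, if_pos h1, if_pos h2]
      exact Or.inl ⟨rfl, (hstep a b).symm.le_succ, (hstep a b).le_succ⟩
    · by_cases h1 : ∀ b' ≤ b, (h (a, b')).2 ≠ 0
      · have h3 : c a = b + 1 := le_antisymm (hcle a _ h2) (hlec a b h1 (hfind a _ h2))
        have h4 : (h (a, b + 1)).2 = 0 := h3 ▸ hc a (hfind a _ h2)
        have h5 := (hstep a b).symm.le_succ
        simp only [g, if_pos h1, if_neg h2]
        right
        simp only
        omega
      · have := hcle a b h1
        simp only [g, if_neg h1, if_neg h2]
        refine Or.inl ⟨rfl, ?_⟩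
        simp only
        omega
  · intro a a'
    left
    have : ∀ a, ∀ b' ≤ 0, (h (a, b')).2 ≠ 0 := by
      intro a b' hb'
      obtain rfl : b' = 0 := by omega
      rw [hzero a R]
      exact hR 0
    simp only [g, if_pos (this _), hzero a a']
  · intro a b
    by_cases h1 : a = R
    · simp only [h', h1, if_true]
      refine Or.inl ⟨rfl, ?_⟩
      simp only
      omega
    · by_cases h2 : ∃ b, (h (a, b)).2 = 0
      · simp only [h', h1, h2, if_false, if_true]
        have := hstep a (b + c a)
        rwa [show b + c a + 1 = b + 1 + c a by ring] at this
      · simp only [h', h1, h2, if_false]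
        exact OdNear.refl _
  · exact fun a a' => Or.inr ⟨h'zero a, h'zero a'⟩
  · rintro ⟨a, b⟩
    by_cases h1 : a = R
    · simp [h', h1]
    · by_cases h2 : ∃ b, (h (a, b)).2 = 0
      · simp only [h', h1, h2, if_false, if_true]
        exact hk _
      · simp [h', h1, h2]
  · rintro ⟨a, b⟩
    by_cases h1 : ∀ b' ≤ b, (h (a, b')).2 ≠ 0
    · have h2 := hPA a b h1
      have h3 := hk (a, b)
      simp only [g, if_pos h1, h', if_true]
      rw [h2] at h3 ⊢
      simp only at h3 ⊢
      rw [min_eq_left h3]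
    · have h2 : a ≠ R := by
        rintro rfl
        exact h1 fun b' _ => hR b'
      simp only [g, if_neg h1, h', if_neg h2, if_pos (hfind a b h1)]
      rw [Nat.sub_add_cancel (hcle a b h1)]

/-- The folding lemma when all arms reach the centre of the target. -/
theorem exists_folding_of_forall_arm_meets (hm : 2 ≤ m) (k : Fin n → ℕ)
    (hnear : ∀ u v, OdNear u v → OdNear (h u) (h v)) (hzero : ∀ a a', h (a, 0) = h (a', 0))
    (hk : ∀ u, (h u).2 ≤ k (h u).1) (h0 : ∀ a, (h (a, 0)).2 ≠ 0)
    (hE : ∀ a, ∃ b, (h (a, b)).2 = 0) :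
    ∃ (g : Fin m × ℕ → Fin m × ℕ) (h' : Fin m × ℕ → Fin n × ℕ),
      (∀ u v, OdNear u v → OdNear (g u) (g v)) ∧ (∀ u v, OdNear u v → OdNear (h' u) (h' v)) ∧
      (∀ a, (h' (a, 0)).2 = 0) ∧ (∀ u, (h' u).2 ≤ k (h' u).1) ∧ ∀ u, h' (g u) = h u := by
  classical
  have hstep : ∀ a b, OdNear (h (a, b)) (h (a, b + 1)) := fun a b =>
    hnear _ _ (Or.inl ⟨rfl, by omega, by omega⟩)
  let c : Fin m → ℕ := fun a => Nat.find (hE a)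
  have hc : ∀ a, (h (a, c a)).2 = 0 := fun a => Nat.find_spec (hE a)
  have hlt : ∀ {a b}, b < c a → (h (a, b)).2 ≠ 0 := fun hb => Nat.find_min (hE _) hb
  have hcpos : ∀ a, 0 < c a := fun a => (Nat.find_pos (hE a)).2 (h0 a)
  let top : Fin m → ℕ := fun a => (Finset.range (c a)).sup fun b => (h (a, b)).2
  have hletop : ∀ {a b}, b < c a → (h (a, b)).2 ≤ top a := fun {a b} hb =>
    Finset.le_sup (f := fun b => (h (a, b)).2) (Finset.mem_range.2 hb)
  obtain ⟨R, -, hRmax⟩ := Finset.exists_max_image (Finset.univ : Finset (Fin m)) top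
    ⟨⟨0, by omega⟩, Finset.mem_univ _⟩
  set A := (h (R, 0)).1 with hA
  have hPA : ∀ {a b}, b < c a → h (a, b) = (A, (h (a, b)).2) := by
    intro a b hb
    rw [hA, hzero R a, ← fst_eq_of_forall_ne_zero hnear fun b' hb' => hlt (hb'.trans_lt hb)]
  let M := (Finset.univ.erase R).sup top
  have hleM : ∀ {a b}, a ≠ R → b < c a → (h (a, b)).2 ≤ M := fun {a b} ha hb =>
    (hletop hb).trans (Finset.le_sup (Finset.mem_erase.2 ⟨ha, Finset.mem_univ _⟩))
  have h0M : (h (R, 0)).2 ≤ M := by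
    obtain ⟨a, ha⟩ : ∃ a : Fin m, a ≠ R := by
      have : Nontrivial (Fin m) := Fin.nontrivial_iff_two_le.2 hm
      exact exists_ne R
    rw [hzero R a]
    exact hleM ha (hcpos a)
  obtain ⟨τ, hτc, hτ, hτlt⟩ : ∃ τ < c R, (h (R, τ)).2 = M ∧ ∀ b < τ, (h (R, b)).2 < M := by
    have hex : ∃ b, b < c R ∧ M ≤ (h (R, b)).2 := by
      obtain ⟨b, hb, hb'⟩ := Finset.exists_mem_eq_sup (Finset.range (c R))
        ⟨0, Finset.mem_range.2 (hcpos R)⟩ fun b => (h (R, b)).2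
      refine ⟨b, Finset.mem_range.1 hb, ?_⟩
      rw [← hb']
      exact Finset.sup_le fun a _ => hRmax a (Finset.mem_univ _)
    have hs := Nat.find_spec hex
    have hmin : ∀ b < Nat.find hex, (h (R, b)).2 < M := by
      intro b hb
      have := Nat.find_min hex hb
      by_contra! hcon
      exact this ⟨hb.trans hs.1, hcon⟩
    refine ⟨Nat.find hex, hs.1, le_antisymm ?_ hs.2, hmin⟩
    rcases Nat.eq_zero_or_pos (Nat.find hex) with hz | hz
    · rw [hz]; exact h0M
    · have h1 := hmin (Nat.find hex - 1) (by omega)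
      have h2 := (hstep R (Nat.find hex - 1)).le_succ
      rw [Nat.sub_add_cancel hz] at h2
      omega
  let g : Fin m × ℕ → Fin m × ℕ := fun u =>
    if u.1 = R then (R, if u.2 ≤ τ then (h (R, u.2)).2 else M + (u.2 - τ)) else
      if u.2 < c u.1 then (R, (h u).2) else (u.1, u.2 - c u.1)
  let h' : Fin m × ℕ → Fin n × ℕ := fun u =>
    if u.1 = R then (if u.2 ≤ M then (A, u.2) else h (R, τ + (u.2 - M))) else
      h (u.1, u.2 + c u.1)
  have h'zero : ∀ a, (h' (a, 0)).2 = 0 := by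
    intro a
    by_cases h1 : a = R
    · simp [h', h1]
    · simp only [h', h1, if_false, zero_add]
      exact hc a
  have hRτ : h (R, τ) = (A, M) := by rw [hPA hτc, hτ]
  refine ⟨g, h', fun u v => OdNear.map_of_step ?_ ?_, fun u v => OdNear.map_of_step ?_ ?_,
    h'zero, ?_, ?_⟩
  · intro a b
    by_cases h1 : a = R
    · subst h1
      simp only [g, if_true]
      left
      refine ⟨rfl, ?_⟩
      have h2 := (hstep a b).le_succ
      have h3 := (hstep a b).symm.le_succ
      simp only
      by_cases h4 : b < τ
      · rw [if_pos (by omega), if_pos (by omega)]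
        exact ⟨h3, h2⟩
      · by_cases h5 : b = τ
        · subst h5
          rw [if_pos le_rfl, if_neg (by omega), hτ]
          omega
        · rw [if_neg (by omega), if_neg (by omega)]
          omega
    · have h2 := (hstep a b).le_succ
      have h3 := (hstep a b).symm.le_succ
      simp only [g, h1, if_false]
      by_cases h4 : b + 1 < c a
      · rw [if_pos (by omega), if_pos h4]
        exact Or.inl ⟨rfl, h3, h2⟩
      · by_cases h5 : b < c a
        · have h6 := hc a
          rw [show c a = b + 1 by omega] at h6
          rw [if_pos h5, if_neg h4]
          right
          simp only
          omega
        · rw [if_neg h5, if_neg h4]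
          refine Or.inl ⟨rfl, ?_⟩
          simp only
          omega
  · intro a a'
    have : ∀ a, g (a, 0) = (R, (h (R, 0)).2) := by
      intro a
      by_cases h1 : a = R
      · simp [g, h1]
      · simp only [g, h1, if_false, if_pos (hcpos a), hzero a R]
    left
    rw [this, this]
  · intro a b
    by_cases h1 : a = R
    · simp only [h', h1, if_true]
      by_cases h2 : b < M
      · rw [if_pos (by omega), if_pos (by omega)]
        refine Or.inl ⟨rfl, ?_⟩
        simp only
        omega
      · by_cases h3 : b = M
        · rw [if_pos (by omega), if_neg (by omega), h3, ← hRτ, Nat.add_sub_cancel_left]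
          exact hstep _ _
        · rw [if_neg (by omega), if_neg (by omega),
            show τ + (b + 1 - M) = τ + (b - M) + 1 by omega]
          exact hstep _ _
    · simp only [h', h1, if_false]
      rw [show b + 1 + c a = b + c a + 1 by ring]
      exact hstep _ _
  · exact fun a a' => Or.inr ⟨h'zero a, h'zero a'⟩
  · rintro ⟨a, b⟩
    by_cases h1 : a = R
    · simp only [h', h1, if_true]
      by_cases h2 : b ≤ M
      · rw [if_pos h2]
        have := hk (R, τ)
        rw [hRτ] at this
        exact h2.trans this
      · rw [if_neg h2]
        exact hk _
    · simp only [h', h1, if_false]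
      exact hk _
  · rintro ⟨a, b⟩
    by_cases h1 : a = R
    · subst h1
      simp only [g, if_true, h']
      by_cases h2 : b ≤ τ
      · have h3 : (h (a, b)).2 ≤ M := by
          rcases h2.lt_or_eq with h2 | h2
          · exact (hτlt b h2).le
          · rw [h2, hτ]
        rw [if_pos h2, if_pos h3, hPA (h2.trans_lt hτc)]
      · rw [if_neg h2, if_neg (by omega)]
        congr 2
        omega
    · simp only [g, h1, if_false]
      by_cases h2 : b < c a
      · simp only [if_pos h2, h', if_true, if_pos (hleM h1 h2)]
        exact (hPA h2).symm
      · simp only [if_neg h2, h', h1, if_false]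
        rw [Nat.sub_add_cancel (by omega)]

/-- A simplicial map from a simple-`m`-od (`m ≥ 2`) to a simple-`n`-od factors through a
simplicial map of a simple-`m`-od that preserves the centre. -/
theorem exists_folding (hm : 2 ≤ m) (k : Fin n → ℕ)
    (hnear : ∀ u v, OdNear u v → OdNear (h u) (h v)) (hzero : ∀ a a', h (a, 0) = h (a', 0))
    (hk : ∀ u, (h u).2 ≤ k (h u).1) :
    ∃ (g : Fin m × ℕ → Fin m × ℕ) (h' : Fin m × ℕ → Fin n × ℕ),
      (∀ u v, OdNear u v → OdNear (g u) (g v)) ∧ (∀ u v, OdNear u v → OdNear (h' u) (h' v)) ∧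
      (∀ a, (h' (a, 0)).2 = 0) ∧ (∀ u, (h' u).2 ≤ k (h' u).1) ∧ ∀ u, h' (g u) = h u := by
  by_cases h0 : ∃ a, (h (a, 0)).2 = 0
  · obtain ⟨a, ha⟩ := h0
    exact ⟨id, h, fun _ _ => id, hnear, fun a' => hzero a' a ▸ ha, hk, fun _ => rfl⟩
  · push Not at h0
    by_cases hE : ∀ a, ∃ b, (h (a, b)).2 = 0
    · exact exists_folding_of_forall_arm_meets hm k hnear hzero hk h0 hE
    · push Not at hE
      obtain ⟨R, hR⟩ := hE
      exact exists_folding_of_arm_avoiding k hnear hzero hk R hR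

end Folding

/-! ## Zones and contraction of a zoned simple-`m`-od -/

/-- A zone is either (a neighbourhood of) a vertex or (the middle of) an edge. Two zones are
compatible if they are equal or are a vertex and an edge containing it. -/
def ZoneCompat {V : Type*} : V ⊕ Sym2 V → V ⊕ Sym2 V → Prop
  | Sum.inl v, Sum.inl w => v = w
  | Sum.inl v, Sum.inr e => v ∈ e
  | Sum.inr e, Sum.inl v => v ∈ e
  | Sum.inr e, Sum.inr f => e = f

/-- The last vertex zone met by a sequence of zones. -/
def lastVertex {V : Type*} (x : V) (s : ℕ → V ⊕ Sym2 V) : ℕ → V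
  | 0 => x
  | b + 1 => Sum.elim id (fun _ => lastVertex x s b) (s (b + 1))

open Classical in
/-- The number of changes of value of a sequence among its first terms. -/
noncomputable def changeCount {V : Type*} (L : ℕ → V) : ℕ → ℕ
  | 0 => 0
  | b + 1 => changeCount L b + if L (b + 1) = L b then 0 else 1

section Contraction

variable {V : Type*}

theorem changeCount_mono (L : ℕ → V) : Monotone (changeCount L) :=
  monotone_nat_of_le_succ fun _ => Nat.le_add_right _ _

theorem changeCount_le (L : ℕ → V) (b : ℕ) : changeCount L b ≤ b := by
  induction b with
  | zero => exact le_rfl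
  | succ b ih =>
    simp only [changeCount]
    split_ifs <;> omega

/-- A sequence can be reparametrized by the number of its changes. -/
theorem exists_contracted_sequence (L : ℕ → V) (R : V → V → Prop)
    (hL : ∀ b, L b = L (b + 1) ∨ R (L b) (L (b + 1))) (B : ℕ) :
    ∃ F : ℕ → V, (∀ b ≤ B, F (changeCount L b) = L b) ∧
      (∀ q, F q = F (q + 1) ∨ R (F q) (F (q + 1))) ∧ ∀ q, F q ∈ Set.range L := by
  induction B with
  | zero =>
    refine ⟨fun _ => L 0, fun b hb => ?_, fun _ => Or.inl rfl, fun _ => ⟨0, rfl⟩⟩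
    rw [Nat.le_zero.1 hb]
  | succ B ih =>
    obtain ⟨F, h1, h2, h3⟩ := ih
    by_cases hB : L (B + 1) = L B
    · refine ⟨F, fun b hb => ?_, h2, h3⟩
      rcases hb.lt_or_eq with hb | rfl
      · exact h1 b (by omega)
      · rw [changeCount, if_pos hB, add_zero, h1 B le_rfl, hB]
    · refine ⟨fun q => if q ≤ changeCount L B then F q else L (B + 1), fun b hb => ?_,
        fun q => ?_, fun q => ?_⟩
      · rcases hb.lt_or_eq with hb | rfl
        · have hb : b ≤ B := by omega
          simp only [if_pos (changeCount_mono L hb), h1 b hb]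
        · simp only [changeCount, if_neg hB]
          rw [if_neg (by omega)]
      · by_cases hq : q < changeCount L B
        · simp only
          rw [if_pos hq.le, if_pos (by omega)]
          exact h2 q
        · by_cases hq' : q = changeCount L B
          · subst hq'
            simp only
            rw [if_pos le_rfl, if_neg (by omega), h1 B le_rfl]
            exact hL B
          · simp only
            rw [if_neg (by omega), if_neg (by omega)]
            exact Or.inl rfl
      · simp only
        split_ifs
        · exact h3 q
        · exact ⟨_, rfl⟩

variable {m : ℕ} (x : V) (H : Fin m × ℕ → V ⊕ Sym2 V)

/-- The vertex labelling a point of a zoned od. -/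
def odLabel (a : Fin m) : ℕ → V :=
  lastVertex x fun b => H (a, b)

/-- The projection of a zoned od onto the od of its label components. -/
noncomputable def odContract (u : Fin m × ℕ) : Fin m × ℕ :=
  (u.1, changeCount (odLabel x H u.1) u.2)

variable {x H}

theorem odLabel_of_inl (hzero : ∀ a, H (a, 0) = Sum.inl x) {a : Fin m} {b : ℕ} {v : V}
    (h : H (a, b) = Sum.inl v) : odLabel x H a b = v := by
  cases b with
  | zero => exact Sum.inl_injective ((hzero a).symm.trans h)
  | succ b => simp [odLabel, lastVertex, h]

theorem odLabel_mem_of_inr (hzero : ∀ a, H (a, 0) = Sum.inl x)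
    (hH : ∀ u v, OdNear u v → ZoneCompat (H u) (H v)) {a : Fin m} {b : ℕ} {e : Sym2 V}
    (h : H (a, b) = Sum.inr e) : odLabel x H a b ∈ e := by
  induction b with
  | zero => simp [hzero a] at h
  | succ b ih =>
    have h1 : odLabel x H a (b + 1) = odLabel x H a b := by simp [odLabel, lastVertex, h]
    have h2 := hH (a, b) (a, b + 1) (Or.inl ⟨rfl, by omega, by omega⟩)
    rw [h] at h2
    rw [h1]
    cases h3 : H (a, b) with
    | inl v =>
      rw [h3] at h2
      rw [odLabel_of_inl hzero h3]
      exact h2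
    | inr f =>
      rw [h3] at h2
      obtain rfl : f = e := h2
      exact ih h3

theorem odLabel_succ (a : Fin m) (b : ℕ) :
    odLabel x H a (b + 1) = odLabel x H a b ∨ H (a, b + 1) = Sum.inl (odLabel x H a (b + 1)) := by
  cases h : H (a, b + 1) with
  | inl v => right; simp [odLabel, lastVertex, h]
  | inr e => left; simp [odLabel, lastVertex, h]

theorem odLabel_step (hzero : ∀ a, H (a, 0) = Sum.inl x)
    (hH : ∀ u v, OdNear u v → ZoneCompat (H u) (H v)) {R : V → V → Prop}
    (hR : ∀ u v w, H u = Sum.inr s(v, w) → R v w) (a : Fin m) (b : ℕ) :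
    odLabel x H a b = odLabel x H a (b + 1) ∨ R (odLabel x H a b) (odLabel x H a (b + 1)) := by
  rcases odLabel_succ (x := x) (H := H) a b with h | h
  · exact Or.inl h.symm
  · have h2 := hH (a, b) (a, b + 1) (Or.inl ⟨rfl, by omega, by omega⟩)
    rw [h] at h2
    cases h3 : H (a, b) with
    | inl v =>
      rw [h3] at h2
      left
      rw [odLabel_of_inl hzero h3]
      exact h2
    | inr e =>
      rw [h3] at h2
      by_cases h4 : odLabel x H a b = odLabel x H a (b + 1)
      · exact Or.inl h4
      · right
        have h5 := (Sym2.mem_and_mem_iff h4).1 ⟨odLabel_mem_of_inr hzero hH h3, h2⟩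
        exact hR _ _ _ (h5 ▸ h3)

theorem odContract_outward (a : Fin m) (b : ℕ) :
    ((odContract x H (a, b + 1)).2 = (odContract x H (a, b)).2 ∧
      odLabel x H a (b + 1) = odLabel x H a b) ∨
    ((odContract x H (a, b + 1)).2 = (odContract x H (a, b)).2 + 1 ∧
      H (a, b + 1) = Sum.inl (odLabel x H a (b + 1)) ∧
      odLabel x H a (b + 1) ≠ odLabel x H a b) := by
  by_cases h : odLabel x H a (b + 1) = odLabel x H a b
  · left; simp [odContract, changeCount, h]
  · right
    refine ⟨by simp [odContract, changeCount, h], ?_, h⟩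
    exact (odLabel_succ a b).resolve_left h

/-- The effect of a step of a walk on labels and label components. -/
theorem odContract_step {u w : Fin m × ℕ} (h : OdNear u w) :
    (((u.1 = w.1 ∧ (odContract x H u).2 = (odContract x H w).2) ∨
      ((odContract x H u).2 = 0 ∧ (odContract x H w).2 = 0 ∧ (u.2 = 0 ∨ w.2 = 0))) ∧
        odLabel x H u.1 u.2 = odLabel x H w.1 w.2) ∨
    ((u.1 = w.1 ∨ u.2 = 0) ∧ (odContract x H w).2 = (odContract x H u).2 + 1 ∧
      H w = Sum.inl (odLabel x H w.1 w.2) ∧ odLabel x H w.1 w.2 ≠ odLabel x H u.1 u.2) ∨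
    ((u.1 = w.1 ∨ w.2 = 0) ∧ (odContract x H u).2 = (odContract x H w).2 + 1 ∧
      H u = Sum.inl (odLabel x H u.1 u.2) ∧ odLabel x H u.1 u.2 ≠ odLabel x H w.1 w.2) := by
  obtain ⟨a, b⟩ := u
  obtain ⟨a', b'⟩ := w
  have hc : ∀ a, (odContract x H (a, 0)).2 = 0 := fun a => rfl
  have hl : ∀ a, odLabel x H a 0 = x := fun a => rfl
  have key : (b = b' ∧ (a = a' ∨ b = 0)) ∨ (b' = b + 1 ∧ (a = a' ∨ b = 0)) ∨
      (b = b' + 1 ∧ (a = a' ∨ b' = 0)) := by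
    rcases h with ⟨h1, h2, h3⟩ | ⟨h1, h2⟩
    · simp only at h1 h2 h3
      have : b = b' ∨ b' = b + 1 ∨ b = b' + 1 := by omega
      tauto
    · simp only at h1 h2
      omega
  rcases key with ⟨rfl, rfl | rfl⟩ | ⟨rfl, ha⟩ | ⟨rfl, ha⟩
  · exact Or.inl ⟨Or.inl ⟨rfl, rfl⟩, rfl⟩
  · exact Or.inl ⟨Or.inr ⟨rfl, rfl, Or.inl rfl⟩, rfl⟩
  · have h1 : (odContract x H (a, b)).2 = (odContract x H (a', b)).2 ∧
        odLabel x H a b = odLabel x H a' b := by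
      rcases ha with rfl | rfl
      · exact ⟨rfl, rfl⟩
      · exact ⟨rfl, rfl⟩
    simp only
    rw [h1.1, h1.2]
    rcases odContract_outward (x := x) (H := H) a' b with ⟨h2, h3⟩ | ⟨h2, h3, h4⟩
    · left
      refine ⟨?_, h3.symm⟩
      rcases ha with rfl | rfl
      · exact Or.inl ⟨rfl, h2.symm⟩
      · exact Or.inr ⟨hc _, by rw [h2, hc], Or.inl rfl⟩
    · exact Or.inr (Or.inl ⟨ha, h2, h3, h4⟩)
  · have h1 : (odContract x H (a', b')).2 = (odContract x H (a, b')).2 ∧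
        odLabel x H a' b' = odLabel x H a b' := by
      rcases ha with rfl | rfl
      · exact ⟨rfl, rfl⟩
      · exact ⟨rfl, rfl⟩
    simp only
    rw [h1.1, h1.2]
    rcases odContract_outward (x := x) (H := H) a b' with ⟨h2, h3⟩ | ⟨h2, h3, h4⟩
    · left
      refine ⟨?_, h3⟩
      rcases ha with rfl | rfl
      · exact Or.inl ⟨rfl, h2⟩
      · exact Or.inr ⟨by rw [h2, hc], hc _, Or.inr rfl⟩
    · exact Or.inr (Or.inr ⟨ha, h2, h3, h4⟩)

/-- A walk which starts at the vertex zone `v` and stays in `v` or the edge zone `e` remains in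
its label component or passes to the parent component. -/
theorem odContract_walk (hzero : ∀ a, H (a, 0) = Sum.inl x) {u : ℕ → Fin m × ℕ} {l : ℕ} {v : V}
    {e : Sym2 V} (hu : ∀ i < l, OdNear (u i) (u (i + 1))) (h0 : H (u 0) = Sum.inl v)
    (hv : ∀ i ≤ l, H (u i) = Sum.inl v ∨ H (u i) = Sum.inr e) :
    (OdEq (odContract x H (u l)) (odContract x H (u 0)) ∧ odLabel x H (u l).1 (u l).2 = v) ∨
    ((u l).1 = (u 0).1 ∧ (odContract x H (u l)).2 + 1 = (odContract x H (u 0)).2 ∧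
      H (u l) = Sum.inr e ∧ odLabel x H (u l).1 (u l).2 ≠ v) := by
  induction l with
  | zero => exact Or.inl ⟨Or.inl rfl, odLabel_of_inl hzero h0⟩
  | succ l ih =>
    have hc0 : ∀ {w : Fin m × ℕ}, w.2 = 0 → H w = Sum.inl x := by
      rintro ⟨a, b⟩ (rfl : b = 0)
      exact hzero a
    have hlab : H (u (l + 1)) = Sum.inl v → odLabel x H (u (l + 1)).1 (u (l + 1)).2 = v :=
      fun h => odLabel_of_inl hzero h
    have hfst : ∀ w, (odContract x H w).1 = w.1 := fun _ => rfl
    have hstep := odContract_step (x := x) (H := H) (hu l l.lt_succ_self)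
    have hnext := hv (l + 1) le_rfl
    rcases ih (fun i hi => hu i (by omega)) fun i hi => hv i (by omega) with
      ⟨h1, h2⟩ | ⟨h1, h2, h3, h4⟩
    · rcases hstep with ⟨h5, h6⟩ | ⟨-, -, h7, h8⟩ | ⟨h5, h6, h7, h8⟩
      · left
        refine ⟨?_, h6 ▸ h2⟩
        rcases h5 with ⟨h5, h7⟩ | ⟨h5, h7, -⟩
        · have : odContract x H (u (l + 1)) = odContract x H (u l) :=
            Prod.ext (by rw [hfst, hfst, h5]) h7.symm
          rwa [this]
        · rcases h1 with h1 | h1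
          · exact Or.inr ⟨h7, h1 ▸ h5⟩
          · exact Or.inr ⟨h7, h1.2⟩
      · exfalso
        rcases hnext with h | h
        · exact h8 ((hlab h).trans h2.symm)
        · simp [h] at h7
      · right
        rcases hnext with h | h
        · exact absurd (h2.trans (hlab h).symm) h8
        · have h9 : (u (l + 1)).2 ≠ 0 := fun h0 => by simp [hc0 h0] at h
          have h10 : odContract x H (u l) = odContract x H (u 0) :=
            h1.resolve_right fun h1 => by omega
          refine ⟨?_, ?_, h, fun h11 => h8 (h2.trans h11.symm)⟩
          · rw [← h5.resolve_right h9, ← hfst (u l), h10, hfst]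
          · rw [← h10, h6]
    · have h9 : (u l).2 ≠ 0 := fun h0 => by simp [hc0 h0] at h3
      rcases hstep with ⟨h5, h6⟩ | ⟨h5, h6, h7, h8⟩ | ⟨h5, h6, h7, h8⟩
      · right
        rcases hnext with h | h
        · exact absurd (h6.trans (hlab h)) h4
        · have h10 : (u (l + 1)).2 ≠ 0 := fun h0 => by simp [hc0 h0] at h
          rcases h5 with ⟨h5, h7⟩ | ⟨-, -, h7⟩
          · exact ⟨h5 ▸ h1, h7 ▸ h2, h, h6 ▸ h4⟩
          · tauto
      · left
        rcases hnext with h | h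
        · refine ⟨Or.inl (Prod.ext ?_ ?_), hlab h⟩
          · rw [hfst, hfst, ← h5.resolve_right h9, h1]
          · rw [h6, h2]
        · simp [h] at h7
      · simp [h3] at h7

/-- The ends of a walk along an edge lie in equal or adjacent label components. -/
theorem odNear_odContract_of_walk (hzero : ∀ a, H (a, 0) = Sum.inl x) {u : ℕ → Fin m × ℕ} {N : ℕ}
    {v v' : V} {e : Sym2 V} (hu : ∀ i < 2 * N, OdNear (u i) (u (i + 1)))
    (h0 : H (u 0) = Sum.inl v) (h1 : H (u (2 * N)) = Sum.inl v')
    (hv : ∀ i ≤ N, H (u i) = Sum.inl v ∨ H (u i) = Sum.inr e)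
    (hv' : ∀ i ≤ 2 * N, N ≤ i → H (u i) = Sum.inl v' ∨ H (u i) = Sum.inr e) :
    OdNear (odContract x H (u 0)) (odContract x H (u (2 * N))) := by
  have hfst : ∀ w, (odContract x H w).1 = w.1 := fun _ => rfl
  have e0 := odContract_walk hzero (l := N) (fun i hi => hu i (by omega)) h0 hv
  have e1 := odContract_walk hzero (u := fun i => u (2 * N - i)) (l := N) (v := v') (e := e)
    (fun i hi => by
      have := (hu (2 * N - (i + 1)) (by omega)).symm
      rwa [show 2 * N - (i + 1) + 1 = 2 * N - i by omega] at this) h1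
    fun i hi => hv' _ (by omega) (by omega)
  simp only [show 2 * N - N = N by omega, Nat.sub_zero] at e1
  have c0 : OdEq (odContract x H (u N)) (odContract x H (u 0)) ∨
      ((odContract x H (u N)).1 = (odContract x H (u 0)).1 ∧
        (odContract x H (u N)).2 + 1 = (odContract x H (u 0)).2) :=
    e0.imp And.left fun h => ⟨h.1, h.2.1⟩
  have c1 : OdEq (odContract x H (u N)) (odContract x H (u (2 * N))) ∨
      ((odContract x H (u N)).1 = (odContract x H (u (2 * N))).1 ∧
        (odContract x H (u N)).2 + 1 = (odContract x H (u (2 * N))).2) :=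
    e1.imp And.left fun h => ⟨h.1, h.2.1⟩
  generalize odContract x H (u N) = p at *
  generalize odContract x H (u 0) = q at *
  generalize odContract x H (u (2 * N)) = r at *
  obtain ⟨p1, p2⟩ := p
  obtain ⟨q1, q2⟩ := q
  obtain ⟨r1, r2⟩ := r
  simp only [OdNear, OdEq, Prod.mk.injEq] at *
  rcases c0 with (⟨rfl, rfl⟩ | c0) | ⟨rfl, c0⟩ <;> rcases c1 with (⟨rfl, rfl⟩ | c1) | ⟨rfl, c1⟩ <;>
    first | (exact Or.inl ⟨rfl, by omega, by omega⟩) | (right; omega)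

/-- The ends of a walk inside a vertex zone lie in the same label component. -/
theorem odNear_odContract_of_constant_walk (hzero : ∀ a, H (a, 0) = Sum.inl x)
    {u : ℕ → Fin m × ℕ} {N : ℕ} {v : V} (hu : ∀ i < N, OdNear (u i) (u (i + 1)))
    (hv : ∀ i ≤ N, H (u i) = Sum.inl v) :
    OdNear (odContract x H (u 0)) (odContract x H (u N)) := by
  rcases odContract_walk hzero (e := s(v, v)) hu (hv 0 (Nat.zero_le _))
    fun i hi => Or.inl (hv i hi) with h | h
  · exact ((OdNear.refl _).congr_left h.1).symm
  · have := h.2.2.1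
    simp [hv N le_rfl] at this

end Contraction

/-! ## Simplicial maps between graphs -/

theorem GraphData.Adj.symm {G : Type*} {Γ : GraphData G} {v w : G} (h : Γ.Adj v w) :
    Γ.Adj w v := by
  obtain ⟨e, he⟩ := h
  exact ⟨e, by rw [he, Set.pair_comm]⟩

section Simplicial

variable {G H J : Type*} [TopologicalSpace G] [TopologicalSpace H] [TopologicalSpace J]
  {Γ : GraphData G} {Δ : GraphData H} {Θ : GraphData J}

theorem GraphData.IsGraph.exists_edge_eq (hΓ : Γ.IsGraph) (x : G) :
    ∃ e, ∃ t ∈ Set.Icc (0 : ℝ) 1, Γ.edge e t = x := by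
  have h : x ∈ ⋃ e, Γ.edge e '' Set.Icc 0 1 := hΓ.2.2.2.2.2.2.1 ▸ Set.mem_univ x
  simpa using h

theorem GraphData.IsGraph.eq_zero_or_one (hΓ : Γ.IsGraph) {e : Fin Γ.nE} {t : ℝ}
    (ht : t ∈ Set.Icc (0 : ℝ) 1) (h : Γ.edge e t ∈ Γ.verts) : t = 0 ∨ t = 1 := by
  by_contra! hne
  exact hΓ.2.2.2.2.2.1 e t ⟨ht.1.lt_of_ne hne.1.symm, ht.2.lt_of_ne hne.2⟩ h

/-- A map of vertices sending the ends of each edge to equal or adjacent vertices extends to a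
simplicial map. -/
theorem GraphData.IsGraph.exists_simplicial_extension [T2Space H] [T2Space G] (hΓ : Γ.IsGraph)
    (hΔ : Δ.IsGraph) (ψ : G → H) (hψ : ∀ v ∈ Γ.verts, ψ v ∈ Δ.verts)
    (hadj : ∀ e, ψ (Γ.edge e 0) = ψ (Γ.edge e 1) ∨ Δ.Adj (ψ (Γ.edge e 0)) (ψ (Γ.edge e 1))) :
    ∃ φ : G → H, IsSimplicialMap Γ Δ φ ∧ ∀ v ∈ Γ.verts, φ v = ψ v := by
  have hpath : ∀ e, ∃ γ : ℝ → H, ContinuousOn γ (Set.Icc 0 1) ∧ γ 0 = ψ (Γ.edge e 0) ∧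
      γ 1 = ψ (Γ.edge e 1) ∧ ((∃ w ∈ Δ.verts, ∀ t ∈ Set.Icc (0 : ℝ) 1, γ t = w) ∨
        ∃ e', (∀ t ∈ Set.Icc (0 : ℝ) 1, γ t = Δ.edge e' t) ∨
          (∀ t ∈ Set.Icc (0 : ℝ) 1, γ t = Δ.edge e' (1 - t))) := by
    intro e
    rcases hadj e with h | ⟨e', h⟩
    · exact ⟨fun _ => ψ (Γ.edge e 0), continuousOn_const, rfl, h,
        Or.inl ⟨_, hψ _ (hΓ.2.2.1 e), fun _ _ => rfl⟩⟩
    · rcases Set.pair_eq_pair_iff.1 h with ⟨h0, h1⟩ | ⟨h0, h1⟩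
      · exact ⟨Δ.edge e', hΔ.1 e', h0, h1, Or.inr ⟨e', Or.inl fun _ _ => rfl⟩⟩
      · refine ⟨fun t => Δ.edge e' (1 - t), ?_, by simpa using h1, by simpa using h0,
          Or.inr ⟨e', Or.inr fun _ _ => rfl⟩⟩
        refine (hΔ.1 e').comp (by fun_prop) fun t ht => ?_
        exact ⟨by linarith [ht.2], by linarith [ht.1]⟩
  choose γ hγc hγ0 hγ1 hγ using hpath
  choose E s hs hE using hΓ.exists_edge_eq
  have hvert : ∀ e, ∀ t ∈ Set.Icc (0 : ℝ) 1, Γ.edge e t ∈ Γ.verts → γ e t = ψ (Γ.edge e t) := by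
    intro e t ht hv
    rcases hΓ.eq_zero_or_one ht hv with rfl | rfl
    · exact hγ0 e
    · exact hγ1 e
  have hφ : ∀ e, ∀ t ∈ Set.Icc (0 : ℝ) 1, γ (E (Γ.edge e t)) (s (Γ.edge e t)) = γ e t := by
    intro e t ht
    by_cases he : E (Γ.edge e t) = e
    · have h1 := hE (Γ.edge e t)
      rw [he] at h1 ⊢
      rw [hΓ.2.1 e (hs _) ht h1]
    · have hv : Γ.edge e t ∈ Γ.verts :=
        hΓ.2.2.2.2.2.2.2.1 _ _ he ⟨⟨_, hs _, hE _⟩, ⟨t, ht, rfl⟩⟩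
      rw [hvert e t ht hv, hvert _ _ (hs _) (by rwa [hE]), hE]
  refine ⟨fun x => γ (E x) (s x), ⟨?_, ?_, ?_⟩, ?_⟩
  · rw [continuous_iff_isClosed]
    intro S hS
    have : (fun x => γ (E x) (s x)) ⁻¹' S =
        ⋃ e, Γ.edge e '' (Set.Icc 0 1 ∩ γ e ⁻¹' S) := by
      ext x
      simp only [Set.mem_preimage, Set.mem_iUnion]
      constructor
      · exact fun hx => ⟨E x, s x, ⟨hs x, hx⟩, hE x⟩
      · rintro ⟨e, t, ⟨ht, hS⟩, rfl⟩
        rw [hφ e t ht]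
        exact hS
    rw [this]
    refine isClosed_iUnion_of_finite fun e => IsCompact.isClosed ?_
    have hcl : IsClosed (Set.Icc 0 1 ∩ γ e ⁻¹' S) :=
      (hγc e).preimage_isClosed_of_isClosed isClosed_Icc hS
    exact (isCompact_Icc.of_isClosed_subset hcl Set.inter_subset_left).image_of_continuousOn
      ((hΓ.1 e).mono Set.inter_subset_left)
  · intro v hv
    simp only
    rw [hvert _ _ (hs v) (by rwa [hE]), hE]
    exact hψ v hv
  · intro e
    rcases hγ e with ⟨w, hw, h⟩ | ⟨e', h | h⟩
    · exact Or.inl ⟨w, hw, fun t ht => (hφ e t ht).trans (h t ht)⟩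
    · exact Or.inr ⟨e', Or.inl fun t ht => (hφ e t ht).trans (h t ht)⟩
    · exact Or.inr ⟨e', Or.inr fun t ht => (hφ e t ht).trans (h t ht)⟩
  · intro v hv
    simp only
    rw [hvert _ _ (hs v) (by rwa [hE]), hE]

theorem IsSimplicialMap.comp {φ : G → H} {χ : H → J} (hχ : IsSimplicialMap Δ Θ χ)
    (hφ : IsSimplicialMap Γ Δ φ) : IsSimplicialMap Γ Θ (χ ∘ φ) := by
  refine ⟨hχ.1.comp hφ.1, fun v hv => hχ.2.1 _ (hφ.2.1 v hv), fun e => ?_⟩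
  have hsymm : ∀ t ∈ Set.Icc (0 : ℝ) 1, 1 - t ∈ Set.Icc (0 : ℝ) 1 := fun t ht =>
    ⟨by linarith [ht.2], by linarith [ht.1]⟩
  simp only [Function.comp_apply]
  rcases hφ.2.2 e with ⟨w, hw, h⟩ | ⟨e', h | h⟩
  · exact Or.inl ⟨χ w, hχ.2.1 w hw, fun t ht => by rw [h t ht]⟩
  · rcases hχ.2.2 e' with ⟨w, hw, h'⟩ | ⟨e'', h' | h'⟩
    · exact Or.inl ⟨w, hw, fun t ht => by rw [h t ht, h' t ht]⟩
    · exact Or.inr ⟨e'', Or.inl fun t ht => by rw [h t ht, h' t ht]⟩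
    · exact Or.inr ⟨e'', Or.inr fun t ht => by rw [h t ht, h' t ht]⟩
  · rcases hχ.2.2 e' with ⟨w, hw, h'⟩ | ⟨e'', h' | h'⟩
    · exact Or.inl ⟨w, hw, fun t ht => by rw [h t ht, h' _ (hsymm t ht)]⟩
    · exact Or.inr ⟨e'', Or.inr fun t ht => by rw [h t ht, h' _ (hsymm t ht)]⟩
    · exact Or.inr ⟨e'', Or.inl fun t ht => by rw [h t ht, h' _ (hsymm t ht), sub_sub_cancel]⟩

theorem IsSimplicialMap.id : IsSimplicialMap Γ Γ id :=
  ⟨continuous_id, fun _ => _root_.id, fun e => Or.inr ⟨e, Or.inl fun _ _ => rfl⟩⟩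

theorem IsSimplicialMap.eq_or_adj {φ : G → H} (hφ : IsSimplicialMap Γ Δ φ) (e : Fin Γ.nE) :
    φ (Γ.edge e 0) = φ (Γ.edge e 1) ∨ Δ.Adj (φ (Γ.edge e 0)) (φ (Γ.edge e 1)) := by
  rcases hφ.2.2 e with ⟨w, -, h⟩ | ⟨e', h | h⟩
  · exact Or.inl (by rw [h 0 (by simp), h 1 (by simp)])
  · exact Or.inr ⟨e', by rw [h 0 (by simp), h 1 (by simp)]⟩
  · exact Or.inr ⟨e', by rw [h 0 (by simp), h 1 (by simp), Set.pair_comm]; simp⟩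

/-- A simplicial map is determined by its values at the vertices. -/
theorem IsSimplicialMap.ext_of_verts (hΓ : Γ.IsGraph) (hΔ : Δ.IsGraph) {φ χ : G → H}
    (hφ : IsSimplicialMap Γ Δ φ) (hχ : IsSimplicialMap Γ Δ χ)
    (h : ∀ v ∈ Γ.verts, φ v = χ v) : φ = χ := by
  have hform : ∀ {f : G → H}, IsSimplicialMap Γ Δ f → ∀ e,
      (f (Γ.edge e 0) = f (Γ.edge e 1) ∧
        ∀ t ∈ Set.Icc (0 : ℝ) 1, f (Γ.edge e t) = f (Γ.edge e 0)) ∨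
      ∃ e', (f (Γ.edge e 0) = Δ.edge e' 0 ∧ f (Γ.edge e 1) = Δ.edge e' 1 ∧
          ∀ t ∈ Set.Icc (0 : ℝ) 1, f (Γ.edge e t) = Δ.edge e' t) ∨
        (f (Γ.edge e 0) = Δ.edge e' 1 ∧ f (Γ.edge e 1) = Δ.edge e' 0 ∧
          ∀ t ∈ Set.Icc (0 : ℝ) 1, f (Γ.edge e t) = Δ.edge e' (1 - t)) := by
    intro f hf e
    have m0 : (0 : ℝ) ∈ Set.Icc (0 : ℝ) 1 := by simp
    have m1 : (1 : ℝ) ∈ Set.Icc (0 : ℝ) 1 := by simp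
    rcases hf.2.2 e with ⟨w, -, h⟩ | ⟨e', h | h⟩
    · exact Or.inl ⟨by rw [h 0 m0, h 1 m1], fun t ht => by rw [h t ht, h 0 m0]⟩
    · exact Or.inr ⟨e', Or.inl ⟨h 0 m0, h 1 m1, h⟩⟩
    · exact Or.inr ⟨e', Or.inr ⟨by simpa using h 0 m0, by simpa using h 1 m1, h⟩⟩
  funext x
  obtain ⟨e, t, ht, rfl⟩ := hΓ.exists_edge_eq x
  have h0 := h _ (hΓ.2.2.1 e)
  have h1 := h _ (hΓ.2.2.2.1 e)
  have hne := hΔ.2.2.2.2.1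
  have huniq := hΔ.2.2.2.2.2.2.2.2
  rcases hform hφ e with ⟨p, hp⟩ | ⟨a, ⟨p0, p1, hp⟩ | ⟨p0, p1, hp⟩⟩ <;>
    rcases hform hχ e with ⟨q, hq⟩ | ⟨b, ⟨q0, q1, hq⟩ | ⟨q0, q1, hq⟩⟩ <;>
    rw [hp t ht, hq t ht]
  · exact h0
  · exact absurd (by rw [← q0, ← q1, ← h0, ← h1, p]) (hne b)
  · exact absurd (by rw [← q0, ← q1, ← h0, ← h1, p]) (hne b)
  · exact absurd (by rw [← p0, ← p1, h0, h1, q]) (hne a)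
  · rw [huniq a b (by rw [← p0, ← p1, ← q0, ← q1, h0, h1])]
  · have hab := huniq a b (by rw [← p0, ← p1, ← q0, ← q1, h0, h1, Set.pair_comm])
    subst hab
    exact absurd (by rw [← p0, h0, q0]) (hne a)
  · exact absurd (by rw [← p0, ← p1, h0, h1, q]) (hne a)
  · have hab := huniq a b (by rw [← p0, ← p1, ← q0, ← q1, h0, h1, Set.pair_comm])
    subst hab
    exact absurd (by rw [← q0, ← h0, p0]) (hne a)
  · rw [huniq a b (by rw [← p0, ← p1, ← q0, ← q1, h0, h1])]

theorem isSimplicialMap_bondIter {X : ℕ → Type*} [∀ i, TopologicalSpace (X i)]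
    {Γ : ∀ i, GraphData (X i)} {Φ : ∀ i, X (i + 1) → X i}
    (hΦ : ∀ i, IsSimplicialMap (Γ (i + 1)) (Γ i) (Φ i)) (i k : ℕ) :
    IsSimplicialMap (Γ (i + k)) (Γ i) (bondIter Φ i k) := by
  induction k with
  | zero => exact IsSimplicialMap.id
  | succ k ih => exact ih.comp (hΦ (i + k))

end Simplicial

/-! ## The model of a simple-`m`-od in `ℝᵐ` -/

/-- The union of the initial segments of length `k a` of the coordinate half-axes of `ℝᵐ`. -/
def OdSpace {m : ℕ} (k : Fin m → ℕ) : Set (Fin m → ℝ) :=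
  ⋃ a, (fun r : ℝ => Pi.single a r) '' Set.Icc 0 (k a)

/-- The point of the model with coordinate `r`, clamped to `[0, k a]`, on the arm `a`. -/
noncomputable def odPoint {m : ℕ} (k : Fin m → ℕ) (a : Fin m) (r : ℝ) : OdSpace k :=
  ⟨Pi.single a (Set.projIcc (0 : ℝ) (k a) (Nat.cast_nonneg _) r : ℝ),
    Set.mem_iUnion.2 ⟨a, _, Subtype.coe_prop _, rfl⟩⟩

open Classical in
/-- The graph structure of the model of a simple-`m`-od with arms of lengths `k a`. -/
noncomputable def odGraph {m : ℕ} (k : Fin m → ℕ) : GraphData (OdSpace k) where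
  verts := (Finset.univ : Finset (Σ a, Fin (k a + 1))).image fun p => odPoint k p.1 (p.2 : ℕ)
  nE := Fintype.card (Σ a, Fin (k a))
  edge e t := odPoint k ((Fintype.equivFin (Σ a, Fin (k a))).symm e).1
    ((((Fintype.equivFin (Σ a, Fin (k a))).symm e).2 : ℕ) + t)

section Model

variable {m : ℕ} {k : Fin m → ℕ}

theorem coe_odPoint {a : Fin m} {r : ℝ} (hr : r ∈ Set.Icc (0 : ℝ) (k a)) :
    (odPoint k a r : Fin m → ℝ) = Pi.single a r := by
  simp [odPoint, Set.projIcc_of_mem _ hr]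

theorem continuous_odPoint (a : Fin m) : Continuous (odPoint k a) := by
  refine Continuous.subtype_mk ?_ _
  exact (continuous_single (A := fun _ : Fin m => ℝ) a).comp (continuous_subtype_val.comp continuous_projIcc)

theorem exists_eq_odPoint (x : OdSpace k) :
    ∃ a, ∃ r ∈ Set.Icc (0 : ℝ) (k a), x = odPoint k a r := by
  obtain ⟨a, r, hr, h⟩ := Set.mem_iUnion.1 x.2
  exact ⟨a, r, hr, Subtype.ext (by rw [coe_odPoint hr]; exact h.symm)⟩

theorem odPoint_zero (a a' : Fin m) : odPoint k a 0 = odPoint k a' 0 := by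
  apply Subtype.ext
  rw [coe_odPoint (by simp), coe_odPoint (by simp)]
  simp

theorem odPoint_inj {a a' : Fin m} {r r' : ℝ} (hr : r ∈ Set.Icc (0 : ℝ) (k a))
    (hr' : r' ∈ Set.Icc (0 : ℝ) (k a')) (h : odPoint k a r = odPoint k a' r') :
    r = r' ∧ (a = a' ∨ r = 0) := by
  have h := congrArg Subtype.val h
  rw [coe_odPoint hr, coe_odPoint hr'] at h
  by_cases ha : a = a'
  · subst ha
    exact ⟨Pi.single_injective a h, Or.inl rfl⟩
  · have h1 := congrFun h a
    have h2 := congrFun h a'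
    rw [Pi.single_eq_same, Pi.single_eq_of_ne ha] at h1
    rw [Pi.single_eq_same, Pi.single_eq_of_ne (Ne.symm ha)] at h2
    exact ⟨h1.trans h2, Or.inr h1⟩

theorem isCompact_odSpace (k : Fin m → ℕ) : IsCompact (OdSpace k) :=
  isCompact_iUnion fun a => isCompact_Icc.image (continuous_single (A := fun _ : Fin m => ℝ) a)

theorem isConnected_odSpace (k : Fin m → ℕ) (a : Fin m) : IsConnected (OdSpace k) := by
  have h0 : ∀ a, (0 : Fin m → ℝ) ∈ (fun r : ℝ => Pi.single a r) '' Set.Icc 0 (k a : ℝ) :=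
    fun a => ⟨0, by simp, Pi.single_zero a⟩
  refine ⟨⟨0, Set.mem_iUnion.2 ⟨a, h0 a⟩⟩, ?_⟩
  exact isPreconnected_iUnion ⟨0, Set.mem_iInter.2 h0⟩ fun a =>
    isPreconnected_Icc.image _ (continuous_single (A := fun _ : Fin m => ℝ) a).continuousOn

theorem mem_verts_odGraph {x : OdSpace k} :
    x ∈ (odGraph k).verts ↔ ∃ a, ∃ q : ℕ, q ≤ k a ∧ x = odPoint k a q := by
  simp only [odGraph, Finset.mem_image, Finset.mem_univ, true_and]
  constructor
  · rintro ⟨⟨a, q⟩, rfl⟩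
    exact ⟨a, q, by omega, rfl⟩
  · rintro ⟨a, q, hq, rfl⟩
    exact ⟨⟨a, ⟨q, by omega⟩⟩, rfl⟩

theorem odGraph_edge_form (e : Fin (odGraph k).nE) :
    ∃ a, ∃ q : ℕ, q + 1 ≤ k a ∧ ∀ t, (odGraph k).edge e t = odPoint k a (q + t) :=
  ⟨_, _, ((Fintype.equivFin (Σ a, Fin (k a))).symm e).2.2, fun _ => rfl⟩

theorem exists_odGraph_edge (a : Fin m) (q : ℕ) (hq : q + 1 ≤ k a) :
    ∃ e, ∀ t, (odGraph k).edge e t = odPoint k a (q + t) := by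
  refine ⟨Fintype.equivFin (Σ a, Fin (k a)) ⟨a, ⟨q, hq⟩⟩, fun t => ?_⟩
  show odPoint k ((Fintype.equivFin (Σ a, Fin (k a))).symm (Fintype.equivFin _ ⟨a, ⟨q, hq⟩⟩)).1
    ((((Fintype.equivFin (Σ a, Fin (k a))).symm (Fintype.equivFin _ ⟨a, ⟨q, hq⟩⟩)).2 : ℕ) + t) = _
  rw [Equiv.symm_apply_apply]

theorem odGraph_edge_ext {e e' : Fin (odGraph k).nE} {a : Fin m} {q : ℕ} (hq : q + 1 ≤ k a)
    (h : ∀ t, (odGraph k).edge e t = odPoint k a (q + t))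
    (h' : ∀ t, (odGraph k).edge e' t = odPoint k a (q + t)) : e = e' := by
  have key : ∀ e : Fin (odGraph k).nE, (∀ t, (odGraph k).edge e t = odPoint k a (q + t)) →
      e = Fintype.equivFin (Σ a, Fin (k a)) ⟨a, ⟨q, hq⟩⟩ := by
    intro e he
    refine (Equiv.symm_apply_eq (Fintype.equivFin (Σ a, Fin (k a)))).1 ?_
    have h1 := he 1
    set p := (Fintype.equivFin (Σ a, Fin (k a))).symm e with hp
    have h2 : odPoint k p.1 ((p.2 : ℕ) + 1) = odPoint k a (q + 1) := h1
    obtain ⟨b, c⟩ := p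
    have hc : (c : ℕ) + 1 ≤ k b := c.2
    obtain ⟨h3, h4⟩ := odPoint_inj ⟨by positivity, by exact_mod_cast hc⟩
      ⟨by positivity, by exact_mod_cast hq⟩ h2
    have h5 : (c : ℕ) = q := by
      have h3 : (c : ℕ) + 1 = q + 1 := by exact_mod_cast h3
      omega
    rcases h4 with rfl | h4
    · simp [← h5]
    · exfalso
      have : (0 : ℝ) < (c : ℕ) + 1 := by positivity
      simp only at h4
      linarith
  rw [key e h, key e' h']

theorem isGraph_odGraph (hk : ∀ a, 1 ≤ k a) : (odGraph k).IsGraph := by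
  have hIcc : ∀ {a : Fin m} {q : ℕ}, q + 1 ≤ k a → ∀ {t : ℝ}, t ∈ Set.Icc (0 : ℝ) 1 →
      (q + t) ∈ Set.Icc (0 : ℝ) (k a) := by
    intro a q hq t ht
    have : (q : ℝ) + 1 ≤ k a := by exact_mod_cast hq
    exact ⟨add_nonneg (Nat.cast_nonneg _) ht.1, by linarith [ht.2]⟩
  have m0 : (0 : ℝ) ∈ Set.Icc (0 : ℝ) 1 := by simp
  have m1 : (1 : ℝ) ∈ Set.Icc (0 : ℝ) 1 := by simp
  refine ⟨fun e => ?_, fun e => ?_, fun e => ?_, fun e => ?_, fun e => ?_, fun e t ht => ?_, ?_,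
    fun e e' hne => ?_, fun e e' h => ?_⟩
  · obtain ⟨a, q, hq, he⟩ := odGraph_edge_form e
    simp only [funext he]
    exact ((continuous_odPoint a).comp (continuous_const.add continuous_id)).continuousOn
  · obtain ⟨a, q, hq, he⟩ := odGraph_edge_form e
    intro t ht t' ht' h
    rw [he, he] at h
    linarith [(odPoint_inj (hIcc hq ht) (hIcc hq ht') h).1]
  · obtain ⟨a, q, hq, he⟩ := odGraph_edge_form e
    rw [he, mem_verts_odGraph]
    exact ⟨a, q, by omega, by simp⟩
  · obtain ⟨a, q, hq, he⟩ := odGraph_edge_form e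
    rw [he, mem_verts_odGraph]
    exact ⟨a, q + 1, hq, by simp⟩
  · obtain ⟨a, q, hq, he⟩ := odGraph_edge_form e
    rw [he, he]
    intro h
    linarith [(odPoint_inj (hIcc hq m0) (hIcc hq m1) h).1]
  · obtain ⟨a, q, hq, he⟩ := odGraph_edge_form e
    rw [he, Finset.mem_coe, mem_verts_odGraph]
    rintro ⟨a', q', hq', h⟩
    have h1 := (odPoint_inj (hIcc hq ⟨ht.1.le, ht.2.le⟩)
      ⟨Nat.cast_nonneg _, by exact_mod_cast hq'⟩ h).1
    have h2 : (q : ℝ) < q' := by linarith [ht.1]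
    have h3 : (q' : ℝ) < q + 1 := by linarith [ht.2]
    have h2 : q < q' := by exact_mod_cast h2
    have h3 : q' < q + 1 := by exact_mod_cast h3
    omega
  · refine Set.eq_univ_of_forall fun x => Set.mem_iUnion.2 ?_
    obtain ⟨a, r, hr, rfl⟩ := exists_eq_odPoint x
    have h1 : ⌈r⌉₊ ≤ k a := Nat.ceil_le.2 hr.2
    obtain ⟨e, he⟩ := exists_odGraph_edge (k := k) a (⌈r⌉₊ - 1) (by have := hk a; omega)
    refine ⟨e, r - (⌈r⌉₊ - 1 : ℕ), ?_, by rw [he]; congr 1; ring⟩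
    rcases hr.1.eq_or_lt with h0 | h0
    · subst h0
      simp
    · have h2 := Nat.ceil_pos.2 h0
      have h3 := Nat.le_ceil r
      have h4 := Nat.ceil_lt_add_one hr.1
      rw [Nat.cast_sub h2]
      constructor <;> push_cast <;> linarith
  · obtain ⟨a, q, hq, he⟩ := odGraph_edge_form e
    obtain ⟨a', q', hq', he'⟩ := odGraph_edge_form e'
    rintro x ⟨⟨t, ht, rfl⟩, t', ht', h⟩
    rw [he, he'] at h
    rw [he, Finset.mem_coe, mem_verts_odGraph]
    obtain ⟨h1, h2⟩ := odPoint_inj (hIcc hq' ht') (hIcc hq ht) h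
    rcases h2 with rfl | h2
    · rcases lt_trichotomy q q' with h3 | rfl | h3
      · have h3 : (q : ℝ) + 1 ≤ q' := by exact_mod_cast h3
        have : t = 1 := by linarith [ht.2, ht'.1]
        exact ⟨a', q + 1, hq, by rw [this]; push_cast; rfl⟩
      · exact absurd (odGraph_edge_ext hq he he') hne
      · have h3 : (q' : ℝ) + 1 ≤ q := by exact_mod_cast h3
        have : t = 0 := by linarith [ht.1, ht'.2]
        exact ⟨a', q, by omega, by rw [this, add_zero]⟩
    · exact ⟨a, 0, Nat.zero_le _, by rw [← h1, h2]; simp⟩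
  · obtain ⟨a, q, hq, he⟩ := odGraph_edge_form e
    obtain ⟨a', q', hq', he'⟩ := odGraph_edge_form e'
    rw [he, he, he', he', Set.pair_eq_pair_iff] at h
    rcases h with ⟨-, h⟩ | ⟨h, h'⟩
    · obtain ⟨h1, h2⟩ := odPoint_inj (hIcc hq m1) (hIcc hq' m1) h
      have h3 : q = q' := by
        have : q + 1 = q' + 1 := by exact_mod_cast h1
        omega
      subst h3
      rcases h2 with rfl | h2
      · exact odGraph_edge_ext hq he he'
      · have : (0 : ℝ) < q + 1 := by positivity
        linarith
    · have h1 := (odPoint_inj (hIcc hq m0) (hIcc hq' m1) h).1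
      have h2 := (odPoint_inj (hIcc hq m1) (hIcc hq' m0) h').1
      linarith

theorem isSimpleOdWith_odGraph (hk : ∀ a, 1 ≤ k a) (a₀ : Fin m) :
    IsSimpleOdWith (odGraph k) m (odPoint k a₀ 0) k fun a q => odPoint k a q := by
  have hIcc : ∀ {a : Fin m} {q : ℕ}, q ≤ k a → (q : ℝ) ∈ Set.Icc (0 : ℝ) (k a) :=
    fun hq => ⟨Nat.cast_nonneg _, by exact_mod_cast hq⟩
  refine ⟨isGraph_odGraph hk, hk, fun a => by simpa using odPoint_zero a a₀, ?_, ?_, ?_, ?_⟩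
  · ext x
    simp only [Finset.mem_coe, mem_verts_odGraph, Set.mem_union, Set.mem_singleton_iff,
      Set.mem_ofPred_eq]
    constructor
    · rintro ⟨a, q, hq, rfl⟩
      rcases Nat.eq_zero_or_pos q with rfl | h
      · left; simpa using odPoint_zero a a₀
      · exact Or.inr ⟨a, q, h, hq, rfl⟩
    · rintro (rfl | ⟨a, q, -, hq, rfl⟩)
      · exact ⟨a₀, 0, Nat.zero_le _, by simp⟩
      · exact ⟨a, q, hq, rfl⟩
  · intro a q a' q' h1 h2 h1' h2' h
    obtain ⟨h3, h4⟩ := odPoint_inj (hIcc h2) (hIcc h2') h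
    have h3 : q = q' := by exact_mod_cast h3
    refine ⟨h4.resolve_right fun h5 => ?_, h3⟩
    have : q = 0 := by exact_mod_cast h5
    omega
  · intro a q h1 h2 h
    have := (odPoint_inj (hIcc h2) (by simp) h).1
    have : q = 0 := by exact_mod_cast this
    omega
  · intro v w
    constructor
    · rintro ⟨e, he⟩
      obtain ⟨a, q, hq, h⟩ := odGraph_edge_form e
      exact ⟨a, q, hq, by rw [← he, h, h]; simp⟩
    · rintro ⟨a, q, hq, h⟩
      obtain ⟨e, he⟩ := exists_odGraph_edge (k := k) a q hq
      exact ⟨e, by rw [h, he, he]; simp⟩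

theorem odGraph_edge_affine (e : Fin (odGraph k).nE) {t : ℝ} (ht : t ∈ Set.Icc (0 : ℝ) 1) :
    ((odGraph k).edge e t : Fin m → ℝ) =
      (1 - t) • ((odGraph k).edge e 0 : Fin m → ℝ) + t • ((odGraph k).edge e 1 : Fin m → ℝ) := by
  obtain ⟨a, q, hq, he⟩ := odGraph_edge_form e
  have hq' : (q : ℝ) + 1 ≤ k a := by exact_mod_cast hq
  have hq0 : (0 : ℝ) ≤ q := Nat.cast_nonneg q
  rw [he, he, he, coe_odPoint ⟨by linarith [ht.1], by linarith [ht.2]⟩,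
    coe_odPoint ⟨by linarith, by linarith⟩, coe_odPoint ⟨by linarith, by linarith⟩,
    ← Pi.single_smul, ← Pi.single_smul, ← Pi.single_add]
  congr 1
  simp only [smul_eq_mul]
  ring

theorem IsSimplicialMap.odSpace_affine {G : Type*} [TopologicalSpace G] {Γ : GraphData G}
    {φ : G → OdSpace k} (hφ : IsSimplicialMap Γ (odGraph k) φ) (e : Fin Γ.nE) {t : ℝ}
    (ht : t ∈ Set.Icc (0 : ℝ) 1) :
    (φ (Γ.edge e t) : Fin m → ℝ) =
      (1 - t) • (φ (Γ.edge e 0) : Fin m → ℝ) + t • (φ (Γ.edge e 1) : Fin m → ℝ) := by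
  have m0 : (0 : ℝ) ∈ Set.Icc (0 : ℝ) 1 := by simp
  have m1 : (1 : ℝ) ∈ Set.Icc (0 : ℝ) 1 := by simp
  rcases hφ.2.2 e with ⟨w, -, h⟩ | ⟨e', h | h⟩
  · rw [h t ht, h 0 m0, h 1 m1, ← add_smul, sub_add_cancel, one_smul]
  · rw [h t ht, h 0 m0, h 1 m1]
    exact odGraph_edge_affine e' ht
  · rw [h t ht, h 0 m0, h 1 m1, odGraph_edge_affine e' ⟨by linarith [ht.2], by linarith [ht.1]⟩]
    simp only [sub_sub_cancel, sub_zero, sub_self]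
    rw [add_comm]

end Model

section ArmMaps

variable {G H : Type*} [TopologicalSpace G] {Γ : GraphData G} {Δ : GraphData H} {m : ℕ} {t₀ : G}
  {k : Fin m → ℕ} {t : Fin m → ℕ → G}

theorem IsSimpleOdWith.mem_verts (h : IsSimpleOdWith Γ m t₀ k t) {a : Fin m} {q : ℕ}
    (hq : q ≤ k a) : t a q ∈ Γ.verts := by
  rw [← Finset.mem_coe, h.2.2.2.1]
  rcases Nat.eq_zero_or_pos q with rfl | h0
  · exact Or.inl (h.2.2.1 a)
  · exact Or.inr ⟨a, q, h0, hq, rfl⟩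

theorem IsSimpleOdWith.exists_eq (h : IsSimpleOdWith Γ m t₀ k t) (a₀ : Fin m) {v : G}
    (hv : v ∈ Γ.verts) : ∃ a q, q ≤ k a ∧ v = t a q := by
  rw [← Finset.mem_coe, h.2.2.2.1] at hv
  rcases hv with hv | ⟨a, q, -, hq, hv⟩
  · exact ⟨a₀, 0, Nat.zero_le _, by rw [h.2.2.1]; exact hv⟩
  · exact ⟨a, q, hq, hv⟩

theorem IsSimpleOdWith.adj (h : IsSimpleOdWith Γ m t₀ k t) {a : Fin m} {q : ℕ}
    (hq : q + 1 ≤ k a) : Γ.Adj (t a q) (t a (q + 1)) :=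
  (h.2.2.2.2.2.2 _ _).2 ⟨a, q, hq, rfl⟩

theorem IsSimpleOdWith.inj (h : IsSimpleOdWith Γ m t₀ k t) {a a' : Fin m} {q q' : ℕ}
    (hq : q ≤ k a) (hq' : q' ≤ k a') (e : t a q = t a' q') :
    OdEq (a, q) (a', q') := by
  rcases Nat.eq_zero_or_pos q with rfl | h0 <;> rcases Nat.eq_zero_or_pos q' with rfl | h0'
  · exact Or.inr ⟨rfl, rfl⟩
  · exact absurd (by rw [← e, h.2.2.1]) (h.2.2.2.2.2.1 a' q' h0' hq')
  · exact absurd (by rw [e, h.2.2.1]) (h.2.2.2.2.2.1 a q h0 hq)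
  · obtain ⟨rfl, rfl⟩ := h.2.2.2.2.1 a q a' q' h0 hq h0' hq' e
    exact Or.inl rfl

/-- Simplicial maps defined on a simple-`m`-od are constructed arm by arm. -/
theorem IsSimpleOdWith.exists_simplicial [TopologicalSpace H] [T2Space G] [T2Space H]
    (h : IsSimpleOdWith Γ m t₀ k t) (hΔ : Δ.IsGraph) (F : Fin m → ℕ → H)
    (hF0 : ∀ a a', F a 0 = F a' 0) (hFv : ∀ a q, q ≤ k a → F a q ∈ Δ.verts)
    (hF : ∀ a q, q + 1 ≤ k a → F a q = F a (q + 1) ∨ Δ.Adj (F a q) (F a (q + 1))) :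
    ∃ φ : G → H, IsSimplicialMap Γ Δ φ ∧ ∀ a q, q ≤ k a → φ (t a q) = F a q := by
  classical
  have hw : ∀ x : G, ∃ y : H, ∀ a q, q ≤ k a → x = t a q → y = F a q := by
    intro x
    by_cases hx : ∃ a q, q ≤ k a ∧ x = t a q
    · obtain ⟨a, q, hq, rfl⟩ := hx
      refine ⟨F a q, fun a' q' hq' e => ?_⟩
      rcases h.inj hq hq' e with e | ⟨e, e'⟩
      · simp only [Prod.mk.injEq] at e
        rw [e.1, e.2]
      · simp only at e e'
        rw [e, e', hF0 a a']
    · have hΔne : Nonempty H := by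
        obtain ⟨e, s, -, -⟩ := h.1.exists_edge_eq x
        have hv := h.1.2.2.1 e
        rw [← Finset.mem_coe, h.2.2.2.1] at hv
        obtain ⟨a, b, -, -⟩ := (h.2.2.2.2.2.2 _ _).1 ⟨e, rfl⟩
        exact ⟨F a 0⟩
      exact ⟨hΔne.some, fun a q hq e => absurd ⟨a, q, hq, e⟩ hx⟩
  choose ψ hψ using hw
  have hψ' : ∀ {a q}, q ≤ k a → ψ (t a q) = F a q := fun hq => hψ _ _ _ hq rfl
  obtain ⟨φ, hφ, hφψ⟩ := h.1.exists_simplicial_extension hΔ ψ (fun v hv => by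
      rcases isEmpty_or_nonempty (Fin m) with hm | ⟨⟨a₀⟩⟩
      · obtain ⟨e, -⟩ := h.1.exists_edge_eq v
        obtain ⟨a, -⟩ := (h.2.2.2.2.2.2 _ _).1 ⟨e, rfl⟩
        exact hm.elim a
      · obtain ⟨a, q, hq, rfl⟩ := h.exists_eq a₀ hv
        rw [hψ' hq]
        exact hFv a q hq) (fun e => by
      obtain ⟨a, q, hq, he⟩ := (h.2.2.2.2.2.2 _ _).1 ⟨e, rfl⟩
      have h1 := hF a q hq
      rw [← hψ' hq, ← hψ' (by omega : q ≤ k a)] at h1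
      rcases Set.pair_eq_pair_iff.1 he with ⟨h2, h3⟩ | ⟨h2, h3⟩
      · rw [h2, h3]; exact h1
      · rw [h2, h3]
        exact h1.imp Eq.symm GraphData.Adj.symm)
  exact ⟨φ, hφ, fun a q hq => by rw [hφψ _ (h.mem_verts hq), hψ' hq]⟩

end ArmMaps

/-! ## Zones of the model -/

/-- A pair `(a, p)` indicating the position of a point of the model: even `p` stands for the
neighbourhood of the vertex `p / 2` of the arm `a`, odd `p` for the middle of an edge. -/
noncomputable def odZone {m : ℕ} {k : Fin m → ℕ} (z : OdSpace k) : Fin m × ℕ :=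
  ((exists_eq_odPoint z).choose, ⌊2 * (exists_eq_odPoint z).choose_spec.choose + 1 / 2⌋₊)

/-- The vertex or the edge of a simple-`m`-od that corresponds to a zone. -/
def odCell {V : Type*} {m : ℕ} (t : Fin m → ℕ → V) (u : Fin m × ℕ) : V ⊕ Sym2 V :=
  if u.2 % 2 = 0 then Sum.inl (t u.1 (u.2 / 2))
  else Sum.inr s(t u.1 (u.2 / 2), t u.1 (u.2 / 2 + 1))

section Zones

variable {m : ℕ} {k : Fin m → ℕ}

theorem odZone_spec (z : OdSpace k) :
    ∃ a, ∃ r ∈ Set.Icc (0 : ℝ) (k a), (z : Fin m → ℝ) = Pi.single a r ∧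
      odZone z = (a, ⌊2 * r + 1 / 2⌋₊) := by
  have h := (exists_eq_odPoint z).choose_spec.choose_spec
  refine ⟨_, _, h.1, ?_, rfl⟩
  rw [← coe_odPoint h.1, ← h.2]

theorem odZone_le (z : OdSpace k) : (odZone z).2 ≤ 2 * k (odZone z).1 := by
  obtain ⟨a, r, hr, -, h⟩ := odZone_spec z
  rw [h]
  refine Nat.lt_succ_iff.1 ((Nat.floor_lt (by linarith [hr.1])).2 ?_)
  push_cast
  linarith [hr.2]

theorem dist_single_cases {a a' : Fin m} {r r' d : ℝ} (hr : 0 ≤ r) (hr' : 0 ≤ r')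
    (h : dist (Pi.single a r : Fin m → ℝ) (Pi.single a' r') < d) :
    (a = a' ∧ |r - r'| < d) ∨ (r < d ∧ r' < d) := by
  have h1 := (dist_le_pi_dist (Pi.single a r : Fin m → ℝ) (Pi.single a' r') a).trans_lt h
  have h2 := (dist_le_pi_dist (Pi.single a r : Fin m → ℝ) (Pi.single a' r') a').trans_lt h
  by_cases ha : a = a'
  · subst ha
    left
    simpa [Real.dist_eq] using h1
  · right
    rw [Pi.single_eq_same, Pi.single_eq_of_ne ha, Real.dist_eq, sub_zero, abs_of_nonneg hr] at h1
    rw [Pi.single_eq_same, Pi.single_eq_of_ne (Ne.symm ha), Real.dist_eq, zero_sub, abs_neg,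
      abs_of_nonneg hr'] at h2
    exact ⟨h1, h2⟩

theorem odNear_odZone {z z' : OdSpace k} (h : dist z z' < 1 / 10) :
    OdNear (odZone z) (odZone z') := by
  obtain ⟨a, r, hr, hz, e⟩ := odZone_spec z
  obtain ⟨a', r', hr', hz', e'⟩ := odZone_spec z'
  rw [Subtype.dist_eq, hz, hz'] at h
  rw [e, e']
  have hle : ∀ {s s' : ℝ}, 0 ≤ s → 0 ≤ s' → s < s' + 1 / 10 →
      ⌊2 * s + 1 / 2⌋₊ ≤ ⌊2 * s' + 1 / 2⌋₊ + 1 := by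
    intro s s' hs hs' hlt
    refine Nat.lt_succ_iff.1 ((Nat.floor_lt (by linarith)).2 ?_)
    have := Nat.lt_floor_add_one (2 * s' + 1 / 2)
    push_cast
    linarith
  rcases dist_single_cases hr.1 hr'.1 h with ⟨ha, h⟩ | ⟨h, h'⟩
  · rw [abs_lt] at h
    exact Or.inl ⟨ha, hle hr.1 hr'.1 (by linarith), hle hr'.1 hr.1 (by linarith)⟩
  · right
    simp only
    rw [Nat.floor_eq_zero.2 (by linarith), Nat.floor_eq_zero.2 (by linarith)]
    simp

theorem exists_odEq_odZone {z : OdSpace k} {a : Fin m} {r : ℝ} (hr : 0 ≤ r)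
    (h : dist (z : Fin m → ℝ) (Pi.single a r) < 1 / 20) :
    ∃ p : ℕ, OdEq (odZone z) (a, p) ∧ 2 * r - 3 / 5 < p ∧ p < 2 * r + 3 / 5 := by
  obtain ⟨a', r', hr', hz, e⟩ := odZone_spec z
  rw [hz] at h
  rw [e]
  rcases dist_single_cases hr'.1 hr h with ⟨rfl, h1⟩ | ⟨h, h'⟩
  · rw [abs_lt] at h1
    refine ⟨_, Or.inl rfl, ?_, ?_⟩
    · linarith [Nat.lt_floor_add_one (2 * r' + 1 / 2)]
    · linarith [Nat.floor_le (show 0 ≤ 2 * r' + 1 / 2 by linarith [hr'.1])]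
  · refine ⟨0, Or.inr ⟨Nat.floor_eq_zero.2 (by linarith), rfl⟩, ?_, ?_⟩ <;> push_cast <;> linarith

section Cell

variable {V : Type*} {t : Fin m → ℕ → V}

theorem odCell_two_mul (a : Fin m) (q : ℕ) : odCell t (a, 2 * q) = Sum.inl (t a q) := by
  simp [odCell]

theorem odCell_two_mul_add_one (a : Fin m) (q : ℕ) :
    odCell t (a, 2 * q + 1) = Sum.inr s(t a q, t a (q + 1)) := by
  have h1 : (2 * q + 1) % 2 = 1 := by omega
  have h2 : (2 * q + 1) / 2 = q := by omega
  simp [odCell, h1, h2]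

theorem OdEq.odCell_eq (ht : ∀ a a', t a 0 = t a' 0) {u v : Fin m × ℕ} (h : OdEq u v) :
    odCell t u = odCell t v := by
  rcases h with rfl | ⟨h, h'⟩
  · rfl
  · simp [odCell, h, h', ht u.1 v.1]

theorem OdNear.zoneCompat (ht : ∀ a a', t a 0 = t a' 0) {u v : Fin m × ℕ} (h : OdNear u v) :
    ZoneCompat (odCell t u) (odCell t v) := by
  have key : ∀ a p, ZoneCompat (odCell t (a, p)) (odCell t (a, p)) ∧
      ZoneCompat (odCell t (a, p)) (odCell t (a, p + 1)) ∧
      ZoneCompat (odCell t (a, p + 1)) (odCell t (a, p)) := by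
    intro a p
    obtain ⟨q, rfl | rfl⟩ := Nat.even_or_odd' p
    · rw [odCell_two_mul, odCell_two_mul_add_one]
      simp [ZoneCompat]
    · rw [show 2 * q + 1 + 1 = 2 * (q + 1) by ring, odCell_two_mul, odCell_two_mul_add_one]
      simp [ZoneCompat]
  have hsame : ∀ a p p', p ≤ p' + 1 → p' ≤ p + 1 →
      ZoneCompat (odCell t (a, p)) (odCell t (a, p')) := by
    intro a p p' h h'
    obtain rfl | rfl | rfl : p = p' ∨ p' = p + 1 ∨ p = p' + 1 := by omega
    exacts [(key a p).1, (key a p).2.1, (key a p').2.2]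
  obtain ⟨a, p⟩ := u
  obtain ⟨a', p'⟩ := v
  rcases h with ⟨h, h1, h2⟩ | ⟨h1, h2⟩
  · simp only at h
    subst h
    exact hsame a p p' h1 h2
  · simp only at h1 h2
    rcases Nat.eq_zero_or_pos p with rfl | hp
    · rw [OdEq.odCell_eq ht (show OdEq (a, 0) (a', 0) from Or.inr ⟨rfl, rfl⟩)]
      exact hsame _ _ _ (by omega) (by omega)
    · have hp' : p' = 0 := by omega
      subst hp'
      rw [OdEq.odCell_eq ht (show OdEq (a', 0) (a, 0) from Or.inr ⟨rfl, rfl⟩)]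
      exact hsame _ _ _ (by omega) (by omega)

theorem IsSimpleOdWith.adj_of_odCell [TopologicalSpace V] {Γ : GraphData V} {t₀ : V}
    (h : IsSimpleOdWith Γ m t₀ k t) {u : Fin m × ℕ} (hu : u.2 ≤ 2 * k u.1) {v w : V}
    (huv : odCell t u = Sum.inr s(v, w)) : Γ.Adj v w := by
  obtain ⟨a, p⟩ := u
  obtain ⟨q, rfl | rfl⟩ := Nat.even_or_odd' p
  · rw [odCell_two_mul] at huv
    exact absurd huv (by simp)
  · rw [odCell_two_mul_add_one] at huv
    have hadj := h.adj (a := a) (q := q) (by simp only at hu; omega)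
    rcases Sym2.eq_iff.1 (Sum.inr_injective huv) with ⟨rfl, rfl⟩ | ⟨rfl, rfl⟩
    exacts [hadj, hadj.symm]

end Cell

theorem eq_or_adj_odGraph {a a' : Fin m} {c c' : ℕ} (hc : c ≤ k a) (hc' : c' ≤ k a')
    (h : OdNear (a, c) (a', c')) :
    odPoint k a c = odPoint k a' c' ∨ (odGraph k).Adj (odPoint k a c) (odPoint k a' c') := by
  have hstep : ∀ a q, q + 1 ≤ k a →
      (odGraph k).Adj (odPoint k a q) (odPoint k a (q + 1 : ℕ)) := by
    intro a q hq
    obtain ⟨e, he⟩ := exists_odGraph_edge (k := k) a q hq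
    exact ⟨e, by rw [he, he]; simp⟩
  have hsame : ∀ {a c c'}, c ≤ k a → c' ≤ k a → c ≤ c' + 1 → c' ≤ c + 1 →
      odPoint k a c = odPoint k a c' ∨ (odGraph k).Adj (odPoint k a c) (odPoint k a c') := by
    intro a c c' hc hc' h h'
    obtain rfl | rfl | rfl : c = c' ∨ c' = c + 1 ∨ c = c' + 1 := by omega
    exacts [Or.inl rfl, Or.inr (hstep a c hc'), Or.inr (hstep a c' hc).symm]
  have hz : odPoint k a (0 : ℕ) = odPoint k a' (0 : ℕ) := by simpa using odPoint_zero a a'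
  rcases h with ⟨h, h1, h2⟩ | ⟨h1, h2⟩
  · simp only at h
    subst h
    exact hsame hc hc' h1 h2
  · simp only at h1 h2
    rcases Nat.eq_zero_or_pos c with rfl | hp
    · rw [hz]
      exact hsame (Nat.zero_le _) hc' (by omega) (by omega)
    · have hp' : c' = 0 := by omega
      subst hp'
      rw [← hz]
      exact hsame hc (Nat.zero_le _) (by omega) (by omega)

end Zones

/-! ## Inverse limits -/

theorem exists_thread {X : ℕ → Type*} (Φ : ∀ i, X (i + 1) → X i)
    (hΦ : ∀ i, Function.Surjective (Φ i)) (j : ℕ) (y : X j) : ∃ x : InvLimit Φ, x.1 j = y := by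
  induction j generalizing X with
  | zero => exact ⟨⟨fun i => Nat.rec y (fun i x => Function.surjInv (hΦ i) x) i,
      fun i => Function.surjInv_eq (hΦ i) _⟩, rfl⟩
  | succ j ih =>
    obtain ⟨x, hx⟩ := ih (X := fun i => X (i + 1)) (fun i => Φ (i + 1)) (fun i => hΦ (i + 1)) y
    refine ⟨⟨fun i => Nat.casesOn i (Φ 0 (x.1 0)) x.1, fun i => ?_⟩, hx⟩
    cases i with
    | zero => rfl
    | succ i => exact x.2 i

theorem InvLimit.bondIter_eq {X : ℕ → Type*} {Φ : ∀ i, X (i + 1) → X i} (x : InvLimit Φ)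
    (i k : ℕ) : bondIter Φ i k (x.1 (i + k)) = x.1 i := by
  induction k with
  | zero => rfl
  | succ k ih =>
    rw [← ih]
    exact congrArg _ (x.2 (i + k))

/-- The projections of an inverse limit onto late terms have small fibres. -/
theorem exists_dist_lt_of_dist_proj_lt {K : Type*} [MetricSpace K] [CompactSpace K] {X : ℕ → Type*}
    [∀ i, MetricSpace (X i)] {Φ : ∀ i, X (i + 1) → X i} (f : K ≃ₜ InvLimit Φ) (i : ℕ) {r : ℝ} (hr : 0 < r) :
    ∃ k, 0 < k ∧ ∃ δ > 0, ∀ x x', dist ((f x).1 (i + k)) ((f x').1 (i + k)) < δ →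
      dist x x' < r := by
  have hπ : ∀ j, Continuous fun x => (f x).1 j := fun j =>
    (continuous_apply j).comp (continuous_subtype_val.comp f.continuous)
  have hc : ∀ j, Continuous fun p : K × K => dist ((f p.1).1 j) ((f p.2).1 j) := fun j =>
    ((hπ j).comp continuous_fst).dist ((hπ j).comp continuous_snd)
  have hD : IsClosed {p : K × K | r ≤ dist p.1 p.2} :=
    isClosed_le continuous_const continuous_dist
  obtain ⟨k, hk, hempty⟩ : ∃ k, 0 < k ∧
      ∀ x x' : K, r ≤ dist x x' → (f x).1 (i + k) ≠ (f x').1 (i + k) := by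
    by_contra! hcon
    let S : ℕ → Set (K × K) := fun k =>
      {p | r ≤ dist p.1 p.2} ∩ {p | dist ((f p.1).1 (i + (k + 1))) ((f p.2).1 (i + (k + 1))) = 0}
    have hS : ∀ k, IsClosed (S k) := fun k =>
      hD.inter (isClosed_eq (hc _) continuous_const)
    obtain ⟨⟨x, x'⟩, hx⟩ := IsCompact.nonempty_iInter_of_sequence_nonempty_isCompact_isClosed S
      (fun k p hp => ⟨hp.1, by
        have h2 : (f p.1).1 (i + (k + 1) + 1) = (f p.2).1 (i + (k + 1) + 1) :=
          dist_eq_zero.1 hp.2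
        show dist _ _ = 0
        rw [← (f p.1).2, ← (f p.2).2, h2, dist_self]⟩)
      (fun k => by
        obtain ⟨x, x', h1, h2⟩ := hcon (k + 1) (Nat.succ_pos k)
        exact ⟨(x, x'), h1, by simp [h2]⟩) (hS 0).isCompact hS
    rw [Set.mem_iInter] at hx
    have heq : ∀ j, (f x).1 j = (f x').1 j := by
      intro j
      have h1 : (f x).1 (i + (j + 1)) = (f x').1 (i + (j + 1)) := dist_eq_zero.1 (hx j).2
      have hdown : ∀ d, (f x).1 (j + d) = (f x').1 (j + d) → (f x).1 j = (f x').1 j := by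
        intro d h
        rw [← (f x).bondIter_eq j d, h, (f x').bondIter_eq j d]
      refine hdown (i + 1) ?_
      rwa [show j + (i + 1) = i + (j + 1) by ring]
    have hxx : x = x' := f.injective (Subtype.ext (funext heq))
    have := (hx 0).1
    simp only [hxx, Set.mem_ofPred_eq, dist_self] at this
    linarith
  refine ⟨k, hk, ?_⟩
  rcases Set.eq_empty_or_nonempty {p : K × K | r ≤ dist p.1 p.2} with h0 | h0
  · refine ⟨1, one_pos, fun x x' _ => not_le.1 fun h => ?_⟩
    have : (x, x') ∈ {p : K × K | r ≤ dist p.1 p.2} := h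
    simp [h0] at this
  · obtain ⟨p, hp, hmin⟩ := hD.isCompact.exists_isMinOn h0 (hc (i + k)).continuousOn
    refine ⟨_, dist_pos.2 (hempty p.1 p.2 hp), fun x x' h => not_le.1 fun h' => ?_⟩
    exact (hmin (show (x, x') ∈ {p : K × K | r ≤ dist p.1 p.2} from h')).not_gt h

/-! ## From covers to factorizations -/

theorem SimpleOdCover.nonempty_of_le {K : Type*} [MetricSpace K] {m : ℕ} (C : SimpleOdCover K m)
    {a : Fin m} {b : ℕ} (hb : b ≤ C.μ a) : (C.U a b).Nonempty := by
  rcases Nat.eq_zero_or_pos b with rfl | h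
  · rw [C.base]
    exact C.nonempty₀
  · exact C.nonempty' a b h hb

theorem SimpleOdCover.isOpen_of_le {K : Type*} [MetricSpace K] {m : ℕ} (C : SimpleOdCover K m)
    {a : Fin m} {b : ℕ} (hb : b ≤ C.μ a) : IsOpen (C.U a b) := by
  rcases Nat.eq_zero_or_pos b with rfl | h
  · rw [C.base]
    exact C.isOpen₀
  · exact C.isOpen' a b h hb

theorem SimpleOdCover.diam_lt {K : Type*} [MetricSpace K] {m : ℕ} {C : SimpleOdCover K m} {ε : ℝ}
    (hC : C.MeshLT ε) {a : Fin m} {b : ℕ} (hb : b ≤ C.μ a) : Metric.diam (C.U a b) < ε := by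
  rcases Nat.eq_zero_or_pos b with rfl | h
  · rw [C.base]
    exact hC.1
  · exact hC.2 a b h hb

theorem SimpleOdCover.exists_mem {K : Type*} [MetricSpace K] {m : ℕ} (C : SimpleOdCover K m)
    (a₀ : Fin m) (x : K) : ∃ u : Fin m × ℕ, u.2 ≤ C.μ u.1 ∧ x ∈ C.U u.1 u.2 := by
  have h : x ∈ C.U₀ ∪ ⋃ i, ⋃ j ∈ Set.Icc 1 (C.μ i), C.U i j := C.covers ▸ Set.mem_univ x
  rcases h with h | h
  · exact ⟨(a₀, 0), Nat.zero_le _, by rw [C.base]; exact h⟩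
  · simp only [Set.mem_iUnion] at h
    obtain ⟨a, b, hb, h⟩ := h
    exact ⟨(a, b), hb.2, h⟩

/-- A cover by sets with small images in the model induces a map of zones. -/
theorem SimpleOdCover.exists_zone_map {K : Type*} [MetricSpace K] [Nonempty K] {m n : ℕ} {k : Fin n → ℕ}
    (C : SimpleOdCover K m) (f : K → OdSpace k)
    (hf : ∀ a b, b ≤ C.μ a → ∀ x ∈ C.U a b, ∀ x' ∈ C.U a b, dist (f x) (f x') < 1 / 20) :
    ∃ h : Fin m × ℕ → Fin n × ℕ, (∀ u v, OdNear u v → OdNear (h u) (h v)) ∧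
      (∀ a a', h (a, 0) = h (a', 0)) ∧ (∀ u, (h u).2 ≤ 2 * k (h u).1) ∧
      ∀ a b, b ≤ C.μ a → ∀ x ∈ C.U a b, ∃ z, dist z (f x) < 1 / 20 ∧ h (a, b) = odZone z := by
  have hp : ∀ S : Set K, ∃ x, S.Nonempty → x ∈ S := fun S => by
    rcases S.eq_empty_or_nonempty with rfl | ⟨x, hx⟩
    · exact ⟨Classical.arbitrary K, fun h => absurd h (by simp)⟩
    · exact ⟨x, fun _ => hx⟩
  choose p hp using hp
  have hpU : ∀ {a b}, b ≤ C.μ a → p (C.U a b) ∈ C.U a b := fun hb => hp _ (C.nonempty_of_le hb)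
  have hzero : ∀ a a', odZone (f (p (C.U a (min 0 (C.μ a))))) =
      odZone (f (p (C.U a' (min 0 (C.μ a'))))) := fun a a' => by
    rw [Nat.zero_min, Nat.zero_min, C.base, C.base]
  refine ⟨fun u => odZone (f (p (C.U u.1 (min u.2 (C.μ u.1))))), fun u v h => ?_, hzero,
    fun u => odZone_le _, fun a b hb x hx => ⟨f (p (C.U a b)), hf a b hb _ (hpU hb) x hx, by
      simp only [min_eq_left hb]⟩⟩
  refine OdNear.map_of_step (f := fun u => odZone (f (p (C.U u.1 (min u.2 (C.μ u.1))))))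
    (fun a b => odNear_odZone ?_) (fun a a' => Or.inl (hzero a a')) h
  have hb : min b (C.μ a) ≤ C.μ a := min_le_right _ _
  have hb' : min (b + 1) (C.μ a) ≤ C.μ a := min_le_right _ _
  obtain ⟨y, hy, hy'⟩ := (C.inter_iff a _ a _ hb hb').2 (Or.inl ⟨rfl, by omega, by omega⟩)
  have h1 := hf a _ hb _ (hpU hb) y hy
  have h2 := hf a _ hb' y hy' _ (hpU hb')
  exact (dist_triangle _ (f y) _).trans_lt (by linarith)

/-- A simplicial map to a simple-`n`-od factors through a simple-`m`-od as soon as the zones of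
its values factor through the combinatorial simple-`m`-od. -/
theorem IsSimpleOdWith.exists_factorization {G V : Type*} [MetricSpace G] [TopologicalSpace V]
    [T2Space V] {Γ : GraphData G} {Δ : GraphData V} {m n : ℕ} {k : Fin n → ℕ} {t : Fin n → ℕ → V}
    {x : V} (hΔ : IsSimpleOdWith Δ n x k t) (hΓ : Γ.IsGraph) {φ : G → V}
    (hφ : IsSimplicialMap Γ Δ φ) {κ : V → OdSpace k} (hκ : IsSimplicialMap Δ (odGraph k) κ)
    (hκt : ∀ a q, q ≤ k a → κ (t a q) = odPoint k a q) (a₀ : Fin m) {u : G → Fin m × ℕ} {δ : ℝ}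
    (hδ : 0 < δ) (hu : ∀ y y', dist y y' < δ → OdNear (u y) (u y'))
    {h : Fin m × ℕ → Fin n × ℕ} (hnear : ∀ u v, OdNear u v → OdNear (h u) (h v))
    (hzero : ∀ a, (h (a, 0)).2 = 0) (hk : ∀ u, (h u).2 ≤ 2 * k (h u).1)
    (hz : ∀ y, ∃ z, dist z (κ (φ y)) < 1 / 20 ∧ h (u y) = odZone z) :
    ∃ l : Fin m → ℕ, (∀ a, 1 ≤ l a) ∧ ∃ (α : G → OdSpace l) (β : OdSpace l → V),
      IsSimplicialMap Γ (odGraph l) α ∧ IsSimplicialMap (odGraph l) Δ β ∧ β ∘ α = φ ∧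
        β (odPoint l a₀ 0) = x := by
  set c : Fin m × ℕ → V ⊕ Sym2 V := fun v => odCell t (h v) with hc
  have ht : ∀ a a', t a 0 = t a' 0 := fun a a' => by rw [hΔ.2.2.1, hΔ.2.2.1]
  have hc0 : ∀ a, c (a, 0) = Sum.inl x := fun a => by
    simp only [hc, odCell, hzero, hΔ.2.2.1, Nat.zero_mod, Nat.zero_div, if_true]
  have hcc : ∀ v w, OdNear v w → ZoneCompat (c v) (c w) := fun v w hvw =>
    (hnear v w hvw).zoneCompat ht
  have hcadj : ∀ u v w, c u = Sum.inr s(v, w) → Δ.Adj v w := fun u v w => hΔ.adj_of_odCell (hk u)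
  have hxv : x ∈ Δ.verts := by
    rw [← Finset.mem_coe, hΔ.2.2.2.1]
    exact Or.inl rfl
  have hstep := odLabel_step hc0 hcc hcadj
  have hLv : ∀ a b, odLabel x c a b ∈ Δ.verts := by
    intro a b
    induction b with
    | zero => exact hxv
    | succ b ih =>
      rcases hstep a b with e | ⟨e, he⟩
      · rwa [← e]
      · rcases Set.pair_eq_pair_iff.1 he with ⟨-, e1⟩ | ⟨e1, -⟩
        · rw [← e1]; exact hΔ.1.2.2.2.1 e
        · rw [← e1]; exact hΔ.1.2.2.1 e
  have hcell : ∀ {y A p}, OdEq (h (u y)) (A, p) → c (u y) = odCell t (A, p) := fun e =>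
    e.odCell_eq ht
  have hpos : ∀ {y A r}, κ (φ y) = odPoint k A r → r ∈ Set.Icc (0 : ℝ) (k A) →
      ∃ p : ℕ, c (u y) = odCell t (A, p) ∧ 2 * r - 3 / 5 < p ∧ p < 2 * r + 3 / 5 := by
    intro y A r e hr
    obtain ⟨z, hz, hzu⟩ := hz y
    rw [Subtype.dist_eq, e, coe_odPoint hr] at hz
    obtain ⟨p, hp, hp'⟩ := exists_odEq_odZone hr.1 hz
    exact ⟨p, hcell (hzu ▸ hp), hp'⟩
  have hposv : ∀ {y A} {q : ℕ}, q ≤ k A → κ (φ y) = odPoint k A q →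
      c (u y) = Sum.inl (t A q) := by
    intro y A q hq e
    obtain ⟨p, hp, h1, h2⟩ := hpos e ⟨Nat.cast_nonneg _, by exact_mod_cast hq⟩
    have h1 : 2 * q < p + 1 := by
      have : ((2 * q : ℕ) : ℝ) < (p + 1 : ℕ) := by push_cast; linarith
      exact_mod_cast this
    have h2 : p < 2 * q + 1 := by
      have : (p : ℝ) < (2 * q + 1 : ℕ) := by push_cast; linarith
      exact_mod_cast this
    rw [hp, show p = 2 * q by omega, odCell_two_mul]
  have hpose : ∀ {y A} {q : ℕ} {r : ℝ}, q + 1 ≤ k A → (q : ℝ) ≤ r → r ≤ q + 1 →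
      κ (φ y) = odPoint k A r →
      (r ≤ q + 1 / 2 → c (u y) = Sum.inl (t A q) ∨ c (u y) = Sum.inr s(t A q, t A (q + 1))) ∧
      (q + 1 / 2 ≤ r →
        c (u y) = Sum.inl (t A (q + 1)) ∨ c (u y) = Sum.inr s(t A q, t A (q + 1))) := by
    intro y A q r hq hr hr' e
    have hqA : (q : ℝ) + 1 ≤ k A := by exact_mod_cast hq
    obtain ⟨p, hp, h1, h2⟩ := hpos e ⟨(Nat.cast_nonneg _).trans hr, hr'.trans hqA⟩
    have hge : 2 * q ≤ p := by
      have : ((2 * q : ℕ) : ℝ) < (p + 1 : ℕ) := by push_cast; linarith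
      have : 2 * q < p + 1 := by exact_mod_cast this
      omega
    have hle : p ≤ 2 * q + 2 := by
      have : (p : ℝ) < (2 * q + 2 + 1 : ℕ) := by push_cast; linarith
      have : p < 2 * q + 2 + 1 := by exact_mod_cast this
      omega
    rw [hp]
    obtain rfl | rfl | rfl : p = 2 * q ∨ p = 2 * q + 1 ∨ p = 2 * (q + 1) := by omega
    · rw [odCell_two_mul]
      refine ⟨fun _ => Or.inl rfl, fun h3 => ?_⟩
      push_cast at h1
      linarith
    · rw [odCell_two_mul_add_one]
      exact ⟨fun _ => Or.inr rfl, fun _ => Or.inr rfl⟩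
    · rw [odCell_two_mul]
      refine ⟨fun h3 => ?_, fun _ => Or.inl rfl⟩
      push_cast at h2
      linarith
  have a₁ : Fin n := (h (a₀, 0)).1
  have hvert : ∀ y ∈ Γ.verts, c (u y) = Sum.inl (φ y) := by
    intro y hy
    obtain ⟨A, q, hq, e⟩ := hΔ.exists_eq a₁ (hφ.2.1 y hy)
    rw [e]
    exact hposv hq (by rw [e, hκt A q hq])
  have hedge : ∀ e, OdNear (odContract x c (u (Γ.edge e 0))) (odContract x c (u (Γ.edge e 1))) := by
    intro e
    obtain ⟨η, hη, hunif⟩ := Metric.uniformContinuousOn_iff.1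
      (isCompact_Icc.uniformContinuousOn_of_continuous (hΓ.1 e)) δ hδ
    obtain ⟨N, hN⟩ := exists_nat_gt (1 / η)
    have hN0 : (0 : ℝ) < N := (one_div_pos.2 hη).trans hN
    have hmem : ∀ i ≤ 2 * N, (i : ℝ) / (2 * N) ∈ Set.Icc (0 : ℝ) 1 := fun i hi =>
      ⟨by positivity, (div_le_one (by positivity)).2 (by exact_mod_cast hi)⟩
    have hwalk : ∀ i < 2 * N, OdNear (u (Γ.edge e ((i : ℝ) / (2 * N))))
        (u (Γ.edge e (((i + 1 : ℕ) : ℝ) / (2 * N)))) := by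
      intro i hi
      refine hu _ _ (hunif _ (hmem i hi.le) _ (hmem (i + 1) hi) ?_)
      have h1 : (i : ℝ) / (2 * N) - ((i + 1 : ℕ) : ℝ) / (2 * N) = -(1 / (2 * N)) := by
        push_cast
        field_simp
        ring
      rw [Real.dist_eq, h1, abs_neg, abs_of_pos (by positivity), div_lt_iff₀ (by positivity)]
      rw [div_lt_iff₀ hη] at hN
      linarith
    have hw0 : Γ.edge e (((0 : ℕ) : ℝ) / (2 * N)) = Γ.edge e 0 := by simp
    have hw1 : Γ.edge e (((2 * N : ℕ) : ℝ) / (2 * N)) = Γ.edge e 1 := by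
      congr 1
      push_cast
      exact div_self (by positivity)
    have hfirst : ∀ i ≤ N, (i : ℝ) / (2 * N) ≤ 1 / 2 := fun i hi => by
      have : (i : ℝ) ≤ N := by exact_mod_cast hi
      rw [div_le_iff₀ (by positivity)]
      linarith
    have hlast : ∀ i, N ≤ i → 1 / 2 ≤ (i : ℝ) / (2 * N) := fun i hi => by
      have : (N : ℝ) ≤ i := by exact_mod_cast hi
      rw [le_div_iff₀ (by positivity)]
      linarith
    have haff : ∀ s ∈ Set.Icc (0 : ℝ) 1, (κ (φ (Γ.edge e s)) : Fin n → ℝ) =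
        (1 - s) • (κ (φ (Γ.edge e 0)) : Fin n → ℝ) + s • (κ (φ (Γ.edge e 1)) : Fin n → ℝ) :=
      fun s hs => (hκ.comp hφ).odSpace_affine e hs
    have hline : ∀ {A} {q q' : ℕ}, q ≤ k A → q' ≤ k A → φ (Γ.edge e 0) = t A q →
        φ (Γ.edge e 1) = t A q' → ∀ s ∈ Set.Icc (0 : ℝ) 1,
        κ (φ (Γ.edge e s)) = odPoint k A ((1 - s) * q + s * q') := by
      intro A q q' hq hq' h0 h1 s hs
      have hqA : (q : ℝ) ≤ k A := by exact_mod_cast hq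
      have hqA' : (q' : ℝ) ≤ k A := by exact_mod_cast hq'
      have hq0 : (0 : ℝ) ≤ q := Nat.cast_nonneg _
      have hq0' : (0 : ℝ) ≤ q' := Nat.cast_nonneg _
      have hs' : 0 ≤ 1 - s := by linarith [hs.2]
      apply Subtype.ext
      rw [haff s hs, h0, h1, hκt A q hq, hκt A q' hq', coe_odPoint ⟨hq0, hqA⟩,
        coe_odPoint ⟨hq0', hqA'⟩, coe_odPoint ⟨by have := hs.1; positivity, by
          nlinarith [mul_le_mul_of_nonneg_left hqA hs', mul_le_mul_of_nonneg_left hqA' hs.1]⟩,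
        ← Pi.single_smul, ← Pi.single_smul, ← Pi.single_add, smul_eq_mul, smul_eq_mul]
    have hv0 := hvert _ (hΓ.2.2.1 e)
    have hv1 := hvert _ (hΓ.2.2.2.1 e)
    rcases hφ.eq_or_adj e with heq | hadj
    · obtain ⟨A, q, hq, e0⟩ := hΔ.exists_eq a₁ (hφ.2.1 _ (hΓ.2.2.1 e))
      have := odNear_odContract_of_constant_walk hc0
        (u := fun i => u (Γ.edge e ((i : ℝ) / (2 * N)))) (v := t A q) hwalk fun i hi => by
          refine hposv hq ?_
          rw [hline hq hq e0 (heq ▸ e0) _ (hmem i hi)]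
          congr 1
          ring
      simp only [hw0, hw1] at this
      exact this
    · obtain ⟨A, q, hq, he⟩ := (hΔ.2.2.2.2.2.2 _ _).1 hadj
      have hq' : q ≤ k A := by omega
      rcases Set.pair_eq_pair_iff.1 he with ⟨e0, e1⟩ | ⟨e0, e1⟩
      · have hpt : ∀ i ≤ 2 * N, κ (φ (Γ.edge e ((i : ℝ) / (2 * N)))) =
            odPoint k A (q + (i : ℝ) / (2 * N)) := fun i hi => by
          rw [hline hq' hq e0 e1 _ (hmem i hi)]
          congr 1
          push_cast
          ring
        have key := fun i (hi : i ≤ 2 * N) => hpose hq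
          (by linarith [(hmem i hi).1]) (by linarith [(hmem i hi).2]) (hpt i hi)
        have := odNear_odContract_of_walk hc0 (u := fun i => u (Γ.edge e ((i : ℝ) / (2 * N))))
          (v := t A q) (v' := t A (q + 1)) (e := s(t A q, t A (q + 1))) hwalk
          (by simp only [hw0]; rw [hv0, e0]) (by simp only [hw1]; rw [hv1, e1])
          (fun i hi => (key i (by omega)).1 (by linarith [hfirst i hi]))
          (fun i hi hi' => (key i hi).2 (by linarith [hlast i hi']))
        simp only [hw0, hw1] at this
        exact this
      · have hpt : ∀ i ≤ 2 * N, κ (φ (Γ.edge e ((i : ℝ) / (2 * N)))) =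
            odPoint k A (q + 1 - (i : ℝ) / (2 * N)) := fun i hi => by
          rw [hline hq hq' e0 e1 _ (hmem i hi)]
          congr 1
          push_cast
          ring
        have key := fun i (hi : i ≤ 2 * N) => hpose hq
          (by linarith [(hmem i hi).2]) (by linarith [(hmem i hi).1]) (hpt i hi)
        have := odNear_odContract_of_walk hc0 (u := fun i => u (Γ.edge e ((i : ℝ) / (2 * N))))
          (v := t A (q + 1)) (v' := t A q) (e := s(t A q, t A (q + 1))) hwalk
          (by simp only [hw0]; rw [hv0, e0]) (by simp only [hw1]; rw [hv1, e1])
          (fun i hi => (key i (by omega)).2 (by linarith [hfirst i hi]))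
          (fun i hi hi' => (key i hi).1 (by linarith [hlast i hi']))
        simp only [hw0, hw1] at this
        exact this
  set B : ℕ := Γ.verts.sup fun y => (u y).2 with hB
  have hBle : ∀ y ∈ Γ.verts, (u y).2 ≤ B := fun y hy => Finset.le_sup (f := fun y => (u y).2) hy
  set l : Fin m → ℕ := fun _ => B + 1 with hl
  have hl1 : ∀ a, 1 ≤ l a := fun _ => Nat.succ_pos B
  have hcl : ∀ y ∈ Γ.verts, (odContract x c (u y)).2 ≤ l (odContract x c (u y)).1 :=
    fun y hy => (changeCount_le _ _).trans ((hBle y hy).trans (Nat.le_succ B))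
  choose F hFL hFstep hFrange using fun a =>
    exists_contracted_sequence (odLabel x c a) Δ.Adj (hstep a) B
  have hF0 : ∀ a, F a 0 = x := fun a => hFL a 0 (Nat.zero_le _)
  have hod := isSimpleOdWith_odGraph hl1 a₀
  obtain ⟨β, hβ, hβF⟩ := hod.exists_simplicial hΔ.1 F (fun a a' => by rw [hF0, hF0])
    (fun a q _ => by
      obtain ⟨b, hb⟩ := hFrange a q
      rw [← hb]
      exact hLv a b) (fun a q _ => hFstep a q)
  obtain ⟨α, hα, hαψ⟩ := hΓ.exists_simplicial_extension hod.1
    (fun y => odPoint l (odContract x c (u y)).1 (odContract x c (u y)).2)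
    (fun y hy => mem_verts_odGraph.2 ⟨_, _, hcl y hy, rfl⟩)
    (fun e => eq_or_adj_odGraph (hcl _ (hΓ.2.2.1 e)) (hcl _ (hΓ.2.2.2.1 e)) (hedge e))
  refine ⟨l, hl1, α, β, hα, hβ, ?_, ?_⟩
  · refine (hβ.comp hα).ext_of_verts hΓ hΔ.1 hφ fun y hy => ?_
    rw [Function.comp_apply, hαψ y hy, hβF _ _ (hcl y hy)]
    exact (hFL _ _ (hBle y hy)).trans (odLabel_of_inl hc0 (hvert y hy))
  · have := hβF a₀ 0 (Nat.zero_le _)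
    rw [Nat.cast_zero] at this
    rw [this, hF0]

/-- Let `n ≥ 3` and let `K` be a continuum homeomorphic to the inverse
limit of simple-`n`-od graphs `X i` with surjective simplicial bonding maps `Φ i`.
If `K` is simple-`(n-1)`-od-like in the covering sense, then for every `i` there are
`j = i + k > i`, `1 ≤ n' ≤ n - 1`, a simple-`n'`-od graph `T` with branch point `t₀`
and simplicial maps `α : X j → T`, `β : T → X i` with `β ∘ α = Φ_i^j` and
`β t₀ = x₀ i`, the branch point of `X i`. -/
theorem statement2 {K : Type*} [MetricSpace K] [CompactSpace K] [ConnectedSpace K]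
    [Nonempty K] (n : ℕ) (hn : 3 ≤ n)
    (X : ℕ → Type) [∀ i, MetricSpace (X i)] [∀ i, CompactSpace (X i)]
    [∀ i, ConnectedSpace (X i)] [∀ i, Nonempty (X i)]
    (Γ : ∀ i, GraphData (X i)) (x₀ : ∀ i, X i)
    (hΓ : ∀ i, IsSimpleOdGraphData (Γ i) n (x₀ i))
    (Φ : ∀ i, X (i + 1) → X i)
    (hΦ : ∀ i, IsSimplicialMap (Γ (i + 1)) (Γ i) (Φ i))
    (hΦsurj : ∀ i, Function.Surjective (Φ i))
    (hK : Nonempty (K ≃ₜ InvLimit Φ))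
    (hlike : SimpleOdLikeCov K (n - 1)) :
    ∀ i : ℕ, ∃ k : ℕ, 0 < k ∧ ∃ n' : ℕ, 1 ≤ n' ∧ n' ≤ n - 1 ∧
      ∃ (T : Type) (_ : MetricSpace T), CompactSpace T ∧ ConnectedSpace T ∧
        ∃ (Δ : GraphData T) (t₀ : T), IsSimpleOdGraphData Δ n' t₀ ∧
          ∃ (α : X (i + k) → T) (β : T → X i),
            IsSimplicialMap (Γ (i + k)) Δ α ∧ IsSimplicialMap Δ (Γ i) β ∧
            β ∘ α = bondIter Φ i k ∧ β t₀ = x₀ i := by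
  intro i
  obtain ⟨l, t, hod⟩ := hΓ i
  obtain ⟨f⟩ := hK
  have hm : 2 ≤ n - 1 := by omega
  let a₀ : Fin (n - 1) := ⟨0, by omega⟩
  let a₁ : Fin n := ⟨0, by omega⟩
  have hmodel := isSimpleOdWith_odGraph hod.2.1 a₁
  obtain ⟨κ, hκ, hκt⟩ := hod.exists_simplicial hmodel.1 (fun a q => odPoint l a q)
    (fun a a' => by simpa using odPoint_zero a a') (fun a q hq => hmodel.mem_verts hq)
    (fun a q hq => Or.inr (hmodel.adj hq))
  have hproj : ∀ j, Continuous fun x => (f x).1 j := fun j =>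
    (continuous_apply j).comp (continuous_subtype_val.comp f.continuous)
  obtain ⟨ε, hε, hεf⟩ := Metric.uniformContinuous_iff.1
    (CompactSpace.uniformContinuous_of_continuous (hκ.1.comp (hproj i))) (1 / 20) (by norm_num)
  obtain ⟨C, hC⟩ := hlike ε hε
  obtain ⟨h, hnear, hzero, hbound, hzone⟩ := C.exists_zone_map (fun x => κ ((f x).1 i))
    fun a b hb x hx x' hx' => hεf ((Metric.dist_le_diam_of_mem (Metric.isBounded_of_compactSpace)
      hx hx').trans_lt (C.diam_lt hC hb))
  obtain ⟨g, h', hg, hnear', hzero', hbound', hgh⟩ := exists_folding hm (fun a => 2 * l a)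
    hnear hzero hbound
  obtain ⟨r, hr, hleb⟩ := lebesgue_number_lemma_of_metric (s := Set.univ) isCompact_univ
    (c := fun u : {u : Fin (n - 1) × ℕ // u.2 ≤ C.μ u.1} => C.U u.1.1 u.1.2)
    (fun u => C.isOpen_of_le u.2) fun x _ => by
      obtain ⟨u, hu, hx⟩ := C.exists_mem a₀ x
      exact Set.mem_iUnion.2 ⟨⟨u, hu⟩, hx⟩
  obtain ⟨k, hk, δ, hδ, hfib⟩ := exists_dist_lt_of_dist_proj_lt f i hr
  have hpoint : ∀ y : X (i + k), ∃ x, (f x).1 (i + k) = y := fun y => by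
    obtain ⟨x, hx⟩ := exists_thread Φ hΦsurj (i + k) y
    exact ⟨f.symm x, by rw [f.apply_symm_apply, hx]⟩
  choose p hp using hpoint
  choose w hw using fun y => hleb (p y) (Set.mem_univ _)
  obtain ⟨_, _, hodk⟩ := hΓ (i + k)
  obtain ⟨l', hl', α, β, hα, hβ, hαβ, hβ0⟩ := hod.exists_factorization hodk.1
    (isSimplicialMap_bondIter hΦ i k) hκ hκt a₀ (u := fun y => g (w y).1) hδ
    (fun y y' hyy => hg _ _ ((C.inter_iff _ _ _ _ (w y).2 (w y').2).1 ⟨p y',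
      hw y (Metric.mem_ball'.2 (hfib _ _ (by rwa [hp, hp]))), hw y' (Metric.mem_ball_self hr)⟩))
    hnear' hzero' hbound' fun y => by
      obtain ⟨z, hz, hz'⟩ := hzone _ _ (w y).2 (p y) (hw y (Metric.mem_ball_self hr))
      refine ⟨z, ?_, by rw [hgh]; exact hz'⟩
      rwa [← (f (p y)).bondIter_eq i k, hp] at hz
  have hcpt : CompactSpace (OdSpace l') := isCompact_iff_compactSpace.1 (isCompact_odSpace l')
  have hconn : ConnectedSpace (OdSpace l') :=
    isConnected_iff_connectedSpace.1 (isConnected_odSpace l' a₀)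
  exact ⟨k, hk, n - 1, by omega, le_rfl, OdSpace l', inferInstance, hcpt, hconn, odGraph l',
    odPoint l' a₀ 0, ⟨l', _, isSimpleOdWith_odGraph hl' a₀⟩, α, β, hα, hβ, hαβ, hβ0⟩
end
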